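/- There exist a constant c > 0 and N such that for all n ≥ N and every injective map π : Fin n → ℝ², the number of trees on vertex set Fin n (connected acyclic simple graphs) that admit a polyline drawing with vertex mapping π having total number of bends at most c·n² is at most 2^{−n}·n^{n−2}. (Since the number of labeled trees on n vertices is n^{n−2}, a uniformly random labeled tree requires more than c·n² bends with probability at least 1 − 2^{−n}.) -/

import Mathlib

open Finset
open scoped Classical

noncomputable section

/-- The polyline traced by a list of points: the union of the closed segments
between consecutive points. -/
def polylineOf (pts : List (ℝ × ℝ)) : Set (ℝ × ℝ) :=
  ⋃ p ∈ pts.zip pts.tail, segment ℝ p.1 p.2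

/-- The curve drawn for the edge `{u, v}`: the polyline through
`π u`, the bend points assigned to `(u, v)`, and `π v`. -/
def edgeCurve {n : ℕ} (π : Fin n → ℝ × ℝ) (bends : Fin n → Fin n → List (ℝ × ℝ))
    (u v : Fin n) : Set (ℝ × ℝ) :=
  polylineOf (π u :: (bends u v ++ [π v]))

/-- `bends` is a polyline drawing of `G` with vertex mapping `π`:
each edge `{u,v}` of `G` is assigned the finite sequence of bend points `bends u v`
(recorded consistently in both directions); the polyline of every edge is a simple
arc from `π u` to `π v`; the polylines of two distinct edges intersect exactly in
the images under `π` of the shared endpoints; and no polyline passes through the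
image of a vertex that is not an endpoint of its edge. -/
structure IsPolylineDrawing {n : ℕ} (G : SimpleGraph (Fin n)) (π : Fin n → ℝ × ℝ)
    (bends : Fin n → Fin n → List (ℝ × ℝ)) : Prop where
  symm : ∀ u v : Fin n, bends v u = (bends u v).reverse
  arc : ∀ u v : Fin n, G.Adj u v → ∃ γ : ℝ → ℝ × ℝ,
    ContinuousOn γ (Set.Icc 0 1) ∧ Set.InjOn γ (Set.Icc 0 1) ∧
    γ 0 = π u ∧ γ 1 = π v ∧ γ '' Set.Icc 0 1 = edgeCurve π bends u v
  inter : ∀ u v x y : Fin n, G.Adj u v → G.Adj x y → s(u, v) ≠ s(x, y) →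
    edgeCurve π bends u v ∩ edgeCurve π bends x y =
      π '' (({u, v} : Set (Fin n)) ∩ ({x, y} : Set (Fin n)))
  noVertex : ∀ u v w : Fin n, G.Adj u v → w ≠ u → w ≠ v →
    π w ∉ edgeCurve π bends u v

/-- The total number of bends of a drawing: the sum over all edges of the number
of bend points of that edge (each unordered edge is counted once, hence the
division by 2 of the sum over ordered pairs). -/
def totalBends {n : ℕ} (G : SimpleGraph (Fin n))
    (bends : Fin n → Fin n → List (ℝ × ℝ)) : ℝ :=
  (∑ u : Fin n, ∑ v : Fin n,
    if G.Adj u v then ((bends u v).length : ℝ) else 0) / 2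

/-- `b` and `t` are consecutive in `l`. -/
def Cons {α : Type*} (l : List α) (b t : α) : Prop := ∃ p q, l = p ++ b :: t :: q

theorem Cons.mem_left {α : Type*} {l : List α} {b t : α} (h : Cons l b t) : b ∈ l := by
  obtain ⟨p, q, rfl⟩ := h; simp

theorem Cons.mem_right {α : Type*} {l : List α} {b t : α} (h : Cons l b t) : t ∈ l := by
  obtain ⟨p, q, rfl⟩ := h; simp

theorem not_cons_nil {α : Type*} {b t : α} : ¬ Cons ([] : List α) b t := by
  rintro ⟨p, q, h⟩; simp at h

theorem not_cons_singleton {α : Type*} {a b t : α} : ¬ Cons [a] b t := by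
  rintro ⟨p, q, h⟩
  have := congrArg List.length h
  simp at this
  omega

theorem cons_cons_iff {α : Type*} {a c b t : α} {l : List α} :
    Cons (a :: c :: l) b t ↔ (a = b ∧ c = t) ∨ Cons (c :: l) b t := by
  constructor
  · rintro ⟨p, q, h⟩
    cases p with
    | nil => left; simp at h; exact ⟨h.1, h.2.1⟩
    | cons d p => right; simp at h; exact ⟨p, q, h.2⟩
  · rintro (⟨rfl, rfl⟩ | ⟨p, q, h⟩)
    · exact ⟨[], l, rfl⟩
    · exact ⟨a :: p, q, by simp [h]⟩

theorem cons_append_iff {α : Type*} {l₁ l₂ : List α} {a b t : α} :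
    Cons (l₁ ++ a :: l₂) b t ↔ Cons (l₁ ++ [a]) b t ∨ Cons (a :: l₂) b t := by
  induction l₁ with
  | nil => simp [not_cons_singleton]
  | cons d l₁ ih =>
    cases l₁ with
    | nil => simp [cons_cons_iff, not_cons_singleton]
    | cons e l₁ =>
      simp only [List.cons_append, cons_cons_iff] at ih ⊢
      rw [ih]; tauto

theorem Cons.mem_of_concat {α : Type*} {l : List α} {b t z : α} (h : Cons (l ++ [z]) b t) :
    b ∈ l := by
  obtain ⟨p, q, hpq⟩ := h
  rcases List.eq_nil_or_concat q with rfl | ⟨q', z', rfl⟩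
  · have : l ++ [z] = (p ++ [b]) ++ [t] := by simp [hpq]
    have := (List.append_inj' this rfl).1
    simp [this]
  · have : l ++ [z] = (p ++ b :: t :: q') ++ [z'] := by simp [hpq]
    have := (List.append_inj' this rfl).1
    simp [this]

theorem Cons.append_right {α : Type*} {l : List α} {b t : α} (h : Cons l b t) (l' : List α) :
    Cons (l ++ l') b t := by
  obtain ⟨p, q, rfl⟩ := h
  exact ⟨p, q ++ l', by simp⟩

theorem Cons.append_left {α : Type*} {l : List α} {b t : α} (h : Cons l b t) (l' : List α) :
    Cons (l' ++ l) b t := by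
  obtain ⟨p, q, rfl⟩ := h
  exact ⟨l' ++ p, q, by simp⟩

/-- The part of `l` after the first occurrence of `b`. -/
def after {α : Type*} (b : α) : List α → List α
  | [] => []
  | a :: l => if a = b then l else after b l

theorem after_append {α : Type*} {b : α} {p q : List α} (h : b ∉ p) :
    after b (p ++ b :: q) = q := by
  induction p with
  | nil => simp [after]
  | cons a p ih =>
    simp at h
    simp [after, Ne.symm h.1, ih h.2]

theorem after_append_of_mem {α : Type*} {b : α} {p q : List α} (h : b ∈ p) :
    after b (p ++ q) = after b p ++ q := by
  induction p with
  | nil => simp at h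
  | cons a p ih =>
    by_cases hab : a = b
    · simp [after, hab]
    · have : b ∈ p := by simpa [Ne.symm hab] using h
      simp [after, hab, ih this]

theorem after_append_of_not_mem {α : Type*} {b : α} {p q : List α} (h : b ∉ p) :
    after b (p ++ q) = after b q := by
  induction p with
  | nil => simp
  | cons a p ih =>
    simp at h
    simp [after, Ne.symm h.1, ih h.2]

/-- Sum of `f` over consecutive pairs of a list. -/
def pairSum {α β : Type*} [AddCommMonoid β] (f : α → α → β) : List α → β
  | [] => 0
  | [_] => 0
  | a :: b :: l => f a b + pairSum f (b :: l)

theorem pairSum_append {α β : Type*} [AddCommMonoid β] (f : α → α → β) (l₁ : List α) (a : α)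
    (l₂ : List α) :
    pairSum f (l₁ ++ a :: l₂) = pairSum f (l₁ ++ [a]) + pairSum f (a :: l₂) := by
  induction l₁ with
  | nil => simp [pairSum]
  | cons d l₁ ih =>
    cases l₁ with
    | nil => simp [pairSum]
    | cons e l₁ =>
      simp only [List.cons_append, pairSum] at ih ⊢
      rw [ih, add_assoc]

theorem pairSum_congr {α β : Type*} [AddCommMonoid β] {f g : α → α → β} {l : List α}
    (h : ∀ b t, Cons l b t → f b t = g b t) : pairSum f l = pairSum g l := by
  induction l with
  | nil => rfl
  | cons a l ih =>
    cases l with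
    | nil => rfl
    | cons b l =>
      simp only [pairSum]
      rw [h a b ⟨[], l, rfl⟩, ih fun b' t' h' => h b' t' (cons_cons_iff.2 (Or.inr h'))]

theorem pairSum_tele {α : Type*} (u : α → ZMod 2) (a c : α) (l : List α) :
    pairSum (fun b t => u b + u t) (a :: (l ++ [c])) = u a + u c := by
  induction l generalizing a with
  | nil => simp [pairSum]
  | cons b l ih =>
    simp only [List.cons_append, pairSum]
    rw [ih]
    have : u b + u b = 0 := CharTwo.add_self_eq_zero _
    linear_combination this

theorem Cons.after_eq {α : Type*} {l : List α} {b t : α} (hn : l.Nodup) (h : Cons l b t) :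
    after b l = t :: after t l := by
  obtain ⟨p, q, rfl⟩ := h
  have hb : b ∉ p := by
    intro hb; rw [List.nodup_append] at hn
    exact hn.2.2 b hb b (by simp) rfl
  have ht : t ∉ p ++ [b] := by
    intro hb
    have : (p ++ [b] ++ t :: q).Nodup := by simpa using hn
    rw [List.nodup_append] at this
    exact this.2.2 t (by simpa using hb) t (by simp) rfl
  rw [after_append hb]
  have := after_append (q := q) ht
  simp only [List.append_assoc, List.singleton_append] at this
  rw [this]

theorem Cons.right_unique {α : Type*} {l : List α} {b t t' : α} (hn : l.Nodup) (h : Cons l b t)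
    (h' : Cons l b t') : t = t' := by
  have := h.after_eq hn
  rw [h'.after_eq hn] at this
  exact (List.cons.inj this).1.symm

theorem after_sublist {α : Type*} (b : α) (l : List α) : (after b l).Sublist l := by
  induction l with
  | nil => simp [after]
  | cons a l ih =>
    simp only [after]; split_ifs
    · simp
    · exact ih.cons a

theorem not_mem_after {α : Type*} {b : α} {l : List α} (hn : l.Nodup) : b ∉ after b l := by
  induction l with
  | nil => simp [after]
  | cons a l ih =>
    rw [List.nodup_cons] at hn
    simp only [after]; split_ifs with h
    · rw [← h]; exact hn.1
    · exact ih hn.2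

/-- In a duplicate free list with `b`, `t` consecutive, any element of the list other than `b`
has `b` after it iff it has `t` after it. -/
theorem Cons.mem_after_iff {α : Type*} {l : List α} {b t a : α} (hn : l.Nodup) (h : Cons l b t)
    (hab : a ≠ b) : b ∈ after a l ↔ t ∈ after a l := by
  obtain ⟨p, q, rfl⟩ := h
  by_cases ha : a ∈ p
  · simp [after_append_of_mem ha]
  · rw [after_append_of_not_mem ha]
    rw [List.nodup_append] at hn
    have hn' := hn.2.1
    simp only [List.nodup_cons, List.mem_cons] at hn'
    have h1 : after a (b :: t :: q) = after a (t :: q) := by simp [after, Ne.symm hab]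
    rw [h1]
    constructor
    · intro hb
      exact absurd ((after_sublist a (t :: q)).subset hb) (by simpa using hn'.1)
    · intro ht
      simp only [after] at ht
      split_ifs at ht
      · exact absurd ht hn'.2.1
      · exact absurd ((after_sublist a q).subset ht) hn'.2.1

/-- Combinatorial description of a planar system of `x`-monotone curves swept from left to
right. Vertex `i` lies between slabs `i` and `i + 1`. -/
structure Sweep (M : Type) where
  n : ℕ
  V : Finset ℕ
  A : ℕ → List M
  E : ℕ → List M
  S : ℕ → List M
  B : ℕ → List M
  bot : M
  top : M
  st : M → ℕ
  fi : M → ℕ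
  V_lt : ∀ i ∈ V, i < n
  step : ∀ i, A i ++ S i ++ B i = A (i + 1) ++ E (i + 1) ++ B (i + 1)
  line_zero : A 0 ++ E 0 ++ B 0 = [bot, top]
  line_n : A n ++ E n ++ B n = [bot, top]
  nodup : ∀ i, (A i ++ E i ++ B i).Nodup
  A_head : ∀ i, ∃ l, A i = bot :: l
  B_last : ∀ i, ∃ l, B i = l ++ [top]
  S_st : ∀ i, ∀ e ∈ S i, st e = i ∧ i ∈ V
  E_fi : ∀ i, ∀ e ∈ E i, fi e = i ∧ i ∈ V
  line_mem : ∀ k, ∀ e ∈ A k ++ E k ++ B k, e ≠ bot → e ≠ top → st e < k ∧ k ≤ fi e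

namespace Sweep

variable {M : Type} (s : Sweep M)

/-- The curves met by slab `k`, from bottom to top. -/
def line (k : ℕ) : List M := s.A k ++ s.E k ++ s.B k

/-- The curve just below vertex `i`. -/
def x (i : ℕ) : M := (s.A i).getLastD s.bot

/-- The curve just above vertex `i`. -/
def y (i : ℕ) : M := (s.B i).headD s.top

theorem exists_A (i : ℕ) : ∃ l, s.A i = l ++ [s.x i] := by
  obtain ⟨l, h⟩ := s.A_head i
  have hne : s.A i ≠ [] := by simp [h]
  refine ⟨(s.A i).dropLast, ?_⟩
  have := List.dropLast_append_getLast hne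
  rw [x, List.getLastD_eq_getLast?, List.getLast?_eq_getLast_of_ne_nil hne]
  simpa using this.symm

theorem exists_B (i : ℕ) : ∃ l, s.B i = s.y i :: l := by
  obtain ⟨l, h⟩ := s.B_last i
  cases hB : s.B i with
  | nil => simp [hB] at h
  | cons a l' => exact ⟨l', by simp [y, hB]⟩

theorem line_succ (i : ℕ) : s.line (i + 1) = s.A i ++ s.S i ++ s.B i := (s.step i).symm

theorem line_split (i : ℕ) : ∃ a b, s.A i = a ++ [s.x i] ∧ s.B i = s.y i :: b ∧
    s.line i = a ++ s.x i :: (s.E i ++ s.y i :: b) ∧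
    s.line (i + 1) = a ++ s.x i :: (s.S i ++ s.y i :: b) := by
  obtain ⟨a, ha⟩ := s.exists_A i
  obtain ⟨b, hb⟩ := s.exists_B i
  refine ⟨a, b, ha, hb, ?_, ?_⟩
  · simp [line, ha, hb]
  · simp [line_succ, ha, hb]

theorem line_nodup (k : ℕ) : (s.line k).Nodup := s.nodup k

theorem E_nil {i : ℕ} (h : i ∉ s.V) : s.E i = [] :=
  List.eq_nil_iff_forall_not_mem.2 fun e he => h (s.E_fi i e he).2

theorem S_nil {i : ℕ} (h : i ∉ s.V) : s.S i = [] :=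
  List.eq_nil_iff_forall_not_mem.2 fun e he => h (s.S_st i e he).2

theorem line_succ_of_not_mem {i : ℕ} (h : i ∉ s.V) : s.line (i + 1) = s.line i := by
  rw [line_succ, line, s.E_nil h, s.S_nil h]

theorem line_succ_zero : s.line 1 = s.bot :: (s.S 0 ++ [s.top]) := by
  have h := s.line_zero
  obtain ⟨a, ha⟩ := s.A_head 0
  obtain ⟨b, hb⟩ := s.B_last 0
  rw [ha, hb] at h
  have hl := congrArg List.length h
  simp at hl
  have ha' : a = [] := List.length_eq_zero_iff.1 (by omega)
  have hb' : b = [] := List.length_eq_zero_iff.1 (by omega)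
  rw [line_succ, ha, hb, ha', hb']; simp

theorem x_zero : s.x 0 = s.bot := by
  have h := s.line_zero
  obtain ⟨a, ha⟩ := s.A_head 0
  obtain ⟨b, hb⟩ := s.B_last 0
  rw [ha, hb] at h
  have hl := congrArg List.length h
  simp at hl
  have ha' : a = [] := List.length_eq_zero_iff.1 (by omega)
  simp [x, ha, ha']

theorem line_head (k : ℕ) : ∃ l, s.line k = s.bot :: (l ++ [s.top]) := by
  obtain ⟨a, ha⟩ := s.A_head k
  obtain ⟨b, hb⟩ := s.B_last k
  exact ⟨a ++ s.E k ++ b, by simp [line, ha, hb]⟩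

theorem mem_line_of_A {i : ℕ} {e : M} (h : e ∈ s.A i) : e ∈ s.line i := by simp [line, h]
theorem mem_line_of_E {i : ℕ} {e : M} (h : e ∈ s.E i) : e ∈ s.line i := by simp [line, h]
theorem mem_line_of_B {i : ℕ} {e : M} (h : e ∈ s.B i) : e ∈ s.line i := by simp [line, h]
theorem mem_line_succ_of_A {i : ℕ} {e : M} (h : e ∈ s.A i) : e ∈ s.line (i + 1) := by
  simp [line_succ, h]
theorem mem_line_succ_of_S {i : ℕ} {e : M} (h : e ∈ s.S i) : e ∈ s.line (i + 1) := by
  simp [line_succ, h]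
theorem mem_line_succ_of_B {i : ℕ} {e : M} (h : e ∈ s.B i) : e ∈ s.line (i + 1) := by
  simp [line_succ, h]

theorem x_mem_A (i : ℕ) : s.x i ∈ s.A i := by
  obtain ⟨a, ha⟩ := s.exists_A i; simp [ha]

theorem y_mem_B (i : ℕ) : s.y i ∈ s.B i := by
  obtain ⟨b, hb⟩ := s.exists_B i; simp [hb]

theorem bot_mem_A (i : ℕ) : s.bot ∈ s.A i := by
  obtain ⟨a, ha⟩ := s.A_head i; simp [ha]

theorem top_mem_B (i : ℕ) : s.top ∈ s.B i := by
  obtain ⟨a, ha⟩ := s.B_last i; simp [ha]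

theorem nodup_split (i : ℕ) : (s.A i).Nodup ∧ (s.E i).Nodup ∧ (s.B i).Nodup ∧
    (∀ a ∈ s.A i, a ∉ s.E i) ∧ (∀ a ∈ s.A i, a ∉ s.B i) ∧ (∀ a ∈ s.E i, a ∉ s.B i) := by
  have := s.nodup i
  simp only [List.nodup_append, List.mem_append] at this
  obtain ⟨⟨h1, h2, h3⟩, h4, h5⟩ := this
  exact ⟨h1, h2, h4, fun a ha hb => h3 a ha a hb rfl, fun a ha hb => h5 a (Or.inl ha) a hb rfl,
    fun a ha hb => h5 a (Or.inr ha) a hb rfl⟩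

theorem nodup_split' (i : ℕ) : (s.S i).Nodup ∧
    (∀ a ∈ s.A i, a ∉ s.S i) ∧ (∀ a ∈ s.S i, a ∉ s.B i) := by
  have := s.line_nodup (i + 1)
  rw [line_succ] at this
  simp only [List.nodup_append, List.mem_append] at this
  obtain ⟨⟨h1, h2, h3⟩, h4, h5⟩ := this
  exact ⟨h2, fun a ha hb => h3 a ha a hb rfl,
    fun a ha hb => h5 a (Or.inr ha) a hb rfl⟩

theorem ne_bot_of_E {i : ℕ} {e : M} (h : e ∈ s.E i) : e ≠ s.bot := by
  rintro rfl; exact (s.nodup_split i).2.2.2.1 _ (s.bot_mem_A i) h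

theorem ne_top_of_E {i : ℕ} {e : M} (h : e ∈ s.E i) : e ≠ s.top := by
  rintro rfl; exact (s.nodup_split i).2.2.2.2.2 _ h (s.top_mem_B i)

theorem ne_bot_of_S {i : ℕ} {e : M} (h : e ∈ s.S i) : e ≠ s.bot := by
  rintro rfl; exact (s.nodup_split' i).2.1 _ (s.bot_mem_A i) h

theorem ne_top_of_S {i : ℕ} {e : M} (h : e ∈ s.S i) : e ≠ s.top := by
  rintro rfl; exact (s.nodup_split' i).2.2 _ h (s.top_mem_B i)

theorem ne_top_of_A {i : ℕ} {e : M} (h : e ∈ s.A i) : e ≠ s.top := by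
  rintro rfl; exact (s.nodup_split i).2.2.2.2.1 _ h (s.top_mem_B i)

theorem ne_bot_of_B {i : ℕ} {e : M} (h : e ∈ s.B i) : e ≠ s.bot := by
  rintro rfl; exact (s.nodup_split i).2.2.2.2.1 _ (s.bot_mem_A i) h

/-- Incidence of a vertex with the curves bounding its neighbourhood. -/
def Con (j : ℕ) (e : M) : Prop :=
  j ∈ s.V ∧ (e = s.x j ∨ e ∈ s.E j ∨ e ∈ s.S j ∨ e = s.y j)

/-- The last vertex before slab `k` bounding the trapezoid above `b`. -/
def birth : ℕ → M → ℕ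
  | 0, _ => 0
  | k + 1, b => if k ∈ s.V ∧ (b = s.x k ∨ b ∈ s.S k) then k else birth k b

theorem con_range {j : ℕ} {e : M} (h : s.Con j e) (hb : e ≠ s.bot) (ht : e ≠ s.top) :
    s.st e ≤ j ∧ j ≤ s.fi e := by
  have key : ∀ k, e ∈ s.line k → s.st e < k ∧ k ≤ s.fi e := fun k hk => s.line_mem k e hk hb ht
  rcases h.2 with rfl | h | h | rfl
  · have := key j (s.mem_line_of_A (s.x_mem_A j)); omega
  · have := key j (s.mem_line_of_E h); omega
  · have := key _ (s.mem_line_succ_of_S h); omega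
  · have := key j (s.mem_line_of_B (s.y_mem_B j)); omega

theorem birth_spec (h0 : 0 ∈ s.V) {k : ℕ} (hk : 1 ≤ k) : ∀ {b t : M}, Cons (s.line k) b t →
    s.birth k b < k ∧ s.Con (s.birth k b) b ∧ s.Con (s.birth k b) t ∧
    (∀ k', s.birth k b < k' → k' ≤ k → Cons (s.line k') b t) ∧
    (∀ j ∈ s.V, s.birth k b < j → j < k → ¬ (b = s.x j ∨ b ∈ s.S j)) ∧
    (b = s.x (s.birth k b) ∨ b ∈ s.S (s.birth k b)) := by
  induction k with
  | zero => omega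
  | succ k ih =>
    intro b t hbt
    by_cases hkV : k ∈ s.V
    · obtain ⟨a, c, ha, hc, h1, h2⟩ := s.line_split k
      have hnd := s.line_nodup (k + 1)
      have hbt' := hbt
      by_cases hbx : b = s.x k ∨ b ∈ s.S k
      · have hbirth : s.birth (k + 1) b = k := by simp [birth, hkV, hbx]
        rw [hbirth]
        have hmid : Cons (s.x k :: (s.S k ++ [s.y k])) b t := by
          rw [h2, cons_append_iff] at hbt
          rcases hbt with h | h
          · exfalso
            have hx : b ∈ a := h.mem_of_concat
            rw [h2] at hnd
            rw [List.nodup_append] at hnd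
            rcases hbx with hbx | hbx
            · exact hnd.2.2 b hx b (by simp [hbx]) rfl
            · exact hnd.2.2 b hx b (by simp [hbx]) rfl
          · rw [← List.cons_append, cons_append_iff] at h
            rcases h with h | h
            · simpa using h
            · exfalso
              have hb : b ∈ s.B k := by rw [hc]; exact h.mem_left
              rcases hbx with rfl | hbx
              · exact (s.nodup_split k).2.2.2.2.1 _ (s.x_mem_A k) hb
              · exact (s.nodup_split' k).2.2 _ hbx hb
        have ht : t ∈ s.x k :: (s.S k ++ [s.y k]) := hmid.mem_right
        refine ⟨by omega, ⟨hkV, ?_⟩, ⟨hkV, ?_⟩, ?_, ?_, hbx⟩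
        · tauto
        · simp at ht; tauto
        · intro k' h h'
          have : k' = k + 1 := by omega
          rw [this]; exact hbt'
        · intro j hj h h'; omega
      · have hbirth : s.birth (k + 1) b = s.birth k b := by simp [birth, hbx]
        rw [hbirth]
        push Not at hbx
        have hk0 : k ≠ 0 := by
          rintro rfl
          rw [s.line_succ_zero] at hbt
          rw [s.x_zero] at hbx
          have : b ∈ s.bot :: s.S 0 := Cons.mem_of_concat (by simpa using hbt)
          simp at this; tauto
        have hold : Cons (s.line k) b t := by
          rw [h2, cons_append_iff] at hbt
          rw [h1, cons_append_iff]
          rcases hbt with h | h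
          · exact Or.inl h
          · right
            rw [← List.cons_append, cons_append_iff] at h ⊢
            rcases h with h | h
            · exfalso
              have : b ∈ s.x k :: s.S k := h.mem_of_concat
              simp at this; tauto
            · exact Or.inr h
        obtain ⟨i1, i2, i3, i4, i5, i6⟩ := ih (by omega) hold
        refine ⟨by omega, i2, i3, ?_, ?_, i6⟩
        · intro k' h h'
          rcases Nat.lt_or_ge k' (k + 1) with h'' | h''
          · exact i4 k' h (by omega)
          · have : k' = k + 1 := by omega
            rw [this]; exact hbt'
        · intro j hj h h'
          rcases Nat.lt_or_ge j k with h'' | h''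
          · exact i5 j hj h h''
          · have : j = k := by omega
            rw [this]; tauto
    · have hk0 : k ≠ 0 := by rintro rfl; exact hkV h0
      have hbirth : s.birth (k + 1) b = s.birth k b := by simp [birth, hkV]
      rw [hbirth]
      have hold := hbt
      rw [s.line_succ_of_not_mem hkV] at hold
      obtain ⟨i1, i2, i3, i4, i5, i6⟩ := ih (by omega) hold
      refine ⟨by omega, i2, i3, ?_, ?_, i6⟩
      · intro k' h h'
        rcases Nat.lt_or_ge k' (k + 1) with h'' | h''
        · exact i4 k' h (by omega)
        · have : k' = k + 1 := by omega
          rw [this]; exact hbt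
      · intro j hj h h'
        rcases Nat.lt_or_ge j k with h'' | h''
        · exact i5 j hj h h''
        · have : j = k := by omega
          rw [this] at hj; exact absurd hj hkV

end Sweep

namespace Sweep

variable {M : Type} (s : Sweep M)

/-- Crossing parity of the chain `C` above the gap over `b` in slab `k`. -/
def chi (C : ℕ → M → ZMod 2) (k : ℕ) (b : M) : ZMod 2 :=
  ((after b (s.line k)).map fun e => ∑ j ∈ range k, C j e).sum

theorem chi_add (C D : ℕ → M → ZMod 2) (k : ℕ) (b : M) :
    s.chi (C + D) k b = s.chi C k b + s.chi D k b := by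
  simp only [chi, Pi.add_apply, sum_add_distrib]
  rw [List.sum_map_add]

/-- The chain consisting of one connector. -/
def sg (j : ℕ) (e : M) : ℕ → M → ZMod 2 := fun j' e' => if j' = j ∧ e' = e then 1 else 0

theorem chi_sg (j : ℕ) (e : M) (k : ℕ) (b : M) :
    s.chi (sg j e) k b = if j < k ∧ e ∈ after b (s.line k) then 1 else 0 := by
  have hn : (after b (s.line k)).Nodup := (after_sublist b _).nodup (s.line_nodup k)
  rw [chi, ← List.sum_toFinset _ hn]
  have : ∀ e', (∑ j' ∈ range k, sg j e j' e') = if e' = e ∧ j < k then (1 : ZMod 2) else 0 := by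
    intro e'
    by_cases he : e' = e
    · simp [sg, he]
    · simp [sg, he]
  simp only [this]
  by_cases hj : j < k
  · simp [hj]
  · simp [hj]

theorem n_pos (h0 : 0 ∈ s.V) : 1 ≤ s.n := s.V_lt 0 h0

/-- The last vertex is the birth of the final gap. -/
theorem le_birth_n (h0 : 0 ∈ s.V) {j : ℕ} (hj : j ∈ s.V) :
    j ≤ s.birth s.n s.bot := by
  have hc : Cons (s.line s.n) s.bot s.top := by
    rw [line, s.line_n]; exact ⟨[], [], rfl⟩
  obtain ⟨i1, i2, i3, i4, i5, i6⟩ := s.birth_spec h0 (s.n_pos h0) hc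
  by_contra! hlt
  have hjn := s.V_lt j hj
  have h := i4 j hlt hjn.le
  have hx := i5 j hj hlt hjn
  obtain ⟨a, b, ha, hb, h1, h2⟩ := s.line_split j
  have hnd := s.line_nodup j
  obtain ⟨c, hc⟩ := s.exists_B j
  apply hx
  left
  obtain ⟨l, hl⟩ := s.A_head j
  rw [ha] at hl
  cases a with
  | nil => simp at hl; exact hl.1.symm
  | cons d a =>
    exfalso
    simp at hl
    obtain ⟨rfl, hl⟩ := hl
    cases a with
    | nil =>
      have h' : Cons (s.line j) s.bot (s.x j) := by
        rw [h1]; exact ⟨[], _, rfl⟩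
      have h'' := h.right_unique hnd h'
      exact s.ne_top_of_A (s.x_mem_A j) h''.symm
    | cons f a =>
      have h' : Cons (s.line j) s.bot f := by
        rw [h1]; exact ⟨[], _, rfl⟩
      have h'' := h.right_unique hnd h'
      have : f ∈ s.A j := by rw [ha]; simp
      exact s.ne_top_of_A this h''.symm

/-- The four-connector chain through two vertices and two curves. -/
def quad (i j : ℕ) (b t : M) : ℕ → M → ZMod 2 := sg j b + sg j t + (sg i b + sg i t)

theorem chi_quad (i j k : ℕ) (a b t : M) : s.chi (quad i j b t) k a =
    ((if j < k then 1 else 0) + (if i < k then 1 else 0)) *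
    ((if b ∈ after a (s.line k) then 1 else 0) + (if t ∈ after a (s.line k) then 1 else 0)) := by
  simp only [quad, chi_add, chi_sg]
  split_ifs <;> simp_all
  decide

/-- A `ZMod 2` valued function on connectors with the quadrilateral relations cannot
distinguish the first from the last gap. -/
theorem quad_sum (h0 : 0 ∈ s.V) (σ : ℕ → M → ZMod 2)
    (hσ : ∀ i ∈ s.V, 1 ≤ i → ∀ b t, Cons (s.line i) b t → s.Con i b → s.Con i t →
      σ (s.birth i b) b + σ (s.birth i b) t + (σ i b + σ i t) = 0) :
    σ 0 s.bot + σ 0 s.top =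
      σ (s.birth s.n s.bot) s.bot + σ (s.birth s.n s.bot) s.top := by
  have key : ∀ k, 1 ≤ k →
      pairSum (fun b t => σ (s.birth k b) b + σ (s.birth k b) t) (s.line k) =
      σ 0 s.bot + σ 0 s.top := by
    intro k hk
    induction k, hk using Nat.le_induction with
    | base =>
      rw [s.line_succ_zero, ← pairSum_tele (fun e => σ 0 e) s.bot s.top (s.S 0)]
      apply pairSum_congr
      intro b t hbt
      have : b ∈ s.bot :: s.S 0 := Cons.mem_of_concat (by simpa using hbt)
      have : s.birth 1 b = 0 := by simp [birth]
      simp [this]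
    | succ k hk ih =>
      rw [← ih]
      by_cases hkV : k ∈ s.V
      · obtain ⟨a, c, ha, hc, h1, h2⟩ := s.line_split k
        rw [h2, pairSum_append _ a (s.x k) (s.S k ++ s.y k :: c), ← List.cons_append,
          pairSum_append _ (s.x k :: s.S k) (s.y k) c, h1,
          pairSum_append _ a (s.x k) (s.E k ++ s.y k :: c), ← List.cons_append,
          pairSum_append _ (s.x k :: s.E k) (s.y k) c]
        have hna : ∀ b ∈ a, b ≠ s.x k ∧ b ∉ s.S k := by
          intro b hb
          have hbA : b ∈ s.A k := by rw [ha]; simp [hb]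
          refine ⟨?_, (s.nodup_split' k).2.1 b hbA⟩
          rintro rfl
          have := (s.nodup_split k).1
          rw [ha, List.nodup_append] at this
          exact this.2.2 _ hb _ (by simp) rfl
        have hnb : ∀ b ∈ s.B k, b ≠ s.x k ∧ b ∉ s.S k := by
          intro b hb
          refine ⟨?_, fun h => (s.nodup_split' k).2.2 b h hb⟩
          rintro rfl
          exact (s.nodup_split k).2.2.2.2.1 _ (s.x_mem_A k) hb
        congr 1
        · apply pairSum_congr
          intro b t hbt
          have : s.birth (k + 1) b = s.birth k b := by
            simp [birth, hna b hbt.mem_of_concat]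
          rw [this]
        · congr 1
          · trans σ k (s.x k) + σ k (s.y k)
            · rw [List.cons_append, ← pairSum_tele (fun e => σ k e)]
              apply pairSum_congr
              intro b t hbt
              have hb : b ∈ s.x k :: s.S k := Cons.mem_of_concat (by simpa using hbt)
              have : s.birth (k + 1) b = k := by
                simp only [birth, hkV, true_and]; rw [if_pos (by simpa using hb)]
              rw [this]
            · rw [List.cons_append, ← pairSum_tele (fun e => σ k e) (s.x k) (s.y k) (s.E k)]
              apply pairSum_congr
              intro b t hbt
              have hcl : Cons (s.line k) b t := by
                rw [h1]
                apply Cons.append_left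
                have := hbt.append_right c
                simpa using this
              have hb := hbt.mem_left
              have ht := hbt.mem_right
              simp only [List.mem_cons, List.mem_append, List.not_mem_nil, or_false] at hb ht
              have := hσ k hkV hk b t hcl ⟨hkV, by tauto⟩ ⟨hkV, by tauto⟩
              exact (CharTwo.add_eq_zero.1 this).symm
          · rw [← hc]
            apply pairSum_congr
            intro b t hbt
            have : s.birth (k + 1) b = s.birth k b := by
              simp [birth, hnb b hbt.mem_left]
            rw [this]
      · rw [s.line_succ_of_not_mem hkV]
        apply pairSum_congr
        intro b t hbt
        simp [birth, hkV]
  have := key s.n (s.n_pos h0)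
  rw [← this, line, s.line_n]
  simp [pairSum]

variable [Fintype M]

/-- The curves other than `bot` and `top`. -/
def segs : Finset M := univ.filter fun e => e ∈ s.S (s.st e)

/-- Vertices and curves. -/
def nodes : Finset (ℕ ⊕ M) := s.V.disjSum s.segs

/-- The gap just above a node. -/
def rep : ℕ ⊕ M → ℕ × M
  | .inl i => (i + 1, s.x i)
  | .inr e => (s.st e + 1, e)

theorem mem_segs {e : M} : e ∈ s.segs ↔ e ∈ s.S (s.st e) := by simp [segs]

theorem mem_segs_of_S {e : M} {i : ℕ} (h : e ∈ s.S i) : e ∈ s.segs := by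
  rw [mem_segs, (s.S_st i e h).1]; exact h

theorem inl_mem_nodes {i : ℕ} : Sum.inl i ∈ s.nodes ↔ i ∈ s.V := by simp [nodes]
theorem inr_mem_nodes {e : M} : Sum.inr e ∈ s.nodes ↔ e ∈ s.segs := by simp [nodes]

theorem chi_quad_eq_zero (h0 : 0 ∈ s.V) {i : ℕ} (hi : 1 ≤ i) {b t : M}
    (hc : Cons (s.line i) b t) : ∃ z₀, ∀ z ∈ s.nodes, z ≠ z₀ →
    s.chi (quad i (s.birth i b) b t) (s.rep z).1 (s.rep z).2 = 0 := by
  obtain ⟨i1, i2, i3, i4, i5, i6⟩ := s.birth_spec h0 hi hc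
  set β := s.birth i b with hβ
  have key : ∀ k a, s.chi (quad i β b t) k a ≠ 0 → β < k ∧ k ≤ i ∧ a = b := by
    intro k a h
    rw [chi_quad] at h
    have h1 := left_ne_zero_of_mul h
    have h2 := right_ne_zero_of_mul h
    have hk : β < k ∧ k ≤ i := by
      by_contra hcon
      apply h1
      by_cases hk : i < k
      · rw [if_pos hk, if_pos (by omega)]; decide
      · rw [if_neg hk, if_neg (by omega)]; decide
    refine ⟨hk.1, hk.2, ?_⟩
    by_contra hab
    apply h2
    have := (i4 k hk.1 hk.2).mem_after_iff (s.line_nodup k) hab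
    by_cases hb : b ∈ after a (s.line k)
    · rw [if_pos hb, if_pos (this.1 hb)]; decide
    · rw [if_neg hb, if_neg (fun h => hb (this.2 h))]; decide
  refine ⟨if b = s.x β then .inl β else .inr b, ?_⟩
  intro z hz hne
  by_contra h
  obtain ⟨h1, h2, h3⟩ := key _ _ h
  rcases z with j | e
  · simp only [rep] at h1 h2 h3
    rw [inl_mem_nodes] at hz
    have : j = β := by
      by_contra hjβ
      exact i5 j hz (by omega) (by omega) (Or.inl h3.symm)
    subst this
    rw [if_pos h3.symm] at hne
    exact hne rfl
  · simp only [rep] at h1 h2 h3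
    rw [inr_mem_nodes, mem_segs] at hz
    have hst : s.st e = β := by
      by_contra hjβ
      exact i5 _ (s.S_st _ _ hz).2 (by omega) (by omega) (Or.inr (h3 ▸ hz))
    rw [hst] at hz
    rw [if_neg] at hne
    · exact hne (by rw [h3])
    · intro hb
      exact (s.nodup_split' _).2.1 _ (s.x_mem_A _) (hb ▸ h3 ▸ hz)

theorem chi_quad_eq_one (h0 : 0 ∈ s.V) : ∃ z₀, ∀ z ∈ s.nodes, z ≠ z₀ →
    s.chi (quad 0 (s.birth s.n s.bot) s.bot s.top) (s.rep z).1 (s.rep z).2 = 1 := by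
  have hc : Cons (s.line s.n) s.bot s.top := by
    rw [line, s.line_n]; exact ⟨[], [], rfl⟩
  obtain ⟨i1, i2, i3, i4, i5, i6⟩ := s.birth_spec h0 (s.n_pos h0) hc
  set β := s.birth s.n s.bot with hβ
  have key : ∀ k a, 0 < k → k ≤ β → a ∈ s.line k → a ≠ s.top →
      s.chi (quad 0 β s.bot s.top) k a = 1 := by
    intro k a hk hkβ ha hat
    rw [chi_quad]
    obtain ⟨l, hl⟩ := s.line_head k
    have hnd := s.line_nodup k
    have hb : s.bot ∉ after a (s.line k) := by
      rw [hl] at hnd ⊢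
      rw [List.nodup_cons] at hnd
      intro h
      simp only [after] at h
      split_ifs at h
      · exact hnd.1 h
      · exact hnd.1 ((after_sublist _ _).subset h)
    have ht : s.top ∈ after a (s.line k) := by
      rw [hl] at ha ⊢
      have : a ∈ s.bot :: l := by
        simp only [List.mem_cons, List.mem_append, List.not_mem_nil, or_false] at ha ⊢
        tauto
      rw [← List.cons_append, after_append_of_mem this]
      simp
    rw [if_neg hb, if_pos ht, if_neg (by omega), if_pos hk]; decide
  refine ⟨.inl β, ?_⟩
  intro z hz hne
  rcases z with j | e
  · rw [inl_mem_nodes] at hz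
    have h1 : j ≤ β := s.le_birth_n h0 hz
    have h2 : j ≠ β := by rintro h; rw [h] at hne; exact hne rfl
    simp only [rep]
    exact key _ _ (by omega) (by omega) (s.mem_line_succ_of_A (s.x_mem_A j))
      (s.ne_top_of_A (s.x_mem_A j))
  · rw [inr_mem_nodes, mem_segs] at hz
    have h1 : s.st e ≤ β := s.le_birth_n h0 (s.S_st _ _ hz).2
    have h2 : s.st e ≠ β := by
      rintro h
      rw [h] at hz
      have hm := i4 (β + 1) (by omega) (by omega)
      have hme := s.mem_line_succ_of_S hz
      obtain ⟨a, b, ha, hb, h3, h4⟩ := s.line_split β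
      have hnd := s.line_nodup (β + 1)
      obtain ⟨l, hl⟩ := s.line_head (β + 1)
      have hlast : ∃ l', s.line (β + 1) = l' ++ [s.top] := ⟨s.bot :: l, by simp [hl]⟩
      have h5 := hm.after_eq hnd
      have h6 : after s.top (s.line (β + 1)) = [] := by
        rw [hl] at hnd ⊢
        rw [← List.cons_append]
        apply after_append
        rw [← List.cons_append, List.nodup_append] at hnd
        intro h
        exact hnd.2.2 _ h _ (by simp) rfl
      rw [h6, hl] at h5
      have h7 : after s.bot (s.bot :: (l ++ [s.top])) = l ++ [s.top] := by simp [after]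
      rw [h7] at h5
      have h8 : l = [] := by
        have := congrArg List.length h5
        simp at this; exact this
      rw [hl, h8] at hme
      simp at hme
      rcases hme with h | h
      · exact s.ne_bot_of_S hz h
      · exact s.ne_top_of_S hz h
    simp only [rep]
    exact key _ _ (by omega) (by omega) (s.mem_line_succ_of_S hz) (s.ne_top_of_S hz)

/-- Fundamental cycles of a spanning structure: one of them is balanced. -/
theorem exists_balanced_cycle (h0 : 0 ∈ s.V) (π : ℕ ⊕ M → ℕ → M → ZMod 2)
    (X : Finset (ℕ ⊕ M)) (hX : X ⊆ s.nodes) (ω : ℕ ⊕ M → ℝ) (hω : ∀ z, 0 ≤ ω z) (m τ : ℝ)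
    (hm0 : 0 ≤ m) (hm : ∀ z ∈ X, ω z ≤ m) (hlt : 4 * τ + m < ∑ z ∈ X, ω z) :
    ∃ j e, s.Con j e ∧ ∀ a : ZMod 2,
      τ ≤ ∑ z ∈ X with s.chi (sg j e + π (.inl j) + π (.inr e)) (s.rep z).1 (s.rep z).2 = a,
        ω z := by
  by_contra! hcon
  have hσ : ∀ j e, ∃ σ : ZMod 2, s.Con j e → ∑ z ∈ X with
      s.chi (sg j e + π (.inl j) + π (.inr e)) (s.rep z).1 (s.rep z).2 ≠ σ, ω z < τ := by
    intro j e
    by_cases h : s.Con j e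
    · obtain ⟨a, ha⟩ := hcon j e h
      refine ⟨a + 1, fun _ => ?_⟩
      refine lt_of_eq_of_lt (sum_congr (filter_congr fun z _ => ?_) fun _ _ => rfl) ha
      have : ∀ a v : ZMod 2, v ≠ a + 1 ↔ v = a := by decide
      exact this _ _
    · exact ⟨0, fun h' => absurd h' h⟩
  choose σ hσ using hσ
  have four : ∀ (j₁ j₂ j₃ j₄ : ℕ) (e₁ e₂ e₃ e₄ : M), s.Con j₁ e₁ → s.Con j₂ e₂ → s.Con j₃ e₃ →
      s.Con j₄ e₄ → ∀ z₀, ∃ z ∈ X, z ≠ z₀ ∧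
      s.chi (sg j₁ e₁ + π (.inl j₁) + π (.inr e₁)) (s.rep z).1 (s.rep z).2 = σ j₁ e₁ ∧
      s.chi (sg j₂ e₂ + π (.inl j₂) + π (.inr e₂)) (s.rep z).1 (s.rep z).2 = σ j₂ e₂ ∧
      s.chi (sg j₃ e₃ + π (.inl j₃) + π (.inr e₃)) (s.rep z).1 (s.rep z).2 = σ j₃ e₃ ∧
      s.chi (sg j₄ e₄ + π (.inl j₄) + π (.inr e₄)) (s.rep z).1 (s.rep z).2 = σ j₄ e₄ := by
    intro j₁ j₂ j₃ j₄ e₁ e₂ e₃ e₄ c₁ c₂ c₃ c₄ z₀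
    by_contra! hno
    set F : ℕ → M → Finset (ℕ ⊕ M) := fun j e => X.filter fun z =>
      s.chi (sg j e + π (.inl j) + π (.inr e)) (s.rep z).1 (s.rep z).2 ≠ σ j e
    have hsub : X ⊆ X.filter (· = z₀) ∪ (F j₁ e₁ ∪ (F j₂ e₂ ∪ (F j₃ e₃ ∪ F j₄ e₄))) := by
      intro z hz
      have := hno z hz
      simp only [F, mem_union, mem_filter, hz, true_and]
      tauto
    have h1 := sum_le_sum_of_subset_of_nonneg hsub (f := ω) (fun z _ _ => hω z)
    have hun : ∀ P Q : Finset (ℕ ⊕ M), ∑ z ∈ P ∪ Q, ω z ≤ ∑ z ∈ P, ω z + ∑ z ∈ Q, ω z := by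
      intro P Q
      rw [← sum_union_inter]
      have := sum_nonneg (s := P ∩ Q) (f := ω) fun z _ => hω z
      linarith
    have h2 := hun (X.filter (· = z₀)) (F j₁ e₁ ∪ (F j₂ e₂ ∪ (F j₃ e₃ ∪ F j₄ e₄)))
    have h3 := hun (F j₁ e₁) (F j₂ e₂ ∪ (F j₃ e₃ ∪ F j₄ e₄))
    have h4 := hun (F j₂ e₂) (F j₃ e₃ ∪ F j₄ e₄)
    have h5 := hun (F j₃ e₃) (F j₄ e₄)
    have h6 : ∑ z ∈ X.filter (· = z₀), ω z ≤ m := by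
      rw [filter_eq']
      split_ifs with h
      · simpa using hm _ h
      · simpa using hm0
    have := hσ _ _ c₁
    have := hσ _ _ c₂
    have := hσ _ _ c₃
    have := hσ _ _ c₄
    linarith
  have hquad : ∀ (i j : ℕ) (b t : M) (z : ℕ ⊕ M),
      s.chi (quad i j b t) (s.rep z).1 (s.rep z).2 =
      s.chi (sg j b + π (.inl j) + π (.inr b)) (s.rep z).1 (s.rep z).2 +
      s.chi (sg j t + π (.inl j) + π (.inr t)) (s.rep z).1 (s.rep z).2 +
      (s.chi (sg i b + π (.inl i) + π (.inr b)) (s.rep z).1 (s.rep z).2 +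
      s.chi (sg i t + π (.inl i) + π (.inr t)) (s.rep z).1 (s.rep z).2) := by
    intro i j b t z
    simp only [quad, chi_add]
    have h2 : ∀ v : ZMod 2, v + v = 0 := CharTwo.add_self_eq_zero
    linear_combination -h2 (s.chi (π (.inl j)) (s.rep z).1 (s.rep z).2) -
      h2 (s.chi (π (.inl i)) (s.rep z).1 (s.rep z).2) -
      h2 (s.chi (π (.inr b)) (s.rep z).1 (s.rep z).2) -
      h2 (s.chi (π (.inr t)) (s.rep z).1 (s.rep z).2)
  have hc : Cons (s.line s.n) s.bot s.top := by
    rw [line, s.line_n]; exact ⟨[], [], rfl⟩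
  obtain ⟨-, i2, i3, -, -, -⟩ := s.birth_spec h0 (s.n_pos h0) hc
  have con0 : s.Con 0 s.bot ∧ s.Con 0 s.top := by
    refine ⟨⟨h0, Or.inl s.x_zero.symm⟩, h0, Or.inr (Or.inr (Or.inr ?_))⟩
    have h := s.line_zero
    obtain ⟨a, ha⟩ := s.A_head 0
    obtain ⟨b, hb⟩ := s.exists_B 0
    have ht := s.top_mem_B 0
    rw [ha, hb] at h
    have hl := congrArg List.length h
    simp at hl
    have hb' : b = [] := List.length_eq_zero_iff.1 (by omega)
    rw [hb, hb'] at ht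
    simpa using ht
  have hend := s.quad_sum h0 σ (by
    intro i hi hi1 b t hbt hb ht
    obtain ⟨-, q2, q3, -, -, -⟩ := s.birth_spec h0 hi1 hbt
    obtain ⟨z₀, hz₀⟩ := s.chi_quad_eq_zero h0 hi1 hbt
    obtain ⟨z, hz, hne, e1, e2, e3, e4⟩ := four _ _ _ _ _ _ _ _ q2 q3 hb ht z₀
    rw [← e1, ← e2, ← e3, ← e4, ← hquad]
    exact hz₀ z (hX hz) hne)
  obtain ⟨z₀, hz₀⟩ := s.chi_quad_eq_one h0
  obtain ⟨z, hz, hne, e1, e2, e3, e4⟩ := four _ _ _ _ _ _ _ _ i2 i3 con0.1 con0.2 z₀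
  have h1 := hz₀ z (hX hz) hne
  rw [hquad, e1, e2, e3, e4, hend] at h1
  rw [CharTwo.add_self_eq_zero] at h1
  exact zero_ne_one h1

end Sweep

theorem exists_of_cons_filter {α : Type*} {p : α → Prop} {l : List α} {b e : α}
    (h : Cons (l.filter p) b e) :
    ∃ l₁ mid l₂, l = l₁ ++ b :: (mid ++ e :: l₂) ∧ ∀ m ∈ mid, ¬ p m := by
  obtain ⟨q, r, h⟩ := h
  obtain ⟨m₁, m₂, rfl, h1, h2⟩ := List.filter_eq_append_iff.1 h
  obtain ⟨a₁, a₂, rfl, h3, h4, h5⟩ := List.filter_eq_cons_iff.1 h2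
  obtain ⟨c₁, c₂, rfl, h6, h7, h8⟩ := List.filter_eq_cons_iff.1 h5
  exact ⟨m₁ ++ a₁, c₁, c₂, by simp, fun m hm => by simpa using h6 m hm⟩

namespace Sweep

variable {M : Type} (s : Sweep M)

/-- A labelling of the gaps that changes only across nodes of `Y`. -/
structure Cst {κ : Type} (Y : Finset (ℕ ⊕ M)) (lam : ℕ → M → κ) : Prop where
  vertical : ∀ k b e, Cons (s.line k) b e → e ≠ s.top → Sum.inr e ∉ Y → lam k b = lam k e
  pass_below : ∀ i b, b ∈ s.A i → (b ≠ s.x i ∨ Sum.inl i ∉ Y) → lam i b = lam (i + 1) b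
  pass_above : ∀ i b, b ∈ s.B i → b ≠ s.top → lam i b = lam (i + 1) b

/-- A node set containing the end points of its curves. -/
def Closed (Y : Finset (ℕ ⊕ M)) : Prop :=
  ∀ e, Sum.inr e ∈ Y → Sum.inl (s.st e) ∈ Y ∧ Sum.inl (s.fi e) ∈ Y

theorem x_of_concat {i : ℕ} {l : List M} {d : M} (h : s.A i = l ++ [d]) : s.x i = d := by
  simp [x, h]

variable {s}

theorem Cst.mono {κ : Type} {Y Y' : Finset (ℕ ⊕ M)} {lam : ℕ → M → κ} (h : s.Cst Y lam)
    (hY : Y ⊆ Y') : s.Cst Y' lam :=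
  ⟨fun k b e hc ht he => h.vertical k b e hc ht fun h' => he (hY h'),
    fun i b hb hx => h.pass_below i b hb (hx.imp_right fun h h' => h (hY h')), h.pass_above⟩

theorem Cst.chain {κ : Type} {Y : Finset (ℕ ⊕ M)} {lam : ℕ → M → κ} (h : s.Cst Y lam)
    {k : ℕ} {p mid q : List M} {b : M} (hl : s.line k = p ++ b :: (mid ++ q))
    (hm : ∀ m ∈ mid, m ≠ s.top ∧ Sum.inr m ∉ Y) : ∀ m ∈ mid, lam k b = lam k m := by
  induction mid generalizing p b with
  | nil => simp
  | cons a mid ih =>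
    have h1 : lam k b = lam k a :=
      h.vertical k b a ⟨p, mid ++ q, by simpa using hl⟩ (hm a (by simp)).1 (hm a (by simp)).2
    intro m hmem
    rcases List.mem_cons.1 hmem with rfl | hmem
    · exact h1
    · rw [h1]
      exact ih (p := p ++ [b]) (b := a) (by simpa using hl) (fun m hm' => hm m (by simp [hm'])) m
        hmem

variable (s)

theorem S_of_line {k : ℕ} {e : M} (h : e ∈ s.line k) (hb : e ≠ s.bot) (ht : e ≠ s.top) :
    e ∈ s.S (s.st e) := by
  induction k with
  | zero =>
    rw [line, s.line_zero] at h
    simp [hb, ht] at h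
  | succ k ih =>
    rw [line_succ] at h
    simp only [List.mem_append] at h
    rcases h with (h | h) | h
    · exact ih (s.mem_line_of_A h)
    · rw [(s.S_st k e h).1]; exact h
    · exact ih (s.mem_line_of_B h)

theorem line_convex {k : ℕ} {e : M} (h : e ∈ s.line k) {j : ℕ}
    (hj : s.st e < j) (hjk : j ≤ k) : e ∈ s.line j := by
  induction k with
  | zero => omega
  | succ k ih =>
    rcases Nat.lt_or_ge k j with hlt | hge
    · have : j = k + 1 := by omega
      rwa [this]
    · apply ih _ hge
      rw [line_succ] at h
      simp only [List.mem_append] at h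
      rcases h with (h | h) | h
      · exact s.mem_line_of_A h
      · have := (s.S_st k e h).1; omega
      · exact s.mem_line_of_B h

theorem AB_of_both {k : ℕ} {e : M} (h : e ∈ s.line k) (h' : e ∈ s.line (k + 1)) :
    e ∈ s.A k ∨ e ∈ s.B k := by
  rw [line_succ] at h'
  simp only [line, List.mem_append] at h h'
  by_contra hcon
  push Not at hcon
  have hS : e ∈ s.S k := by tauto
  have hE : e ∈ s.E k := by tauto
  have := s.line_mem k e (by simp [hE]) (s.ne_bot_of_E hE) (s.ne_top_of_E hE)
  have := (s.S_st k e hS).1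
  omega

variable {s}

/-- A curve outside `Y` sees the same label along its whole length. -/
theorem Cst.along_succ {κ : Type} {Y : Finset (ℕ ⊕ M)} {lam : ℕ → M → κ} (h : s.Cst Y lam) {k : ℕ}
    {e : M} (he : Sum.inr e ∉ Y) (hb : e ≠ s.bot) (ht : e ≠ s.top) (hk : e ∈ s.line k)
    (hk' : e ∈ s.line (k + 1)) : lam k e = lam (k + 1) e := by
  rcases s.AB_of_both hk hk' with hA | hB
  · by_cases hx : e = s.x k
    · obtain ⟨a, c, ha, hc, h1, h2⟩ := s.line_split k
      obtain ⟨l, hl⟩ := s.A_head k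
      rcases List.eq_nil_or_concat a with rfl | ⟨a', d, rfl⟩
      · rw [ha] at hl
        simp at hl
        exact absurd (hx.trans hl.1) hb
      · have e1 := h.vertical k d e ⟨a', _, by rw [h1, hx]; simp; rfl⟩ ht he
        have e2 := h.vertical (k + 1) d e ⟨a', _, by rw [h2, hx]; simp; rfl⟩ ht he
        have e3 := h.pass_below k d (by rw [ha]; simp) (Or.inl (by
          rintro rfl
          have := (s.nodup_split k).1
          rw [ha, List.nodup_append] at this
          exact this.2.2 (s.x k) (by simp) (s.x k) (by simp) rfl))
        rw [← e1, ← e2, e3]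
    · exact h.pass_below k e hA (Or.inl hx)
  · exact h.pass_above k e hB ht

theorem Cst.along {κ : Type} {Y : Finset (ℕ ⊕ M)} {lam : ℕ → M → κ} (h : s.Cst Y lam) {k : ℕ}
    {e : M} (he : Sum.inr e ∉ Y) (hb : e ≠ s.bot) (ht : e ≠ s.top) (hk : e ∈ s.line k) :
    lam (s.st e + 1) e = lam k e := by
  have hst := (s.line_mem k e hk hb ht).1
  obtain ⟨d, rfl⟩ := Nat.exists_eq_add_of_le (Nat.succ_le_of_lt hst)
  induction d with
  | zero => rfl
  | succ d ih =>
    have hk' : e ∈ s.line ((s.st e).succ + d) := s.line_convex hk (by omega) (by omega)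
    rw [ih hk' (by omega)]
    exact h.along_succ he hb ht hk' hk

theorem Cst.S_eq {κ : Type} {Y : Finset (ℕ ⊕ M)} {lam : ℕ → M → κ} (h : s.Cst Y lam)
    (hY : s.Closed Y) {i : ℕ} (hi : Sum.inl i ∉ Y) {e : M} (he : e ∈ s.S i) :
    lam (i + 1) (s.x i) = lam (s.st e + 1) e := by
  obtain ⟨a, c, ha, hc, h1, h2⟩ := s.line_split i
  rw [(s.S_st i e he).1]
  refine h.chain h2 (fun m hm => ⟨s.ne_top_of_S hm, fun h' => ?_⟩) e he
  have := (hY m h').1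
  rw [(s.S_st i m hm).1] at this
  exact hi this

theorem Cst.E_eq {κ : Type} {Y : Finset (ℕ ⊕ M)} {lam : ℕ → M → κ} (h : s.Cst Y lam)
    (hY : s.Closed Y) {i : ℕ} (hi : Sum.inl i ∉ Y) {e : M} (he : e ∈ s.E i) :
    lam (i + 1) (s.x i) = lam (s.st e + 1) e := by
  obtain ⟨a, c, ha, hc, h1, h2⟩ := s.line_split i
  have key : ∀ m ∈ s.E i, Sum.inr m ∉ Y := by
    intro m hm h'
    have := (hY m h').2
    rw [(s.E_fi i m hm).1] at this
    exact hi this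
  rw [← h.pass_below i _ (s.x_mem_A i) (Or.inr hi),
    h.chain h1 (fun m hm => ⟨s.ne_top_of_E hm, key m hm⟩) e he,
    h.along (key e he) (s.ne_bot_of_E he) (s.ne_top_of_E he) (s.mem_line_of_E he)]

variable (s)

/-- Keep a curve iff it is extremal or belongs to `U`. -/
def keep (U : Finset (ℕ ⊕ M)) (e : M) : Prop := e = s.bot ∨ e = s.top ∨ Sum.inr e ∈ U

/-- The subsystem of the nodes in `U`. -/
def restrict (U : Finset (ℕ ⊕ M)) (hU : s.Closed U) : Sweep M where
  n := s.n
  V := s.V.filter fun i => Sum.inl i ∈ U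
  A i := (s.A i).filter (s.keep U)
  E i := (s.E i).filter (s.keep U)
  S i := (s.S i).filter (s.keep U)
  B i := (s.B i).filter (s.keep U)
  bot := s.bot
  top := s.top
  st := s.st
  fi := s.fi
  V_lt i hi := s.V_lt i (mem_filter.1 hi).1
  step i := by simp only [← List.filter_append, s.step]
  line_zero := by
    simp only [← List.filter_append, s.line_zero]; simp [keep]
  line_n := by
    simp only [← List.filter_append, s.line_n]; simp [keep]
  nodup i := by
    simp only [← List.filter_append]; exact (s.nodup i).filter _
  A_head i := by
    obtain ⟨l, hl⟩ := s.A_head i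
    exact ⟨l.filter (s.keep U), by simp [hl, keep]⟩
  B_last i := by
    obtain ⟨l, hl⟩ := s.B_last i
    exact ⟨l.filter (s.keep U), by simp [hl, keep]⟩
  S_st i e he := by
    simp only [List.mem_filter, decide_eq_true_eq] at he
    have h := s.S_st i e he.1
    refine ⟨h.1, mem_filter.2 ⟨h.2, ?_⟩⟩
    rcases he.2 with h' | h' | h'
    · exact absurd h' (s.ne_bot_of_S he.1)
    · exact absurd h' (s.ne_top_of_S he.1)
    · rw [← h.1]; exact (hU e h').1
  E_fi i e he := by
    simp only [List.mem_filter, decide_eq_true_eq] at he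
    have h := s.E_fi i e he.1
    refine ⟨h.1, mem_filter.2 ⟨h.2, ?_⟩⟩
    rcases he.2 with h' | h' | h'
    · exact absurd h' (s.ne_bot_of_E he.1)
    · exact absurd h' (s.ne_top_of_E he.1)
    · rw [← h.1]; exact (hU e h').2
  line_mem k e he := by
    simp only [← List.filter_append] at he
    exact s.line_mem k e (List.mem_filter.1 he).1

section restrict

variable {U : Finset (ℕ ⊕ M)} {hU : s.Closed U}

theorem restrict_line (k : ℕ) : (s.restrict U hU).line k = (s.line k).filter (s.keep U) := by
  simp [line, restrict]

theorem restrict_split (i : ℕ) : ∃ p q, s.A i = p ++ (s.restrict U hU).x i :: q ∧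
    ∀ m ∈ q, ¬ s.keep U m := by
  obtain ⟨a, ha⟩ := (s.restrict U hU).exists_A i
  change (s.A i).filter (s.keep U) = _ at ha
  obtain ⟨m₁, m₂, h0, h1, h2⟩ := List.filter_eq_append_iff.1 ha
  obtain ⟨a₁, a₂, rfl, h3, h4, h5⟩ := List.filter_eq_cons_iff.1 h2
  refine ⟨m₁ ++ a₁, a₂, by rw [h0]; simp, fun m hm => ?_⟩
  have := List.filter_eq_nil_iff.1 h5 m hm
  simpa using this

theorem Cst.restrict_x {κ : Type} {s : Sweep M} {U : Finset (ℕ ⊕ M)} {hU : s.Closed U}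
    {Y : Finset (ℕ ⊕ M)} {lam : ℕ → M → κ} (h : s.Cst Y lam)
    (hY : Y ⊆ U) (i : ℕ) : lam (i + 1) ((s.restrict U hU).x i) = lam (i + 1) (s.x i) := by
  obtain ⟨p, q, h1, h2⟩ := s.restrict_split (hU := hU) i
  have hl : s.line (i + 1) = p ++ (s.restrict U hU).x i :: (q ++ (s.S i ++ s.B i)) := by
    rw [line_succ, h1]; simp
  rcases List.eq_nil_or_concat q with rfl | ⟨q', d, rfl⟩
  · have : s.x i = (s.restrict U hU).x i := by rw [x, h1]; simp
    rw [this]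
  · have : s.x i = d := s.x_of_concat (l := p ++ (s.restrict U hU).x i :: q') (by rw [h1]; simp)
    rw [this]
    refine h.chain hl (fun m hm => ?_) d (by simp)
    have := h2 m hm
    simp only [keep, not_or] at this
    exact ⟨this.2.1, fun h' => this.2.2 (hY h')⟩

theorem Cst.restrict {κ : Type} {s : Sweep M} {U : Finset (ℕ ⊕ M)} {hU : s.Closed U}
    {Y : Finset (ℕ ⊕ M)} {lam : ℕ → M → κ} (h : s.Cst Y lam)
    (hY : Y ⊆ U) : (s.restrict U hU).Cst Y lam where
  vertical k b e hc ht he := by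
    rw [restrict_line] at hc
    obtain ⟨l₁, mid, l₂, hl, hm⟩ := exists_of_cons_filter hc
    refine h.chain (k := k) (p := l₁) (mid := mid ++ [e]) (q := l₂) (by simpa using hl)
      (fun m hm' => ?_) e (by simp)
    rcases List.mem_append.1 hm' with hm' | hm'
    · have := hm m hm'
      simp only [keep, not_or] at this
      exact ⟨this.2.1, fun h' => this.2.2 (hY h')⟩
    · simp only [List.mem_singleton] at hm'
      subst hm'
      exact ⟨ht, he⟩
  pass_below i b hb hx := by
    have hbA : b ∈ s.A i := (List.mem_filter.1 hb).1
    refine h.pass_below i b hbA (hx.imp_left fun hne h' => hne ?_)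
    obtain ⟨p, q, h1, h2⟩ := s.restrict_split (hU := hU) i
    rcases List.eq_nil_or_concat q with rfl | ⟨q', d, rfl⟩
    · rw [h', x, h1]; simp
    · have : s.x i = d :=
        s.x_of_concat (l := p ++ (s.restrict U hU).x i :: q') (by rw [h1]; simp)
      have hk : s.keep U b := by simpa using (List.mem_filter.1 hb).2
      rw [h', this] at hk
      exact absurd hk (h2 d (by simp))
  pass_above i b hb ht := h.pass_above i b (List.mem_filter.1 hb).1 ht

theorem restrict_nodes [Fintype M] (hUn : U ⊆ s.nodes) : (s.restrict U hU).nodes = U := by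
  ext z
  rcases z with i | e
  · rw [inl_mem_nodes]
    simp only [restrict, mem_filter]
    exact ⟨fun h => h.2, fun h => ⟨s.inl_mem_nodes.1 (hUn h), h⟩⟩
  · rw [inr_mem_nodes, mem_segs]
    change e ∈ (s.S (s.st e)).filter (s.keep U) ↔ _
    rw [List.mem_filter, decide_eq_true_eq, keep]
    constructor
    · rintro ⟨h1, h2⟩
      rcases h2 with h' | h' | h'
      · exact absurd h' (s.ne_bot_of_S h1)
      · exact absurd h' (s.ne_top_of_S h1)
      · exact h'
    · exact fun h => ⟨s.mem_segs.1 (s.inr_mem_nodes.1 (hUn h)), Or.inr (Or.inr h)⟩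

end restrict

variable [Fintype M]

/-- The parity labelling of a cycle is consistent with respect to its nodes. -/
theorem cst_chi (C : ℕ → M → ZMod 2) (hC : ∀ j e, C j e ≠ 0 → s.Con j e)
    (hseg : ∀ e, ∑ j ∈ range s.n, C j e = 0) (hver : ∀ j, ∑ e, C j e = 0)
    (Y : Finset (ℕ ⊕ M))
    (hYe : ∀ j e, C j e ≠ 0 → e ≠ s.bot → e ≠ s.top → Sum.inr e ∈ Y)
    (hYj : ∀ j e, C j e ≠ 0 → Sum.inl j ∈ Y) : s.Cst Y (s.chi C) where
  vertical k b e hc ht he := by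
    rw [chi, hc.after_eq (s.line_nodup k)]
    have hb : e ≠ s.bot := by
      rintro rfl
      obtain ⟨l, hl⟩ := s.line_head k
      have hnd := s.line_nodup k
      obtain ⟨p, q, hpq⟩ := hc
      rw [hl] at hpq hnd
      cases p with
      | nil => simp at hpq; rw [List.nodup_cons] at hnd; rw [hpq.2] at hnd; simp at hnd
      | cons d p => simp at hpq; rw [List.nodup_cons] at hnd; rw [hpq.2] at hnd; simp at hnd
    have : ∀ j, C j e = 0 := fun j => by
      by_contra h; exact he (hYe j e h hb ht)
    simp [this, chi]
  pass_above i b hb ht := by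
    obtain ⟨p, q, hpq⟩ := List.append_of_mem hb
    have h1 : s.line i = (s.A i ++ s.E i ++ p) ++ b :: q := by rw [line, hpq]; simp
    have h2 : s.line (i + 1) = (s.A i ++ s.S i ++ p) ++ b :: q := by rw [line_succ, hpq]; simp
    have hn1 := s.line_nodup i
    have hn2 := s.line_nodup (i + 1)
    rw [h1, List.nodup_append] at hn1
    rw [h2, List.nodup_append] at hn2
    rw [chi, chi, h1, h2, after_append fun h => hn1.2.2 _ h b (by simp) rfl,
      after_append fun h => hn2.2.2 _ h b (by simp) rfl]
    congr 1
    apply List.map_congr_left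
    intro e he
    rw [sum_range_succ]
    have : C i e = 0 := by
      by_contra h
      have hcon := (hC i e h).2
      have heB : e ∈ s.B i := by rw [hpq]; simp [he]
      rcases hcon with rfl | h | h | rfl
      · exact (s.nodup_split i).2.2.2.2.1 _ (s.x_mem_A i) heB
      · exact (s.nodup_split i).2.2.2.2.2 _ h heB
      · exact (s.nodup_split' i).2.2 _ h heB
      · obtain ⟨l, hl⟩ := s.exists_B i
        have hnd := (s.nodup_split i).2.2.1
        rw [hpq] at hl
        cases p with
        | nil =>
          rw [hpq] at hnd
          simp at hl
          rw [← hl.1] at he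
          simp [he] at hnd
        | cons d p =>
          rw [hpq] at hnd
          simp at hl
          rw [hl.1] at hnd
          simp [he] at hnd
    rw [this, add_zero]
  pass_below i b hb hx := by
    obtain ⟨p, q, hpq⟩ := List.append_of_mem hb
    have h1 : s.line i = p ++ b :: (q ++ s.E i ++ s.B i) := by rw [line, hpq]; simp
    have h2 : s.line (i + 1) = p ++ b :: (q ++ s.S i ++ s.B i) := by rw [line_succ, hpq]; simp
    have hn1 := s.line_nodup i
    have hn2 := s.line_nodup (i + 1)
    have hn1' := hn1
    have hn2' := hn2
    rw [h1, List.nodup_append] at hn1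
    rw [h2, List.nodup_append] at hn2
    rw [chi, chi, h1, h2, after_append fun h => hn1.2.2 _ h b (by simp) rfl,
      after_append fun h => hn2.2.2 _ h b (by simp) rfl]
    simp only [List.map_append, List.sum_append, sum_range_succ, List.sum_map_add]
    have hE : ((s.E i).map fun e => ∑ j ∈ range i, C j e).sum =
        ((s.E i).map fun e => C i e).sum := by
      congr 1
      apply List.map_congr_left
      intro e he
      have hs := hseg e
      have hin : i < s.n := s.V_lt i (s.E_fi i e he).2
      have : ∑ j ∈ range s.n, C j e = ∑ j ∈ range (i + 1), C j e := by
        symm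
        apply sum_subset
        · intro j; simp; omega
        · intro j _ hj
          by_contra h
          have := (s.con_range (hC j e h) (s.ne_bot_of_E he) (s.ne_top_of_E he)).2
          rw [(s.E_fi i e he).1] at this
          simp at hj; omega
      rw [this, sum_range_succ] at hs
      exact CharTwo.add_eq_zero.1 hs
    have hS : ((s.S i).map fun e => ∑ j ∈ range i, C j e).sum = 0 := by
      apply List.sum_eq_zero
      intro v hv
      obtain ⟨e, he, rfl⟩ := List.mem_map.1 hv
      apply sum_eq_zero
      intro j hj
      by_contra h
      have := (s.con_range (hC j e h) (s.ne_bot_of_S he) (s.ne_top_of_S he)).1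
      rw [(s.S_st i e he).1] at this
      simp at hj; omega
    rw [hE, hS]
    have htot : (q.map fun e => C i e).sum + ((s.E i).map fun e => C i e).sum +
        ((s.S i).map fun e => C i e).sum + ((s.B i).map fun e => C i e).sum = 0 := by
      rcases hx with hx | hx
      · have hnd : (q ++ s.E i ++ s.S i ++ s.B i).Nodup := by
          rw [line] at hn1'
          rw [line_succ] at hn2'
          rw [hpq] at hn1' hn2'
          simp only [List.nodup_append, List.nodup_cons, List.mem_append, List.mem_cons] at *
          refine ⟨⟨⟨by tauto, by tauto, ?_⟩, by tauto, ?_⟩, by tauto, ?_⟩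
          · intro a ha b hb
            exact hn1'.1.2.2 a (Or.inr (Or.inr ha)) b hb
          · intro a ha b hb
            rcases ha with ha | ha
            · exact hn2'.1.2.2 a (Or.inr (Or.inr ha)) b hb
            · rintro rfl
              have h3 := s.line_mem i a (by simp [ha]) (s.ne_bot_of_E ha) (s.ne_top_of_E ha)
              have := (s.S_st i a hb).1
              omega
          · intro a ha b hb
            rcases ha with (ha | ha) | ha
            · exact hn1'.2.2 a (Or.inl (Or.inr (Or.inr ha))) b hb
            · exact hn1'.2.2 a (Or.inr ha) b hb
            · exact hn2'.2.2 a (Or.inr ha) b hb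
        have hsum : ((q ++ s.E i ++ s.S i ++ s.B i).map fun e => C i e).sum = ∑ e, C i e := by
          rw [← List.sum_toFinset _ hnd]
          apply sum_subset (subset_univ _)
          intro e _ he
          by_contra h
          simp only [List.mem_toFinset, List.mem_append, not_or] at he
          have hcon := (hC i e h).2
          rcases hcon with rfl | h | h | rfl
          · apply he.1.1.1
            obtain ⟨a, ha⟩ := s.exists_A i
            rw [hpq] at ha
            rcases List.eq_nil_or_concat q with rfl | ⟨q', d, rfl⟩
            · have : s.x i = b := by rw [x, hpq]; simp
              exact absurd this.symm hx
            · have : s.x i = d := s.x_of_concat (l := p ++ b :: q') (by rw [hpq]; simp)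
              simp [this]
          · exact he.1.1.2 h
          · exact he.1.2 h
          · exact he.2 (s.y_mem_B i)
        rw [hver] at hsum
        simpa [add_assoc] using hsum
      · have : ∀ e, C i e = 0 := fun e => by
          by_contra h; exact hx (hYj i e h)
        simp [this]
    have h2 : ∀ v w : ZMod 2, v + w = 0 → v = w := fun v w => CharTwo.add_eq_zero.1
    apply h2
    have h3 : ∀ v : ZMod 2, v + v = 0 := CharTwo.add_self_eq_zero
    linear_combination htot + h3 (q.map fun e => ∑ j ∈ range i, C j e).sum +
      h3 ((s.B i).map fun e => ∑ j ∈ range i, C j e).sum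

end Sweep

/-- Being the endpoint of a walk of length `m` from `r`. -/
inductive WalkTo {α : Type*} (adj : α → α → Prop) (r : α) : ℕ → α → Prop
  | zero : WalkTo adj r 0 r
  | succ {m u v} : WalkTo adj r m u → adj u v → WalkTo adj r (m + 1) v

/-- Length of a shortest walk. -/
def walkDist {α : Type*} (adj : α → α → Prop) (r z : α) : ℕ := sInf {m | WalkTo adj r m z}

theorem walkTo_walkDist {α : Type*} {adj : α → α → Prop} {r z : α} {m : ℕ}
    (h : WalkTo adj r m z) : WalkTo adj r (walkDist adj r z) z :=
  Nat.sInf_mem (s := {m | WalkTo adj r m z}) ⟨m, h⟩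

theorem walkDist_le {α : Type*} {adj : α → α → Prop} {r z : α} {m : ℕ}
    (h : WalkTo adj r m z) : walkDist adj r z ≤ m := Nat.sInf_le h

/-- Averaging over shifts: some shift modulo `T` puts few elements into the residues `R`. -/
theorem exists_shift {α : Type*} (N : Finset α) (d : α → ℕ) (T : ℕ) (hT : 0 < T) (R : Finset ℕ) :
    ∃ r < T, T * #(N.filter fun z => (d z + r) % T ∈ R) ≤ #R * #N := by
  by_contra! hcon
  have h1 : ∑ r ∈ range T, #(N.filter fun z => (d z + r) % T ∈ R) ≤ #R * #N := by
    simp only [card_filter]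
    rw [sum_comm, mul_comm, ← smul_eq_mul, ← sum_const]
    apply sum_le_sum
    intro z _
    rw [← card_filter]
    apply card_le_card_of_injOn (fun r => (d z + r) % T)
    · intro r hr
      simpa using (mem_filter.1 hr).2
    · intro a ha b hb hab
      simp only [coe_filter, mem_range, Set.mem_ofPred_eq] at ha hb
      have : a ≡ b [MOD T] := Nat.ModEq.add_left_cancel' (d z) hab
      rw [Nat.ModEq, Nat.mod_eq_of_lt ha.1, Nat.mod_eq_of_lt hb.1] at this
      exact this
  have h2 : ∑ r ∈ range T, (#R * #N) < ∑ r ∈ range T, T * #(N.filter fun z => (d z + r) % T ∈ R) :=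
    sum_lt_sum_of_nonempty ⟨0, by simpa using hT⟩ fun r hr => hcon r (by simpa using hr)
  have h3 : T * (#R * #N) < T * ∑ r ∈ range T, #(N.filter fun z => (d z + r) % T ∈ R) := by
    rw [mul_sum]
    exact lt_of_eq_of_lt (by rw [sum_const, card_range, smul_eq_mul]) h2
  exact absurd (Nat.lt_of_mul_lt_mul_left h3) (not_lt.2 h1)

/-- A set on which `d` is injective with values in an interval is small. -/
theorem card_le_of_injOn_interval {α : Type*} (P : Finset α) (d : α → ℕ)
    (hd : Set.InjOn d P) (a L : ℕ) (h : ∀ z ∈ P, a ≤ d z ∧ d z < a + L) : #P ≤ L := by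
  have : #P ≤ #(Ico a (a + L)) := card_le_card_of_injOn d
    (fun z hz => by simpa using h z hz) hd
  simpa using this

namespace Sweep

variable {M : Type} (s : Sweep M)

theorem ne_bot_of_cons {k : ℕ} {b e : M} (hc : Cons (s.line k) b e) : e ≠ s.bot := by
  rintro rfl
  obtain ⟨l, hl⟩ := s.line_head k
  have hnd := s.line_nodup k
  obtain ⟨p, q, hpq⟩ := hc
  rw [hl] at hpq hnd
  cases p with
  | nil => simp at hpq; rw [List.nodup_cons] at hnd; rw [hpq.2] at hnd; simp at hnd
  | cons d p => simp at hpq; rw [List.nodup_cons] at hnd; rw [hpq.2] at hnd; simp at hnd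

theorem S_of_con {j : ℕ} {e : M} (h : s.Con j e) (hb : e ≠ s.bot) (ht : e ≠ s.top) :
    e ∈ s.S (s.st e) := by
  rcases h.2 with rfl | h | h | rfl
  · exact s.S_of_line (s.mem_line_of_A (s.x_mem_A j)) hb ht
  · exact s.S_of_line (s.mem_line_of_E h) hb ht
  · rwa [(s.S_st j e h).1]
  · exact s.S_of_line (s.mem_line_of_B (s.y_mem_B j)) hb ht

/-- Adjacency of vertices and curves. -/
def adj : ℕ ⊕ M → ℕ ⊕ M → Prop
  | .inl j, .inr e => s.Con j e
  | .inr e, .inl j => s.Con j e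
  | _, _ => False

theorem adj_symm {u v : ℕ ⊕ M} (h : s.adj u v) : s.adj v u := by
  rcases u with j | e <;> rcases v with j' | e' <;> exact h

/-- Distance from the leftmost vertex. -/
def dist (z : ℕ ⊕ M) : ℕ := walkDist s.adj (.inl 0) z

theorem reach (h0 : 0 ∈ s.V) {k : ℕ} (hk : 1 ≤ k) :
    (∀ e ∈ s.line k, ∃ m, WalkTo s.adj (.inl 0) m (.inr e)) ∧
    (∀ j ∈ s.V, j < k → ∃ m, WalkTo s.adj (.inl 0) m (.inl j)) := by
  induction k, hk using Nat.le_induction with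
  | base =>
    constructor
    · intro e he
      refine ⟨1, WalkTo.succ WalkTo.zero ?_⟩
      refine ⟨h0, ?_⟩
      rw [s.line_succ_zero] at he
      have hy : s.y 0 = s.top := by
        have h := s.line_zero
        obtain ⟨a, ha⟩ := s.A_head 0
        obtain ⟨b, hb⟩ := s.exists_B 0
        have ht := s.top_mem_B 0
        rw [ha, hb] at h
        have hl := congrArg List.length h
        simp at hl
        have hb' : b = [] := List.length_eq_zero_iff.1 (by omega)
        rw [hb, hb'] at ht
        have : s.top = s.y 0 := by simpa using ht
        exact this.symm
      rw [s.x_zero, hy]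
      simp at he; tauto
    · intro j hj hj1
      have : j = 0 := by omega
      subst this
      exact ⟨0, WalkTo.zero⟩
  | succ k hk ih =>
    by_cases hkV : k ∈ s.V
    · obtain ⟨m, hm⟩ := ih.1 _ (s.mem_line_of_A (s.x_mem_A k))
      have hmk : WalkTo s.adj (.inl 0) (m + 1) (.inl k) := hm.succ ⟨hkV, Or.inl rfl⟩
      constructor
      · intro e he
        rw [line_succ] at he
        simp only [List.mem_append] at he
        rcases he with (h | h) | h
        · exact ih.1 e (s.mem_line_of_A h)
        · exact ⟨m + 2, hmk.succ ⟨hkV, Or.inr (Or.inr (Or.inl h))⟩⟩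
        · exact ih.1 e (s.mem_line_of_B h)
      · intro j hj hjk
        rcases Nat.lt_succ_iff_lt_or_eq.1 hjk with h | rfl
        · exact ih.2 j hj h
        · exact ⟨_, hmk⟩
    · rw [s.line_succ_of_not_mem hkV]
      refine ⟨ih.1, fun j hj hjk => ?_⟩
      rcases Nat.lt_succ_iff_lt_or_eq.1 hjk with h | rfl
      · exact ih.2 j hj h
      · exact absurd hj hkV

theorem reach_inl (h0 : 0 ∈ s.V) {j : ℕ} (hj : j ∈ s.V) :
    ∃ m, WalkTo s.adj (.inl 0) m (.inl j) :=
  (s.reach h0 (k := j + 1) (by omega)).2 j hj (by omega)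

theorem reach_con (h0 : 0 ∈ s.V) {j : ℕ} {e : M} (h : s.Con j e) :
    ∃ m, WalkTo s.adj (.inl 0) m (.inr e) := by
  obtain ⟨m, hm⟩ := s.reach_inl h0 h.1
  exact ⟨m + 1, hm.succ h⟩

theorem dist_con (h0 : 0 ∈ s.V) {j : ℕ} {e : M} (h : s.Con j e) :
    s.dist (.inl j) ≤ s.dist (.inr e) + 1 ∧ s.dist (.inr e) ≤ s.dist (.inl j) + 1 := by
  obtain ⟨m, hm⟩ := s.reach_inl h0 h.1
  obtain ⟨m', hm'⟩ := s.reach_con h0 h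
  exact ⟨walkDist_le ((walkTo_walkDist hm').succ (s.adj_symm (u := .inl j) (v := .inr e) h)),
    walkDist_le ((walkTo_walkDist hm).succ h)⟩

variable [Fintype M]

/-- Boundary of a chain. -/
def bd (C : ℕ → M → ZMod 2) : ℕ ⊕ M → ZMod 2
  | .inl j => ∑ e, C j e
  | .inr e => ∑ j ∈ range s.n, C j e

theorem bd_add (C D : ℕ → M → ZMod 2) (u : ℕ ⊕ M) : s.bd (C + D) u = s.bd C u + s.bd D u := by
  rcases u with j | e <;> simp [bd, sum_add_distrib]

theorem bd_sg {j : ℕ} {e : M} (hj : j < s.n) (u : ℕ ⊕ M) :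
    s.bd (sg j e) u = (if u = .inl j then 1 else 0) + (if u = .inr e then 1 else 0) := by
  rcases u with j' | e'
  · by_cases h : j' = j <;> simp [bd, sg, h]
  · by_cases h : e' = e <;> simp [bd, sg, h, hj]

theorem exists_path (m : ℕ) : ∀ z : ℕ ⊕ M, (∃ m', WalkTo s.adj (.inl 0) m' z) →
    s.dist z = m →
    ∃ (C : ℕ → M → ZMod 2) (P : Finset (ℕ ⊕ M)),
      (∀ j e, C j e ≠ 0 → s.Con j e ∧ Sum.inl j ∈ P ∧ Sum.inr e ∈ P) ∧
      (∀ u, s.bd C u = (if u = z then 1 else 0) + (if u = .inl 0 then 1 else 0)) ∧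
      z ∈ P ∧ Set.InjOn s.dist P ∧ ∀ u ∈ P, s.dist u ≤ m := by
  induction m with
  | zero =>
    intro z ⟨m', hm'⟩ hz
    have h := walkTo_walkDist hm'
    rw [show walkDist s.adj (.inl 0) z = 0 from hz] at h
    cases h
    refine ⟨0, {.inl 0}, by simp, ?_, by simp, by simp, by simp [hz]⟩
    intro u
    rw [CharTwo.add_self_eq_zero]
    rcases u with j | e <;> simp [bd]
  | succ m ih =>
    intro z ⟨m', hm'⟩ hz
    have h := walkTo_walkDist hm'
    rw [show walkDist s.adj (.inl 0) z = m + 1 from hz] at h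
    cases h with
    | @succ _ w _ hw ha =>
      have hle : s.dist w ≤ m := walkDist_le hw
      have hge : m ≤ s.dist w := by
        have : s.dist z ≤ s.dist w + 1 := walkDist_le ((walkTo_walkDist hw).succ ha)
        omega
      obtain ⟨C, P, h1, h2, h3, h4, h5⟩ := ih w ⟨m, hw⟩ (le_antisymm hle hge)
      obtain ⟨j, e, hje, hcases⟩ : ∃ j e, s.Con j e ∧
          ((w = .inl j ∧ z = .inr e) ∨ (w = .inr e ∧ z = .inl j)) := by
        rcases w with j | e <;> rcases z with j' | e' <;> simp only [adj] at ha
        · exact ⟨j, e', ha, Or.inl ⟨rfl, rfl⟩⟩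
        · exact ⟨j', e, ha, Or.inr ⟨rfl, rfl⟩⟩
      refine ⟨sg j e + C, insert z P, ?_, ?_, by simp, ?_, ?_⟩
      · intro j' e' hne
        by_cases hsg : sg j e j' e' = 0
        · have : C j' e' ≠ 0 := by simpa [hsg] using hne
          have := h1 j' e' this
          exact ⟨this.1, mem_insert_of_mem this.2.1, mem_insert_of_mem this.2.2⟩
        · simp only [sg, ite_eq_right_iff, Classical.not_imp] at hsg
          obtain ⟨⟨rfl, rfl⟩, -⟩ := hsg
          refine ⟨hje, ?_⟩
          rcases hcases with ⟨rfl, rfl⟩ | ⟨rfl, rfl⟩ <;> simp [h3]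
      · intro u
        rw [bd_add, h2, s.bd_sg (s.V_lt j hje.1)]
        have hv : ∀ v : ZMod 2, v + v = 0 := CharTwo.add_self_eq_zero
        rcases hcases with ⟨rfl, rfl⟩ | ⟨rfl, rfl⟩
        · linear_combination hv (if u = Sum.inl j then (1 : ZMod 2) else 0)
        · linear_combination hv (if u = Sum.inr e then (1 : ZMod 2) else 0)
      · rw [coe_insert]
        intro u hu v hv huv
        rcases Set.mem_insert_iff.1 hu with hu' | hu' <;>
          rcases Set.mem_insert_iff.1 hv with hv' | hv'
        · rw [hu', hv']
        · have := h5 v hv'; rw [hu'] at huv; omega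
        · have := h5 u hu'; rw [hv'] at huv; omega
        · exact h4 hu' hv' huv
      · intro u hu
        rcases mem_insert.1 hu with rfl | hu
        · exact hz.le
        · have := h5 u hu; omega

/-- The residues too close to a multiple of `T`. -/
def badRes (T : ℕ) : Finset ℕ := {0, 1, T - 2, T - 1}

theorem div_eq_of_residue {T a b : ℕ} (hT : 5 ≤ T) (h : b % T ∉ badRes T) (h1 : a ≤ b + 2)
    (h2 : b ≤ a + 2) : a / T = b / T := by
  simp only [badRes, mem_insert, mem_singleton, not_or] at h
  have hb := Nat.div_add_mod b T
  have hlt := Nat.mod_lt b (show 0 < T by omega)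
  have e1 : a = (a - T * (b / T)) + T * (b / T) := by omega
  rw [e1, Nat.add_mul_div_left _ _ (by omega), Nat.div_eq_of_lt (by omega), zero_add]

set_option maxHeartbeats 1000000 in
/-- Every sweep with weighted nodes has a small balanced separator. -/
theorem exists_separator (h0 : 0 ∈ s.V) (ω : ℕ ⊕ M → ℝ) (hω : ∀ z, 0 ≤ ω z) (W : ℝ)
    (hW : ∑ z ∈ s.nodes, ω z = W) (hsmall : ∀ z ∈ s.nodes, ω z ≤ W / 10) :
    ∃ Y ⊆ s.nodes, (#Y : ℝ) ≤ 60 * √(#s.nodes) ∧ ∃ mu : ℕ → M → Bool, s.Cst Y mu ∧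
      ∀ a, ∑ z ∈ s.nodes \ Y with mu (s.rep z).1 (s.rep z).2 = a, ω z ≤ 9 / 10 * W := by
  set N := #s.nodes with hN
  set T := Nat.sqrt N + 5 with hT
  have hT5 : 5 ≤ T := by omega
  have hN1 : 1 ≤ N := card_pos.2 ⟨.inl 0, s.inl_mem_nodes.2 h0⟩
  have hNT : N < T * T := lt_of_lt_of_le (Nat.sqrt_lt'.1 (Nat.lt_succ_self _))
    (by rw [sq]; exact Nat.mul_le_mul (by omega) (by omega))
  have hW0 : 0 ≤ W := hW ▸ sum_nonneg fun z _ => hω z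
  obtain ⟨r, hrT, hr⟩ := exists_shift s.nodes s.dist T (by omega) (badRes T)
  set Bad := s.nodes.filter fun z => (s.dist z + r) % T ∈ badRes T with hBad
  have hcR : #(badRes T) ≤ 4 := card_le_four
  have hBadcard : #Bad ≤ 4 * T := by
    have : T * #Bad ≤ T * (4 * T) := by nlinarith
    exact Nat.le_of_mul_le_mul_left this (by omega)
  have hTs : (T : ℝ) ≤ √N + 5 := by
    rw [hT]; push_cast
    have : (Nat.sqrt N : ℝ) ≤ √N := Real.nat_sqrt_le_real_sqrt
    linarith
  have hs1 : (1 : ℝ) ≤ √N := by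
    rw [Real.one_le_sqrt]; exact_mod_cast hN1
  set band : M → ℕ := fun b => (s.dist (.inr b) + r) / T with hband
  have hbandc : ∀ k b e, Cons (s.line k) b e → e ≠ s.top → Sum.inr e ∉ Bad → band b = band e := by
    intro k b e hc ht he
    have hk : 1 ≤ k := by
      rcases Nat.eq_zero_or_pos k with rfl | h
      · rw [line, s.line_zero] at hc
        rcases cons_cons_iff.1 hc with h | h
        · exact absurd h.2.symm ht
        · exact absurd h not_cons_singleton
      · exact h
    have hb : e ≠ s.bot := s.ne_bot_of_cons hc
    obtain ⟨-, i2, i3, -⟩ := s.birth_spec h0 hk hc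
    have hd1 := s.dist_con h0 i2
    have hd2 := s.dist_con h0 i3
    have hes : Sum.inr e ∈ s.nodes := by
      rw [inr_mem_nodes, mem_segs]; exact s.S_of_line hc.mem_right hb ht
    apply div_eq_of_residue hT5
    · intro h; exact he (mem_filter.2 ⟨hes, h⟩)
    · omega
    · omega
  set bz : ℕ ⊕ M → ℕ := fun z => band (s.rep z).2 with hbz
  by_cases hcase : ∀ q, ∑ z ∈ s.nodes with bz z = q, ω z ≤ 8 / 10 * W
  · -- an initial run of the bands is balanced
    set f : ℕ → ℝ := fun q => ∑ z ∈ s.nodes with bz z < q, ω z with hf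
    have hex : ∃ q, W / 10 ≤ f q := by
      refine ⟨s.nodes.sup bz + 1, ?_⟩
      have : s.nodes.filter (fun z => bz z < s.nodes.sup bz + 1) = s.nodes :=
        filter_true_of_mem fun z hz => Nat.lt_succ_of_le (le_sup (f := bz) hz)
      simp only [hf, this, hW]; linarith
    set q := Nat.find hex with hq
    have hq1 : W / 10 ≤ f q := Nat.find_spec hex
    have hq2 : f q ≤ 9 / 10 * W := by
      rcases Nat.eq_zero_or_pos q with h | h
      · rw [h]; simp [hf]; linarith
      · obtain ⟨p, hp⟩ : ∃ p, q = p + 1 := ⟨q - 1, by omega⟩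
        have h1 : f p < W / 10 := not_le.1 (Nat.find_min hex (show p < q by omega))
        have h2 : f q = f p + ∑ z ∈ s.nodes with bz z = p, ω z := by
          rw [hp]
          simp only [hf]
          rw [← sum_union (disjoint_filter.2 fun z _ h => by omega), ← filter_or]
          congr 1
          apply filter_congr
          intro z _; omega
        have := hcase p
        linarith
    refine ⟨Bad, filter_subset _ _, ?_, fun _ b => decide (band b < q), ?_, ?_⟩
    · have : (#Bad : ℝ) ≤ 4 * T := by exact_mod_cast hBadcard
      linarith
    · exact ⟨fun k b e hc ht he => by simp only [hbandc k b e hc ht he], fun _ _ _ _ => rfl,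
        fun _ _ _ _ => rfl⟩
    · intro a
      have hsplit : f q + ∑ z ∈ s.nodes with ¬ bz z < q, ω z = W := by
        rw [← hW]; exact sum_filter_add_sum_filter_not _ _ _
      cases a
      · refine le_trans (sum_le_sum_of_subset_of_nonneg ?_ fun z _ _ => hω z)
          (show ∑ z ∈ s.nodes with ¬ bz z < q, ω z ≤ _ by linarith)
        intro z hz
        simp only [mem_filter, mem_sdiff, decide_eq_false_iff_not] at hz ⊢
        exact ⟨hz.1.1, hz.2⟩
      · refine le_trans (sum_le_sum_of_subset_of_nonneg ?_ fun z _ _ => hω z) hq2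
        intro z hz
        simp only [mem_filter, mem_sdiff, decide_eq_true_eq] at hz ⊢
        exact ⟨hz.1.1, hz.2⟩
  · push Not at hcase
    obtain ⟨q, hq⟩ := hcase
    set X := s.nodes.filter fun z => bz z = q with hX
    have hpath : ∀ z, ∃ (C : ℕ → M → ZMod 2) (P : Finset (ℕ ⊕ M)),
        (∃ m, WalkTo s.adj (.inl 0) m z) →
        (∀ j e, C j e ≠ 0 → s.Con j e ∧ Sum.inl j ∈ P ∧ Sum.inr e ∈ P) ∧
        (∀ u, s.bd C u = (if u = z then 1 else 0) + (if u = .inl 0 then 1 else 0)) ∧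
        z ∈ P ∧ Set.InjOn s.dist P := by
      intro z
      by_cases h : ∃ m, WalkTo s.adj (.inl 0) m z
      · obtain ⟨C, P, h1, h2, h3, h4, -⟩ := s.exists_path _ z h rfl
        exact ⟨C, P, fun _ => ⟨h1, h2, h3, h4⟩⟩
      · exact ⟨0, ∅, fun h' => absurd h' h⟩
    choose π P hπ using hpath
    obtain ⟨j, e, hje, hbal⟩ := s.exists_balanced_cycle h0 π X (filter_subset _ _) ω hω (W / 10)
      (15 / 100 * W) (by linarith) (fun z hz => hsmall z (mem_filter.1 hz).1) (by linarith)
    obtain ⟨p1, p2, p3, p4⟩ := hπ (.inl j) (s.reach_inl h0 hje.1)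
    obtain ⟨r1, r2, r3, r4⟩ := hπ (.inr e) (s.reach_con h0 hje)
    set C := sg j e + π (.inl j) + π (.inr e) with hC
    have hCsupp : ∀ j' e', C j' e' ≠ 0 → s.Con j' e' ∧
        Sum.inl j' ∈ P (.inl j) ∪ P (.inr e) ∧ Sum.inr e' ∈ P (.inl j) ∪ P (.inr e) := by
      intro j' e' hne
      simp only [mem_union]
      by_cases h1 : π (.inl j) j' e' = 0
      · by_cases h2 : π (.inr e) j' e' = 0
        · have hsg : sg j e j' e' ≠ 0 := by simpa [hC, h1, h2] using hne
          simp only [sg, ne_eq, ite_eq_right_iff, Classical.not_imp] at hsg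
          obtain ⟨⟨rfl, rfl⟩, -⟩ := hsg
          exact ⟨hje, Or.inl p3, Or.inr r3⟩
        · have := r1 _ _ h2; tauto
      · have := p1 _ _ h1; tauto
    have hbd : ∀ u, s.bd C u = 0 := by
      intro u
      rw [hC, bd_add, bd_add, s.bd_sg (s.V_lt j hje.1), p2, r2]
      have h2 : ∀ v : ZMod 2, v + v = 0 := CharTwo.add_self_eq_zero
      linear_combination h2 (if u = Sum.inl j then (1 : ZMod 2) else 0) +
        h2 (if u = Sum.inr e then (1 : ZMod 2) else 0) +
          h2 (if u = Sum.inl 0 then (1 : ZMod 2) else 0)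
    set Q := s.nodes.filter fun z => z ∈ P (.inl j) ∪ P (.inr e) with hQ
    have hchi : s.Cst Q (s.chi C) :=
      s.cst_chi C (fun j' e' h => (hCsupp j' e' h).1) (fun e' => hbd (.inr e'))
        (fun j' => hbd (.inl j')) _ (fun j' e' h hb ht => mem_filter.2
          ⟨s.inr_mem_nodes.2 (s.mem_segs.2 (s.S_of_con (hCsupp j' e' h).1 hb ht)),
            (hCsupp j' e' h).2.2⟩)
        (fun j' e' h => mem_filter.2 ⟨s.inl_mem_nodes.2 (hCsupp j' e' h).1.1, (hCsupp j' e' h).2.1⟩)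
    have hcnt : ∀ z, Set.InjOn s.dist (P z) →
        #(s.nodes.filter fun u => u ∈ P z ∧ bz u = q) ≤ T + 2 + r := by
      intro z hz
      apply card_le_of_injOn_interval _ s.dist (hz.mono fun u hu => ?_) (q * T - 1 - r)
      · intro u hu
        obtain ⟨hu1, hu2, hu3⟩ := mem_filter.1 hu
        have hd : s.dist u ≤ s.dist (.inr (s.rep u).2) + 1 ∧
            s.dist (.inr (s.rep u).2) ≤ s.dist u + 1 := by
          rcases u with i | b
          · exact s.dist_con h0 ⟨s.inl_mem_nodes.1 hu1, Or.inl rfl⟩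
          · simp only [rep]; omega
        simp only [hbz, hband] at hu3
        have h1 := Nat.div_mul_le_self (s.dist (.inr (s.rep u).2) + r) T
        have h2 := Nat.lt_div_mul_add (a := s.dist (.inr (s.rep u).2) + r) (b := T) (by omega)
        rw [hu3] at h1 h2
        omega
      · simp only [coe_filter, Set.mem_ofPred_eq] at hu
        exact hu.2.1
    set Y := Bad ∪ ((s.nodes.filter fun u => u ∈ P (.inl j) ∧ bz u = q) ∪
      (s.nodes.filter fun u => u ∈ P (.inr e) ∧ bz u = q)) with hY
    have hYmem : ∀ z ∈ s.nodes, z ∈ P (.inl j) ∪ P (.inr e) → bz z = q → z ∈ Y := by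
      intro z hz h1 h2
      rw [hY, mem_union, mem_union, mem_filter, mem_filter]
      rw [mem_union] at h1
      rcases h1 with h1 | h1
      · exact Or.inr (Or.inl ⟨hz, h1, h2⟩)
      · exact Or.inr (Or.inr (mem_filter.2 ⟨hz, h1, h2⟩))
    refine ⟨Y, ?_, ?_, fun k b => decide (band b = q ∧ s.chi C k b = 1), ?_, ?_⟩
    · exact union_subset (filter_subset _ _) (union_subset (filter_subset _ _) (filter_subset _ _))
    · have : #Y ≤ 4 * T + ((T + 2 + r) + (T + 2 + r)) :=
        (card_union_le _ _).trans (add_le_add hBadcard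
          ((card_union_le _ _).trans (add_le_add (hcnt _ p4) (hcnt _ r4))))
      have h3 : (#Y : ℝ) ≤ 8 * T + 4 := by
        have : #Y ≤ 8 * T + 4 := by omega
        exact_mod_cast this
      linarith
    · refine ⟨?_, ?_, ?_⟩
      · intro k b e' hc ht he
        have h1 := hbandc k b e' hc ht fun h => he (mem_union_left _ h)
        rw [decide_eq_decide, h1]
        apply and_congr_right
        intro hbq
        by_cases hmem : Sum.inr e' ∈ Q
        · exfalso
          have hb : e' ≠ s.bot := s.ne_bot_of_cons hc
          apply he
          exact hYmem _ (mem_filter.1 hmem).1 (mem_filter.1 hmem).2 hbq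
        · rw [hchi.vertical k b e' hc ht hmem]
      · intro i b hb hx
        rw [decide_eq_decide]
        apply and_congr_right
        intro hbq
        have : b ≠ s.x i ∨ Sum.inl i ∉ Q := by
          by_contra! hcon
          rcases hx with hx | hx
          · exact hx hcon.1
          · apply hx
            apply hYmem _ (mem_filter.1 hcon.2).1 (mem_filter.1 hcon.2).2
            simp only [hbz, rep, ← hcon.1]
            exact hbq
        rw [hchi.pass_below i b hb this]
      · intro i b hb ht
        rw [hchi.pass_above i b hb ht]
    · intro a
      have hsub : ∀ (c : ZMod 2), (∀ z ∈ X, s.chi C (s.rep z).1 (s.rep z).2 = c →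
          decide (band (s.rep z).2 = q ∧ s.chi C (s.rep z).1 (s.rep z).2 = 1) ≠ a) →
          ∑ z ∈ s.nodes \ Y with
            decide (band (s.rep z).2 = q ∧ s.chi C (s.rep z).1 (s.rep z).2 = 1) = a, ω z
          ≤ 9 / 10 * W := by
        intro c hc
        have h1 := hbal c
        have h2 : ∑ z ∈ s.nodes \ Y with
            decide (band (s.rep z).2 = q ∧ s.chi C (s.rep z).1 (s.rep z).2 = 1) = a, ω z +
            ∑ z ∈ X with s.chi C (s.rep z).1 (s.rep z).2 = c, ω z ≤ W := by
          rw [← hW, ← sum_union]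
          · apply sum_le_sum_of_subset_of_nonneg _ fun z _ _ => hω z
            intro z hz
            simp only [mem_union, mem_filter, mem_sdiff, hX] at hz
            tauto
          · rw [Finset.disjoint_left]
            intro z hz hz'
            rw [mem_filter] at hz hz'
            exact hc z hz'.1 hz'.2 hz.2
        linarith
      cases a
      · apply hsub 1
        intro z hz h
        have hzq : band (s.rep z).2 = q := (mem_filter.1 hz).2
        simp [hzq, h]
      · apply hsub 0
        intro z hz h
        simp [h]

end Sweep

/-- The closed half-plane with coefficients `h`. -/
def Half (h : ℝ × ℝ × ℝ) (p : ℝ × ℝ) : Prop := h.2.2 ≤ h.1 * p.1 + h.2.1 * p.2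

/-- The subsets of `Q` cut out by closed half-planes. -/
def halfTraces {α : Type*} (P : α → ℝ × ℝ) (Q : Finset α) : Finset (Finset α) :=
  Q.powerset.filter fun T => ∃ h, T = Q.filter fun p => Half h (P p)

theorem mem_halfTraces {α : Type*} (P : α → ℝ × ℝ) (Q : Finset α) (h : ℝ × ℝ × ℝ) :
    Q.filter (fun p => Half h (P p)) ∈ halfTraces P Q :=
  mem_filter.2 ⟨mem_powerset.2 (filter_subset _ _), h, rfl⟩

theorem card_le_three_of_shatters {α : Type*} (P : α → ℝ × ℝ) (Q S : Finset α)
    (hS : (halfTraces P Q).Shatters S) : #S ≤ 3 := by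
  by_contra! hcard
  have hdep : ¬ AffineIndependent ℝ (fun p : S => P p) := by
    intro hind
    have h1 := hind.card_le_finrank_succ
    have h2 : Module.finrank ℝ (vectorSpan ℝ (Set.range fun p : S => P p)) ≤ 2 := by
      refine (Submodule.finrank_le _).trans ?_
      simp
    simp only [Fintype.card_coe] at h1
    omega
  obtain ⟨I, z, hz1, hz2⟩ := Convex.radon_partition hdep
  obtain ⟨u, hu, hSu⟩ := hS (t := S.filter fun p => ∃ hp : p ∈ S, (⟨p, hp⟩ : S) ∈ I)
    (filter_subset _ _)
  obtain ⟨hu1, h, rfl⟩ := mem_filter.1 hu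
  have hSQ : S ⊆ Q := by
    obtain ⟨t, ht, hst⟩ := hS.exists_superset
    exact hst.trans (mem_powerset.1 (mem_filter.1 ht).1)
  have key : ∀ p : S, Half h (P p) ↔ p ∈ I := by
    intro p
    have := Finset.ext_iff.1 hSu p
    simp only [mem_inter, mem_filter, p.2, true_and, hSQ p.2] at this
    rw [this]
    exact ⟨fun ⟨_, h⟩ => h, fun h => ⟨trivial, h⟩⟩
  let L : ℝ × ℝ →ₗ[ℝ] ℝ := h.1 • LinearMap.fst ℝ ℝ ℝ + h.2.1 • LinearMap.snd ℝ ℝ ℝ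
  have hc1 : Convex ℝ {p : ℝ × ℝ | h.2.2 ≤ L p} := convex_halfSpace_ge L.isLinear _
  have hc2 : Convex ℝ {p : ℝ × ℝ | L p < h.2.2} := convex_halfSpace_lt L.isLinear _
  have h1 : z ∈ {p : ℝ × ℝ | h.2.2 ≤ L p} := by
    refine convexHull_min ?_ hc1 hz1
    rintro _ ⟨p, hp, rfl⟩
    have := (key p).2 hp
    simpa [L, Half] using this
  have h2 : z ∈ {p : ℝ × ℝ | L p < h.2.2} := by
    refine convexHull_min ?_ hc2 hz2
    rintro _ ⟨p, hp, rfl⟩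
    have := mt (key p).1 hp
    simpa [L, Half] using this
  exact absurd (show h.2.2 ≤ L z from h1) (not_le.2 h2)

theorem card_subsets_le {α : Type*} (Q : Finset α) :
    #(Q.powerset.filter fun S => #S ≤ 3) ≤ (#Q + 1) ^ 3 := by
  have hsub : (Q.powerset.filter fun S => #S ≤ 3) ⊆
      (Fintype.piFinset fun _ : Fin 3 => insertNone Q).image
        fun g => Q.filter fun p => ∃ i, g i = some p := by
    intro S hS
    obtain ⟨h1, h2⟩ := mem_filter.1 hS
    rw [mem_powerset] at h1
    rw [mem_image]
    let g : Fin 3 → Option α := fun i => S.toList[(i : ℕ)]?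
    refine ⟨g, Fintype.mem_piFinset.2 fun i => ?_, ?_⟩
    · rw [mem_insertNone]
      intro a ha
      exact h1 (mem_toList.1 (List.mem_of_getElem? ha))
    · ext p
      rw [mem_filter]
      constructor
      · rintro ⟨-, i, hi⟩
        exact mem_toList.1 (List.mem_of_getElem? hi)
      · intro hp
        refine ⟨h1 hp, ?_⟩
        obtain ⟨i, hi, hip⟩ := List.mem_iff_getElem.1 (mem_toList.2 hp)
        refine ⟨⟨i, ?_⟩, ?_⟩
        · rw [length_toList] at hi; omega
        · simp only [g]
          rw [List.getElem?_eq_getElem hi, hip]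
  refine (card_le_card hsub).trans (card_image_le.trans ?_)
  simp

theorem card_halfTraces_le {α : Type*} (P : α → ℝ × ℝ) (Q : Finset α) :
    #(halfTraces P Q) ≤ (#Q + 1) ^ 3 := by
  refine (card_le_card_shatterer _).trans ((card_le_card ?_).trans (card_subsets_le Q))
  intro S hS
  rw [mem_shatterer] at hS
  refine mem_filter.2 ⟨?_, card_le_three_of_shatters P Q S hS⟩
  obtain ⟨t, ht, hst⟩ := hS.exists_superset
  exact mem_powerset.2 (hst.trans (mem_powerset.1 (mem_filter.1 ht).1))

namespace Sweep

variable {M : Type} (s : Sweep M)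

/-- Realization of a sweep by straight lines and points; `W` lists the indices with a point. -/
structure Geo (W : Finset ℕ) (pt : ℕ → ℝ × ℝ) (sl ic : M → ℝ) : Prop where
  mono : ∀ i ∈ W, ∀ j ∈ W, i < j → (pt i).1 < (pt j).1
  below : ∀ i ∈ W, ∀ e ∈ s.A i, e ≠ s.bot → sl e * (pt i).1 + ic e < (pt i).2
  above : ∀ i ∈ W, ∀ e ∈ s.B i, e ≠ s.top → (pt i).2 < sl e * (pt i).1 + ic e

variable {s}

theorem Geo.restrict {W : Finset ℕ} {pt : ℕ → ℝ × ℝ} {sl ic : M → ℝ} (h : s.Geo W pt sl ic)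
    {U : Finset (ℕ ⊕ M)} {hU : s.Closed U} : (s.restrict U hU).Geo W pt sl ic where
  mono := h.mono
  below i hi e he := h.below i hi e (List.mem_of_mem_filter he)
  above i hi e he := h.above i hi e (List.mem_of_mem_filter he)

theorem Geo.le_of {W : Finset ℕ} {pt : ℕ → ℝ × ℝ} {sl ic : M → ℝ} (h : s.Geo W pt sl ic)
    {i j : ℕ} (hi : i ∈ W) (hj : j ∈ W) (hij : (pt i).1 ≤ (pt j).1) : i ≤ j := by
  by_contra! hlt
  exact absurd (h.mono j hj i hi hlt) (not_lt.2 hij)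

theorem cons_x_y {i : ℕ} (hi : i ∉ s.V) : Cons (s.line (i + 1)) (s.x i) (s.y i) := by
  obtain ⟨a, c, ha, hc, h1, h2⟩ := s.line_split i
  rw [h2, s.S_nil hi]
  exact ⟨a, c, rfl⟩

theorem eq_x_of_cons {i : ℕ} {b t : M} (hc : Cons (s.line (i + 1)) b t)
    (hb : b ∈ s.A i) (ht : t ∈ s.B i) : b = s.x i := by
  obtain ⟨a, c, ha, hc', h1, h2⟩ := s.line_split i
  rw [ha] at hb
  by_contra hne
  have hba : b ∈ a := by simpa [hne] using hb
  obtain ⟨p, q, rfl⟩ := List.append_of_mem hba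
  have hn := s.line_nodup (i + 1)
  obtain ⟨t', ht', hct⟩ : ∃ t', t' ∈ s.A i ∧ Cons (s.line (i + 1)) b t' := by
    rw [h2, ha]
    cases q with
    | nil => exact ⟨s.x i, by simp, p, s.S i ++ s.y i :: c, by simp⟩
    | cons d q => exact ⟨d, by simp, p, q ++ s.x i :: (s.S i ++ s.y i :: c), by simp⟩
  rw [hc.right_unique hn hct] at ht
  exact (s.nodup_split i).2.2.2.2.1 _ ht' ht

variable [Fintype M]

/-- Labels are constant along a trapezoid. -/
theorem Cst.along_gap {κ : Type} {lam : ℕ → M → κ} (h : s.Cst s.nodes lam) {β k : ℕ} {b t : M}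
    (hc : ∀ k', β < k' → k' ≤ k → Cons (s.line k') b t)
    (hx : ∀ j ∈ s.V, β < j → j < k → b ≠ s.x j) {k' : ℕ} (h1 : β < k') (h2 : k' ≤ k) :
    lam k' b = lam (β + 1) b := by
  obtain ⟨d, rfl⟩ := Nat.exists_eq_add_of_le (Nat.succ_le_of_lt h1)
  clear h1
  induction d with
  | zero => rfl
  | succ d ih =>
    rw [← ih (by omega)]
    symm
    have hc1 := hc (β + 1 + d) (by omega) (by omega)
    have hc2 := hc (β + 1 + (d + 1)) (by omega) (by omega)
    have hbt : b ≠ s.top := by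
      rintro rfl
      obtain ⟨l, hl⟩ := s.line_head (β + 1 + d)
      rw [hl] at hc1
      have hn := s.line_nodup (β + 1 + d)
      rw [hl] at hn
      have := hc1.after_eq hn
      rw [show s.bot :: (l ++ [s.top]) = (s.bot :: l) ++ s.top :: [] by simp, after_append] at this
      · cases this
      · intro hmem
        rw [show s.bot :: (l ++ [s.top]) = (s.bot :: l) ++ [s.top] by simp,
          List.nodup_append] at hn
        exact hn.2.2 _ hmem _ (by simp) rfl
    rcases s.AB_of_both hc1.mem_left hc2.mem_left with hA | hB
    · apply h.pass_below _ _ hA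
      by_cases hj : β + 1 + d ∈ s.V
      · exact Or.inl (hx _ hj (by omega) (by omega))
      · exact Or.inr fun h' => hj (s.inl_mem_nodes.1 h')
    · exact h.pass_above _ _ hB hbt

/-- Each trapezoid is cut out by four half-planes. -/
theorem Geo.cells {κ : Type} {W : Finset ℕ} {pt : ℕ → ℝ × ℝ} {sl ic : M → ℝ}
    (hG : s.Geo W pt sl ic) (h0 : 0 ∈ s.V) {lam : ℕ → M → κ} (h : s.Cst s.nodes lam)
    (Q : Finset ℕ) (hQ : ∀ q ∈ Q, q ∈ W ∧ q ∉ s.V) :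
    ∃ key : ℕ → ℕ ⊕ M, (∀ q ∈ Q, key q ∈ s.nodes) ∧ ∃ F : ℕ ⊕ M → κ, ∀ z,
      ∃ H : Fin 4 → ℝ × ℝ × ℝ, (∀ q ∈ Q, key q = z → ∀ i, Half (H i) (pt q)) ∧
        ∀ q ∈ Q, (∀ i, Half (H i) (pt q)) → lam (q + 1) (s.x q) = F z := by
  let β : ℕ → ℕ := fun q => s.birth (q + 1) (s.x q)
  let key : ℕ → ℕ ⊕ M := fun q => if s.x q = s.x (β q) then .inl (β q) else .inr (s.x q)
  have hspec := fun (q : ℕ) (hq : q ∈ Q) =>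
    s.birth_spec h0 (k := q + 1) (by omega) (cons_x_y (hQ q hq).2)
  have hrep : ∀ q ∈ Q, s.rep (key q) = (β q + 1, s.x q) := by
    intro q hq
    obtain ⟨-, -, -, -, -, i6⟩ := hspec q hq
    by_cases hx : s.x q = s.x (β q)
    · simp only [key, if_pos hx, rep, ← hx]
    · simp only [key, if_neg hx, rep]
      rw [(s.S_st _ _ (i6.resolve_left hx)).1]
  refine ⟨key, ?_, fun z => lam (s.rep z).1 (s.rep z).2, fun z => ?_⟩
  · intro q hq
    obtain ⟨-, i2, -, -, -, i6⟩ := hspec q hq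
    by_cases hx : s.x q = s.x (β q)
    · simp only [key, if_pos hx]
      exact s.inl_mem_nodes.2 i2.1
    · simp only [key, if_neg hx]
      exact s.inr_mem_nodes.2 (s.mem_segs_of_S (i6.resolve_left hx))
  set D := Q.filter fun q => key q = z with hD
  rcases D.eq_empty_or_nonempty with hemp | hne
  · refine ⟨fun _ => (0, 0, 1), ?_, ?_⟩
    · intro q hq hk
      have : q ∈ D := mem_filter.2 ⟨hq, hk⟩
      rw [hemp] at this
      simp at this
    · intro q hq hH
      have := hH 0
      simp only [Half] at this
      norm_num at this
  set b := (s.rep z).2 with hb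
  obtain ⟨p1, hp1, hmin⟩ := exists_min_image D (fun q => (pt q).1) hne
  obtain ⟨p2, hp2, hmax⟩ := exists_max_image D (fun q => (pt q).1) hne
  obtain ⟨p3, hp3, hlow⟩ := exists_min_image D (fun q => (pt q).2 - sl b * (pt q).1) hne
  set t := s.y p2 with ht
  obtain ⟨p4, hp4, hhigh⟩ := exists_min_image D (fun q => sl t * (pt q).1 - (pt q).2) hne
  have hDx : ∀ q ∈ D, q ∈ Q ∧ s.x q = b ∧ β q + 1 = (s.rep z).1 := by
    intro q hq
    obtain ⟨h1, h2⟩ := mem_filter.1 hq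
    have := hrep q h1
    rw [h2] at this
    exact ⟨h1, by rw [hb, this], by rw [this]⟩
  obtain ⟨hp2Q, hp2x, hp2β⟩ := hDx p2 hp2
  obtain ⟨i1, i2, i3, i4, i5, i6⟩ := hspec p2 hp2Q
  change β p2 < _ at i1
  have i4' : ∀ k', β p2 < k' → k' ≤ p2 + 1 → Cons (s.line k') b t := by
    intro k' h1 h2
    have := i4 k' h1 h2
    rwa [hp2x] at this
  have hDle : ∀ q ∈ D, q ≤ p2 := fun q hq =>
    hG.le_of (hQ q (hDx q hq).1).1 (hQ p2 hp2Q).1 (hmax q hq)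
  have hDlt : ∀ q ∈ D, β p2 < q := by
    intro q hq
    obtain ⟨j1, j2, j3, -⟩ := hspec q (hDx q hq).1
    have e : β q = β p2 := by
      have := (hDx q hq).2.2
      omega
    change β q < _ at j1
    have hne' : q ≠ β p2 := by
      intro h'
      apply (hQ q (hDx q hq).1).2
      rw [h', ← e]
      exact j2.1
    omega
  have hDy : ∀ q ∈ D, s.y q = t := by
    intro q hq
    have hcq := cons_x_y (s := s) (hQ q (hDx q hq).1).2
    rw [(hDx q hq).2.1] at hcq
    have := i4' (q + 1) (by have := hDlt q hq; omega) (by have := hDle q hq; omega)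
    exact hcq.right_unique (s.line_nodup _) this
  have hbt : b ≠ t := by
    have := i4' (p2 + 1) i1 le_rfl
    intro h'
    rw [← h'] at this
    have e := this.after_eq (s.line_nodup _)
    have := not_mem_after (b := b) (s.line_nodup (p2 + 1))
    rw [e] at this
    simp at this
  refine ⟨![(1, 0, (pt p1).1), (-1, 0, -(pt p2).1),
    if b = s.bot then (0, 0, 0) else (-sl b, 1, (pt p3).2 - sl b * (pt p3).1),
    if t = s.top then (0, 0, 0) else (sl t, -1, sl t * (pt p4).1 - (pt p4).2)], ?_, ?_⟩
  · intro q hq hk i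
    have hqD : q ∈ D := mem_filter.2 ⟨hq, hk⟩
    have m1 := hmin q hqD
    have m2 := hmax q hqD
    have m3 := hlow q hqD
    have m4 := hhigh q hqD
    fin_cases i
    · simp [Half]; linarith
    · simp [Half]; linarith
    · simp only [Half]; simp
      split_ifs
      · simp
      · simp; linarith
    · simp only [Half]; simp
      split_ifs
      · simp
      · simp; linarith
  · intro q hq hH
    have e1 := hH 0
    have e2 := hH 1
    have e3 := hH 2
    have e4 := hH 3
    simp [Half] at e1 e2 e3 e4
    have hqW := (hQ q hq).1
    have hq2 : q ≤ p2 := hG.le_of hqW (hQ p2 hp2Q).1 e2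
    have hq1 : p1 ≤ q := hG.le_of (hQ p1 (hDx p1 hp1).1).1 hqW e1
    have hβq : β p2 < q := lt_of_lt_of_le (hDlt p1 hp1) hq1
    have hcq := i4' (q + 1) (by omega) (by omega)
    have hqline : s.line (q + 1) = s.A q ++ s.B q := by
      rw [line_succ, s.S_nil (hQ q hq).2]; simp
    have hbA : b ∈ s.A q := by
      have := hcq.mem_left
      rw [hqline, List.mem_append] at this
      rcases this with h' | h'
      · exact h'
      exfalso
      have hbb := s.ne_bot_of_B h'
      by_cases hbtop : b = s.top
      · obtain ⟨l, hl⟩ := s.A_head p2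
        have := s.x_mem_A p2
        rw [hp2x] at this
        exact s.ne_top_of_A this hbtop
      · have g1 := hG.above q hqW b h' hbtop
        rw [if_neg hbb] at e3
        have g2 := hG.below p3 (hQ p3 (hDx p3 hp3).1).1 b
          (by rw [← (hDx p3 hp3).2.1]; exact s.x_mem_A p3) hbb
        simp at e3
        linarith
    have htB : t ∈ s.B q := by
      have := hcq.mem_right
      rw [hqline, List.mem_append] at this
      rcases this with h' | h'
      swap
      · exact h'
      exfalso
      have htt := s.ne_top_of_A h'
      have htb : t ≠ s.bot := s.ne_bot_of_B (by rw [ht]; exact s.y_mem_B p2)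
      have g1 := hG.below q hqW t h' htb
      rw [if_neg htt] at e4
      have g2 := hG.above p4 (hQ p4 (hDx p4 hp4).1).1 t
        (by rw [← hDy p4 hp4]; exact s.y_mem_B p4) htt
      simp at e4
      linarith
    rw [← eq_x_of_cons hcq hbA htB]
    have : (s.rep z).1 = β p2 + 1 := hp2β.symm
    simp only [this]
    rw [← hb]
    refine h.along_gap (k := p2 + 1) i4' (fun j hj h1 h2 h3 => ?_) (by omega) (by omega)
    exact i5 j hj h1 h2 (Or.inl (by rw [hp2x]; exact h3))

end Sweep

/-- Shear in the direction of the first axis. -/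
def shear (ε : ℝ) (p : ℝ × ℝ) : ℝ × ℝ := (p.1 + ε * p.2, p.2)

theorem half_shear (h : ℝ × ℝ × ℝ) (ε : ℝ) (p : ℝ × ℝ) :
    Half h (shear ε p) ↔ Half (h.1, h.1 * ε + h.2.1, h.2.2) p := by
  simp only [Half, shear]
  rw [show h.1 * (p.1 + ε * p.2) + h.2.1 * p.2 = h.1 * p.1 + (h.1 * ε + h.2.1) * p.2 by ring]

/-- A labelling `f` of the points `Q`, induced by a planar system whose remaining `m` nodes
separate points of different labels. -/
structure Realization {α κ : Type} (P : α → ℝ × ℝ) (Q : Finset α) (m : ℕ) (f : α → κ) where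
  M : Type
  inst : Fintype M
  s : Sweep M
  W : Finset ℕ
  pt : ℕ → ℝ × ℝ
  sl : M → ℝ
  ic : M → ℝ
  ε : ℝ
  idx : α → ℕ
  Z : Finset (ℕ ⊕ M)
  lam : ℕ → M → κ
  geo : s.Geo W pt sl ic
  inj : Set.InjOn idx Q
  idx_W : ∀ p ∈ Q, idx p ∈ W
  idx_Z : ∀ p ∈ Q, Sum.inl (idx p) ∉ Z
  idx_pt : ∀ p ∈ Q, pt (idx p) = shear ε (P p)
  nodes_eq : s.nodes = Z ∪ Q.image fun p => Sum.inl (idx p)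
  card_Z : #Z = m
  closed : s.Closed Z
  zero_mem : Sum.inl 0 ∈ Z
  cst : s.Cst Z lam
  f_eq : ∀ p ∈ Q, f p = lam (idx p + 1) (s.x (idx p))

attribute [instance] Realization.inst

/-- The labellings with a realization. -/
def labelings {α κ : Type} [Fintype α] [Fintype κ] [Inhabited κ] (P : α → ℝ × ℝ) (Q : Finset α)
    (m : ℕ) : Finset (α → κ) :=
  univ.filter fun f => (∀ p ∉ Q, f p = default) ∧ Nonempty (Realization P Q m f)

theorem mem_labelings {α κ : Type} [Fintype α] [Fintype κ] [Inhabited κ] {P : α → ℝ × ℝ}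
    {Q : Finset α} {m : ℕ} {f : α → κ} :
    f ∈ labelings P Q m ↔ (∀ p ∉ Q, f p = default) ∧ Nonempty (Realization P Q m f) := by
  simp [labelings]

theorem Realization.cells {α κ : Type} {P : α → ℝ × ℝ} {Q : Finset α} {m : ℕ} {f : α → κ}
    (r : Realization P Q m f) :
    ∃ key : α → Fin m, ∃ F : Fin m → κ, ∃ H : Fin m → Fin 4 → ℝ × ℝ × ℝ,
      (∀ q ∈ Q, ∀ i, Half (H (key q) i) (P q)) ∧
        ∀ z, ∀ q ∈ Q, (∀ i, Half (H z i) (P q)) → f q = F z := by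
  have hZn : r.Z ⊆ r.s.nodes := by rw [r.nodes_eq]; exact subset_union_left
  set s' := r.s.restrict r.Z r.closed with hs'
  have hn : s'.nodes = r.Z := r.s.restrict_nodes (hU := r.closed) hZn
  have h0 : 0 ∈ s'.V := s'.inl_mem_nodes.1 (hn ▸ r.zero_mem)
  have hc : s'.Cst s'.nodes r.lam := by rw [hn]; exact r.cst.restrict subset_rfl
  obtain ⟨key, hkey, F, hF⟩ := (r.geo.restrict (hU := r.closed)).cells h0 hc (Q.image r.idx) (by
    intro q hq
    obtain ⟨p, hp, rfl⟩ := mem_image.1 hq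
    refine ⟨r.idx_W p hp, fun h => r.idx_Z p hp ?_⟩
    rw [← hn]; exact s'.inl_mem_nodes.2 h)
  choose H hH1 hH2 using hF
  have hcard : #s'.nodes = m := by rw [hn, r.card_Z]
  let e := s'.nodes.equivFinOfCardEq hcard
  have : Nonempty (Fin m) := ⟨e ⟨.inl 0, s'.inl_mem_nodes.2 h0⟩⟩
  refine ⟨fun q => if h : key (r.idx q) ∈ s'.nodes then e ⟨_, h⟩ else Classical.arbitrary _,
    fun i => F (e.symm i),
    fun i j => ((H (e.symm i) j).1, (H (e.symm i) j).1 * r.ε + (H (e.symm i) j).2.1,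
      (H (e.symm i) j).2.2), ?_, ?_⟩
  · intro q hq i
    have hq' := mem_image_of_mem r.idx hq
    dsimp only
    rw [dif_pos (show key (r.idx q) ∈ s'.nodes from hkey _ hq'), ← half_shear, ← r.idx_pt q hq]
    exact hH1 _ _ hq' (by simp) i
  · intro z q hq hh
    have hq' := mem_image_of_mem r.idx hq
    dsimp only
    rw [← hH2 (e.symm z) _ hq' fun i => by rw [r.idx_pt q hq, half_shear]; exact hh i]
    rw [r.f_eq q hq]
    exact (r.cst.restrict_x (hU := r.closed) subset_rfl _).symm

theorem card_labelings_le_pow {α κ : Type} [Fintype α] [Fintype κ] [Inhabited κ]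
    (P : α → ℝ × ℝ) (Q : Finset α) (m : ℕ) :
    #(labelings P Q m : Finset (α → κ)) ≤ ((#Q + 1) ^ 12 * Fintype.card κ) ^ m := by
  let code : Finset (Fin m → (Fin 4 → Finset α) × κ) :=
    Fintype.piFinset fun _ => (Fintype.piFinset fun _ => halfTraces P Q) ×ˢ univ
  let dec : (Fin m → (Fin 4 → Finset α) × κ) → α → κ := fun g p =>
    if h : ∃ i, ∀ j, p ∈ (g i).1 j then (g h.choose).2 else default
  have hsub : (labelings P Q m : Finset (α → κ)) ⊆ code.image dec := by
    intro f hf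
    obtain ⟨hoff, ⟨r⟩⟩ := mem_labelings.1 hf
    obtain ⟨key, F, H, h1, h2⟩ := r.cells
    refine mem_image.2 ⟨fun i => (fun j => Q.filter fun p => Half (H i j) (P p), F i), ?_, ?_⟩
    · refine Fintype.mem_piFinset.2 fun i => mem_product.2 ⟨?_, mem_univ _⟩
      exact Fintype.mem_piFinset.2 fun j => mem_halfTraces P Q _
    · funext p
      dsimp only [dec]
      split_ifs with h
      · have := fun j => mem_filter.1 (h.choose_spec j)
        exact (h2 _ p (this 0).1 fun i => (this i).2).symm
      · by_cases hp : p ∈ Q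
        · exact absurd ⟨key p, fun j => mem_filter.2 ⟨hp, h1 p hp j⟩⟩ h
        · exact (hoff p hp).symm
  refine (card_le_card hsub).trans (card_image_le.trans ?_)
  simp only [code, Fintype.card_piFinset, card_product, prod_const, card_univ, Fintype.card_fin]
  have h : #(halfTraces P Q) ^ 4 ≤ (#Q + 1) ^ 12 :=
    (Nat.pow_le_pow_left (card_halfTraces_le P Q) 4).trans_eq (pow_mul _ 3 4).symm
  exact Nat.pow_le_pow_left (Nat.mul_le_mul_right _ h) m

namespace Sweep

variable {M : Type} {s : Sweep M}

theorem E_of_S {e : M} (he : e ∈ s.S (s.st e)) : e ∈ s.E (s.fi e) := by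
  have hb := s.ne_bot_of_S he
  have ht := s.ne_top_of_S he
  have h1 := s.mem_line_succ_of_S he
  have key : ∀ d, s.st e + 1 + d ≤ s.fi e → e ∈ s.line (s.st e + 1 + d) := by
    intro d
    induction d with
    | zero => exact fun _ => h1
    | succ d ih =>
      intro hd
      have h := ih (by omega)
      have hE : e ∉ s.E (s.st e + 1 + d) := fun hE => by
        have := (s.E_fi _ e hE).1
        omega
      simp only [line, List.mem_append] at h
      rcases h with (h | h) | h
      · exact s.mem_line_succ_of_A h
      · exact absurd h hE
      · exact s.mem_line_succ_of_B h
  have hle := (s.line_mem _ e h1 hb ht).2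
  obtain ⟨d, hd⟩ := Nat.exists_eq_add_of_le hle
  have h := key d hd.ge
  rw [← hd] at h
  have hgt : e ∉ s.line (s.fi e + 1) := fun h' => by
    have := (s.line_mem _ e h' hb ht).2
    omega
  simp only [line, List.mem_append] at h
  rcases h with (h | h) | h
  · exact absurd (s.mem_line_succ_of_A h) hgt
  · exact h
  · exact absurd (s.mem_line_succ_of_B h) hgt

theorem exists_closed [Fintype M] {Y : Finset (ℕ ⊕ M)} (hY : Y ⊆ s.nodes) (h0 : 0 ∈ s.V) :
    ∃ Y', Y ⊆ Y' ∧ Y' ⊆ s.nodes ∧ s.Closed Y' ∧ Sum.inl 0 ∈ Y' ∧ #Y' ≤ 3 * #Y + 1 := by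
  let a : ℕ ⊕ M → ℕ ⊕ M := Sum.elim Sum.inl fun e => Sum.inl (s.st e)
  let b : ℕ ⊕ M → ℕ ⊕ M := Sum.elim Sum.inl fun e => Sum.inl (s.fi e)
  have hsub : ∀ e, Sum.inr e ∈ Y → s.st e ∈ s.V ∧ s.fi e ∈ s.V := fun e he => by
    have h := s.mem_segs.1 (s.inr_mem_nodes.1 (hY he))
    exact ⟨(s.S_st _ e h).2, (s.E_fi _ e (E_of_S h)).2⟩
  refine ⟨insert (Sum.inl 0) (Y ∪ (Y.image a ∪ Y.image b)), fun z hz => by simp [hz], ?_, ?_,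
    by simp, ?_⟩
  · intro z hz
    simp only [mem_insert, mem_union, mem_image] at hz
    rcases hz with rfl | hz | ⟨y, hy, rfl⟩ | ⟨y, hy, rfl⟩
    · exact s.inl_mem_nodes.2 h0
    · exact hY hz
    · rcases y with i | e
      · exact hY hy
      · exact s.inl_mem_nodes.2 (hsub e hy).1
    · rcases y with i | e
      · exact hY hy
      · exact s.inl_mem_nodes.2 (hsub e hy).2
  · intro e he
    have he' : Sum.inr e ∈ Y := by
      simp only [mem_insert, mem_union, mem_image, a, b] at he
      rcases he with h | h | ⟨y, hy, h⟩ | ⟨y, hy, h⟩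
      · cases h
      · exact h
      · rcases y with i | e' <;> cases h
      · rcases y with i | e' <;> cases h
    constructor
    · exact mem_insert_of_mem (mem_union_right _ (mem_union_left _ (mem_image_of_mem a he')))
    · exact mem_insert_of_mem (mem_union_right _ (mem_union_right _ (mem_image_of_mem b he')))
  · have h1 := card_insert_le (Sum.inl 0) (Y ∪ (Y.image a ∪ Y.image b))
    have h2 := card_union_le Y (Y.image a ∪ Y.image b)
    have h3 := card_union_le (Y.image a) (Y.image b)
    have h4 : #(Y.image a) ≤ #Y := card_image_le
    have h5 : #(Y.image b) ≤ #Y := card_image_le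
    omega

/-- The part of a colouring inside one class of another colouring. -/
theorem Cst.cut {κ κ' : Type} [Inhabited κ] {Y Z : Finset (ℕ ⊕ M)} {mu : ℕ → M → κ'}
    {lam : ℕ → M → κ} (hmu : s.Cst Y mu) (hlam : s.Cst Z lam) (a : κ') :
    s.Cst (Y ∪ Z.filter fun z => mu (s.rep z).1 (s.rep z).2 = a)
      fun k b => if mu k b = a then lam k b else default where
  vertical k b e hc ht he := by
    simp only [mem_union, mem_filter, not_or, not_and] at he
    have h1 := hmu.vertical k b e hc ht he.1
    rw [h1]
    split_ifs with ha
    · refine hlam.vertical k b e hc ht fun hZ => he.2 hZ ?_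
      have he' : e ≠ s.bot := ne_bot_of_cons _ hc
      change mu (s.st e + 1) e = a
      rw [hmu.along he.1 he' ht hc.mem_right, ha]
    · rfl
  pass_below i b hb hx := by
    simp only [mem_union, mem_filter, not_or, not_and] at hx
    have h1 := hmu.pass_below i b hb (hx.imp_right And.left)
    rw [h1]
    split_ifs with ha
    · refine hlam.pass_below i b hb ?_
      by_cases hbx : b = s.x i
      · rcases hx with hx | hx
        · exact absurd hbx hx
        · exact Or.inr fun hZ => hx.2 hZ (by change mu (i + 1) (s.x i) = a; rw [← hbx, ha])
      · exact Or.inl hbx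
    · rfl
  pass_above i b hb ht := by
    rw [hmu.pass_above i b hb ht, hlam.pass_above i b hb ht]

theorem closed_cut [Fintype M] {κ' : Type} {Y Z : Finset (ℕ ⊕ M)} {mu : ℕ → M → κ'}
    (hmu : s.Cst Y mu) (hY : s.Closed Y) (hZ : s.Closed Z) (hZn : Z ⊆ s.nodes) (a : κ') :
    s.Closed (Y ∪ Z.filter fun z => mu (s.rep z).1 (s.rep z).2 = a) := by
  intro e he
  simp only [mem_union, mem_filter] at he ⊢
  rcases he with he | ⟨he, ha⟩
  · exact ⟨Or.inl (hY e he).1, Or.inl (hY e he).2⟩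
  · have hS := s.mem_segs.1 (s.inr_mem_nodes.1 (hZn he))
    change mu (s.st e + 1) e = a at ha
    refine ⟨or_iff_not_imp_left.2 fun h => ⟨(hZ e he).1, ?_⟩,
      or_iff_not_imp_left.2 fun h => ⟨(hZ e he).2, ?_⟩⟩
    · change mu (s.st e + 1) (s.x (s.st e)) = a
      rw [hmu.S_eq hY h hS, ha]
    · change mu (s.fi e + 1) (s.x (s.fi e)) = a
      rw [hmu.E_eq hY h (E_of_S hS), ha]

end Sweep

/-- A labelling given by a subset of the nodes of a planar system. -/
theorem Sweep.Geo.nonempty_realization {α κ : Type} {M : Type} [Fintype M] {s : Sweep M}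
    {W : Finset ℕ} {pt : ℕ → ℝ × ℝ} {sl ic : M → ℝ} (geo : s.Geo W pt sl ic) {P : α → ℝ × ℝ}
    {Q : Finset α} {f : α → κ} {ε : ℝ} {idx : α → ℕ} {Z : Finset (ℕ ⊕ M)} {lam : ℕ → M → κ}
    (inj : Set.InjOn idx Q) (idx_W : ∀ p ∈ Q, idx p ∈ W)
    (idx_V : ∀ p ∈ Q, Sum.inl (idx p) ∈ s.nodes)
    (idx_Z : ∀ p ∈ Q, Sum.inl (idx p) ∉ Z) (idx_pt : ∀ p ∈ Q, pt (idx p) = shear ε (P p))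
    (hZ : Z ⊆ s.nodes) (closed : s.Closed Z) (zero_mem : Sum.inl 0 ∈ Z) (cst : s.Cst Z lam)
    (f_eq : ∀ p ∈ Q, f p = lam (idx p + 1) (s.x (idx p))) : Nonempty (Realization P Q #Z f) := by
  have hU : s.Closed (Z ∪ Q.image fun p => Sum.inl (idx p)) := by
    intro e he
    have he' : Sum.inr e ∈ Z := by
      rcases mem_union.1 he with h | h
      · exact h
      · obtain ⟨p, -, h⟩ := mem_image.1 h
        cases h
    exact ⟨mem_union_left _ (closed e he').1, mem_union_left _ (closed e he').2⟩
  have hUn : (Z ∪ Q.image fun p => Sum.inl (idx p)) ⊆ s.nodes := by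
    refine union_subset hZ fun z hz => ?_
    obtain ⟨p, hp, rfl⟩ := mem_image.1 hz
    exact idx_V p hp
  exact ⟨{
    M := M
    inst := inferInstance
    s := s.restrict _ hU
    W := W
    pt := pt
    sl := sl
    ic := ic
    ε := ε
    idx := idx
    Z := Z
    lam := lam
    geo := geo.restrict
    inj := inj
    idx_W := idx_W
    idx_Z := idx_Z
    idx_pt := idx_pt
    nodes_eq := s.restrict_nodes (hU := hU) hUn
    card_Z := rfl
    closed := closed
    zero_mem := zero_mem
    cst := cst.restrict subset_union_left
    f_eq := fun p hp => by rw [f_eq p hp, cst.restrict_x (hU := hU) subset_union_left] }⟩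

theorem exists_split {α κ : Type} [Fintype α] [Fintype κ] [Inhabited κ] {P : α → ℝ × ℝ}
    {Q : Finset α} {m : ℕ} {f : α → κ} (hf : f ∈ labelings P Q m) {δ : ℝ} (hδ0 : 0 < δ)
    (hδ1 : δ ≤ 1) (hw : 10 ≤ δ * #Q + m) :
    ∃ R ⊆ Q, ∃ t : ℕ, #R ≤ t ∧ (t : ℝ) ≤ 180 * √(#Q + m) + 1 ∧
      ∃ g ∈ (labelings P (Q \ R) t : Finset (α → Bool)), ∃ m' : Bool → ℕ,
        (∀ a, (fun p => if p ∈ Q \ R ∧ g p = a then f p else default) ∈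
            labelings P ((Q \ R).filter (g · = a)) (m' a) ∧
          δ * #((Q \ R).filter (g · = a)) + m' a ≤ 9 / 10 * (δ * #Q + m) + t) ∧
        δ * #Q + m ≤ ∑ a, (δ * #((Q \ R).filter (g · = a)) + m' a) ∧
        ∑ a, (δ * #((Q \ R).filter (g · = a)) + m' a) ≤ δ * #Q + m + 2 * t := by
  obtain ⟨-, ⟨r⟩⟩ := mem_labelings.1 hf
  set s := r.s
  let J : Finset α → Finset (ℕ ⊕ r.M) := fun Q' => Q'.image fun p => Sum.inl (r.idx p)
  have hJinj : ∀ Q' ⊆ Q, #(J Q') = #Q' := fun Q' hQ' =>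
    card_image_of_injOn fun p hp q hq h => r.inj (hQ' hp) (hQ' hq) (Sum.inl_injective h)
  have hdisj : ∀ Q' ⊆ Q, Disjoint r.Z (J Q') := fun Q' hQ' => by
    refine disjoint_left.2 fun z hz hz' => ?_
    obtain ⟨p, hp, rfl⟩ := mem_image.1 hz'
    exact r.idx_Z p (hQ' hp) hz
  have hnodes : s.nodes = r.Z ∪ J Q := r.nodes_eq
  have hZn : r.Z ⊆ s.nodes := by rw [hnodes]; exact subset_union_left
  have hJn : ∀ p ∈ Q, Sum.inl (r.idx p) ∈ s.nodes := fun p hp => by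
    rw [hnodes]; exact mem_union_right _ (mem_image_of_mem _ hp)
  have h0 : 0 ∈ s.V := s.inl_mem_nodes.1 (hZn r.zero_mem)
  let ω : ℕ ⊕ r.M → ℝ := fun z => if z ∈ r.Z then 1 else δ
  have hωsum : ∀ A ⊆ r.Z, ∀ Q' ⊆ Q, ∑ z ∈ A ∪ J Q', ω z = δ * #Q' + #A := by
    intro A hA Q' hQ'
    rw [sum_union ((hdisj Q' hQ').mono_left hA),
      sum_congr rfl (g := fun _ => (1 : ℝ)) fun z hz => if_pos (hA hz),
      sum_congr rfl (s₁ := J Q') (g := fun _ => δ) fun z hz =>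
        if_neg fun h => disjoint_left.1 (hdisj Q' hQ') h hz]
    simp [hJinj Q' hQ']
    ring
  have hω0 : ∀ z, 0 ≤ ω z := fun z => by
    simp only [ω]; split_ifs <;> positivity
  have hωW : ∑ z ∈ s.nodes, ω z = δ * #Q + m := by
    rw [hnodes, hωsum _ subset_rfl _ subset_rfl, r.card_Z]
  obtain ⟨Y, hYn, hYc, mu, hmu, hbal⟩ := s.exists_separator h0 ω hω0 _ hωW fun z _ => by
    simp only [ω]; split_ifs <;> linarith
  obtain ⟨Y', hYY', hY'n, hY'c, hY'0, hY'card⟩ := Sweep.exists_closed hYn h0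
  have hN : (#s.nodes : ℝ) = #Q + m := by
    rw [hnodes, card_union_of_disjoint (hdisj Q subset_rfl), hJinj Q subset_rfl, r.card_Z]
    push_cast
    ring
  have hmu' := hmu.mono hYY'
  let R := Q.filter fun p => Sum.inl (r.idx p) ∈ Y'
  have hRQ : R ⊆ Q := filter_subset _ _
  have hRt : #R ≤ #Y' := by
    rw [← hJinj R hRQ]
    refine card_le_card fun z hz => ?_
    obtain ⟨p, hp, rfl⟩ := mem_image.1 hz
    exact (mem_filter.1 hp).2
  let g : α → Bool := fun p => if p ∈ Q \ R then mu (r.idx p + 1) (s.x (r.idx p)) else false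
  have hg : ∀ p ∈ Q \ R, g p = mu (r.idx p + 1) (s.x (r.idx p)) := fun p hp => if_pos hp
  have hQR : ∀ p ∈ Q \ R, p ∈ Q ∧ Sum.inl (r.idx p) ∉ Y' := fun p hp => by
    simp only [R, mem_sdiff, mem_filter, not_and] at hp
    exact ⟨hp.1, hp.2 hp.1⟩
  let Zc : Bool → Finset (ℕ ⊕ r.M) := fun a => r.Z.filter fun z => mu (s.rep z).1 (s.rep z).2 = a
  let Qc : Bool → Finset α := fun a => (Q \ R).filter (g · = a)
  have hQc : ∀ a, Qc a ⊆ Q := fun a => (filter_subset _ _).trans sdiff_subset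
  have hcard : ∀ a, #(Y' ∪ Zc a) = #Y' + #(Zc a \ Y') := fun a => by
    rw [← union_sdiff_self_eq_union, card_union_of_disjoint disjoint_sdiff]
  have hsumQ : ∑ a, #(Qc a) = #(Q \ R) :=
    (card_eq_sum_card_fiberwise (fun _ _ => by simp)).symm
  have hsumZ : ∑ a, #(Zc a \ Y') = #(r.Z \ Y') := by
    rw [card_eq_sum_card_fiberwise (s := r.Z \ Y') (t := univ)
      (f := fun z => mu (s.rep z).1 (s.rep z).2) (fun _ _ => by simp)]
    refine sum_congr rfl fun a _ => congrArg card ?_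
    ext z
    simp only [Zc, mem_sdiff, mem_filter]
    tauto
  have hQcard : #(Q \ R) + #R = #Q := card_sdiff_add_card_eq_card hRQ
  have hZcard : #(r.Z \ Y') + #(r.Z ∩ Y') = m := by rw [card_sdiff_add_card_inter, r.card_Z]
  have hZY : #(r.Z ∩ Y') ≤ #Y' := card_le_card inter_subset_right
  have hsum : ∑ a, (δ * #(Qc a) + (#(Y' ∪ Zc a) : ℝ)) = δ * #(Q \ R) + 2 * #Y' + #(r.Z \ Y') := by
    rw [← hsumQ, ← hsumZ]
    simp only [Fintype.sum_bool, hcard]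
    push_cast
    ring
  refine ⟨R, hRQ, #Y', hRt, ?_, g, ?_, fun a => #(Y' ∪ Zc a), fun a => ⟨?_, ?_⟩, ?_, ?_⟩
  · rw [← hN]
    have : (#Y' : ℝ) ≤ 3 * #Y + 1 := by exact_mod_cast hY'card
    linarith
  · refine mem_labelings.2 ⟨fun p hp => if_neg hp, ?_⟩
    exact r.geo.nonempty_realization (r.inj.mono (by simp)) (fun p hp => r.idx_W p (hQR p hp).1)
      (fun p hp => hJn p (hQR p hp).1) (fun p hp => (hQR p hp).2)
      (fun p hp => r.idx_pt p (hQR p hp).1) hY'n hY'c hY'0 hmu' hg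
  · refine mem_labelings.2 ⟨fun p hp => if_neg fun h => hp (mem_filter.2 h), ?_⟩
    refine r.geo.nonempty_realization (ε := r.ε) (idx := r.idx)
      (r.inj.mono (by exact_mod_cast hQc a))
      (fun p hp => r.idx_W p (hQc a hp))
      (fun p hp => hJn p (hQc a hp)) (fun p hp => ?_)
      (fun p hp => r.idx_pt p (hQc a hp)) (union_subset hY'n ((filter_subset _ _).trans hZn))
      (by convert Sweep.closed_cut hmu' hY'c r.closed hZn a) (mem_union_left _ hY'0)
      (by convert hmu'.cut r.cst a) (fun p hp => ?_)
    · have hp' := mem_filter.1 hp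
      exact notMem_union.2 ⟨(hQR p hp'.1).2,
        fun h => r.idx_Z p (hQR p hp'.1).1 (mem_filter.1 h).1⟩
    · have hp' := mem_filter.1 hp
      rw [if_pos hp', if_pos (by rw [← hg p hp'.1]; exact hp'.2), r.f_eq p (hQc a hp)]
  · have h1 : ∑ z ∈ (Zc a \ Y') ∪ J (Qc a), ω z ≤ 9 / 10 * (δ * #Q + m) := by
      refine (sum_le_sum_of_subset_of_nonneg ?_ fun z _ _ => hω0 z).trans (hbal a)
      intro z hz
      simp only [mem_filter, mem_sdiff]
      rcases mem_union.1 hz with hz | hz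
      · obtain ⟨hz1, hz2⟩ := mem_sdiff.1 hz
        obtain ⟨hz1, hz3⟩ := mem_filter.1 hz1
        exact ⟨⟨hZn hz1, fun h => hz2 (hYY' h)⟩, hz3⟩
      · obtain ⟨p, hp, rfl⟩ := mem_image.1 hz
        have hp' := mem_filter.1 hp
        refine ⟨⟨hJn p (hQc a hp), fun h => (hQR p hp'.1).2 (hYY' h)⟩, ?_⟩
        exact (hg p hp'.1).symm.trans hp'.2
    rw [hωsum _ (sdiff_subset.trans (filter_subset _ _)) _ (hQc a)] at h1
    dsimp only
    rw [hcard]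
    push_cast
    change δ * #(Qc a) + _ ≤ _
    linarith
  · refine le_of_le_of_eq ?_ hsum.symm
    have h1 : (#(Q \ R) : ℝ) + #R = #Q := by exact_mod_cast hQcard
    have h2 : (#(r.Z \ Y') : ℝ) + #(r.Z ∩ Y') = m := by exact_mod_cast hZcard
    have h3 : (#(r.Z ∩ Y') : ℝ) ≤ #Y' := by exact_mod_cast hZY
    have h4 : (#R : ℝ) ≤ #Y' := by exact_mod_cast hRt
    have h5 : δ * #R ≤ 1 * #R := by gcongr
    rw [← h1, ← h2]
    linarith
  · refine le_of_eq_of_le hsum ?_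
    have h1 : (#(Q \ R) : ℝ) + #R = #Q := by exact_mod_cast hQcard
    have h2 : (#(r.Z \ Y') : ℝ) + #(r.Z ∩ Y') = m := by exact_mod_cast hZcard
    have h5 : 0 ≤ δ * #R := by positivity
    have h6 : (0 : ℝ) ≤ #(r.Z ∩ Y') := by positivity
    rw [← h1, ← h2]
    linarith

theorem card_biUnion_le_real {ι β : Type} [DecidableEq β] (s : Finset ι) (t : ι → Finset β)
    {a b : ℝ}
    (hs : #s ≤ a) (hb : 0 ≤ b) (h : ∀ i ∈ s, (#(t i) : ℝ) ≤ b) : (#(s.biUnion t) : ℝ) ≤ a * b :=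
  calc (#(s.biUnion t) : ℝ) ≤ ∑ i ∈ s, (#(t i) : ℝ) := by exact_mod_cast card_biUnion_le
    _ ≤ #s * b := by rw [← nsmul_eq_mul]; exact sum_le_card_nsmul _ _ _ h
    _ ≤ a * b := by gcongr

theorem card_small_subsets_le {α : Type} (Q : Finset α) (T : ℕ) :
    #(Q.powerset.filter (#· ≤ T)) ≤ (T + 1) * (#Q + 1) ^ T := by
  have hsub : Q.powerset.filter (#· ≤ T) ⊆ (range (T + 1)).biUnion fun j => Q.powersetCard j := by
    intro R hR
    obtain ⟨h1, h2⟩ := mem_filter.1 hR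
    exact mem_biUnion.2 ⟨#R, mem_range.2 (by omega), mem_powersetCard.2 ⟨mem_powerset.1 h1, rfl⟩⟩
  refine (card_le_card hsub).trans ((card_biUnion_le_card_mul _ _ ((#Q + 1) ^ T)
    fun j hj => ?_).trans
    (by simp))
  rw [card_powersetCard]
  calc (#Q).choose j ≤ #Q ^ j := Nat.choose_le_pow _ _
    _ ≤ (#Q + 1) ^ j := by gcongr; omega
    _ ≤ (#Q + 1) ^ T := Nat.pow_le_pow_right (by omega) (by simpa [Nat.lt_succ_iff] using hj)

theorem card_labelings_step {α κ : Type} [Fintype α] [Fintype κ] [Inhabited κ] {P : α → ℝ × ℝ}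
    {Q : Finset α} {m : ℕ} {δ : ℝ} (hδ0 : 0 < δ) (hδ1 : δ ≤ 1) (hw : 10 ≤ δ * #Q + m) {T K : ℕ}
    (hT : 180 * √(#Q + m) + 1 ≤ T) (hK : δ * #Q + m + 2 * T < K) {B : ℝ} (hB0 : 0 ≤ B)
    (hB : ∀ (Q' : Bool → Finset α) (m' : Bool → ℕ),
      (∀ a, δ * #(Q' a) + m' a ≤ 9 / 10 * (δ * #Q + m) + T) →
      δ * #Q + m ≤ ∑ a, (δ * #(Q' a) + m' a) → ∑ a, (δ * #(Q' a) + m' a) ≤ δ * #Q + m + 2 * T →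
      ∏ a, (#(labelings P (Q' a) (m' a) : Finset (α → κ)) : ℝ) ≤ B) :
    (#(labelings P Q m : Finset (α → κ)) : ℝ) ≤
      ((T + 1) * (#Q + 1) ^ T) * ((T + 1) * ((((#Q + 1) ^ 12 * 2) ^ T) * ((K * K) *
        (Fintype.card κ ^ T * B)))) := by
  let Qc : Finset α → (α → Bool) → Bool → Finset α := fun R g a => (Q \ R).filter (g · = a)
  let ok : Finset α → (α → Bool) → ℕ × ℕ → Prop := fun R g mm =>
      (∀ a, δ * #(Qc R g a) + (bif a then mm.2 else mm.1) ≤ 9 / 10 * (δ * #Q + m) + T) ∧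
      δ * #Q + m ≤ ∑ a, (δ * #(Qc R g a) + (bif a then mm.2 else mm.1)) ∧
      ∑ a, (δ * #(Qc R g a) + (bif a then mm.2 else mm.1)) ≤ δ * #Q + m + 2 * T
  let out : Finset α → (α → Bool) → ℕ × ℕ → Finset (α → κ) := fun R g mm =>
    ((Fintype.piFinset fun p => if p ∈ R then univ else {default}) ×ˢ
      ((labelings P (Qc R g false) mm.1 : Finset (α → κ)) ×ˢ
        (labelings P (Qc R g true) mm.2 : Finset (α → κ)))).image fun F p =>
          if p ∈ R then F.1 p else if g p = true then F.2.2 p else F.2.1 p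
  let all : Finset (α → κ) := (Q.powerset.filter (#· ≤ T)).biUnion fun R =>
    (range (T + 1)).biUnion fun t => (labelings P (Q \ R) t : Finset (α → Bool)).biUnion fun g =>
      ((range K ×ˢ range K).filter (ok R g)).biUnion (out R g)
  have hsub : (labelings P Q m : Finset (α → κ)) ⊆ all := by
    intro f hf
    obtain ⟨R, hRQ, t, hRt, ht, g, hg, m', h1, h2, h3⟩ := exists_split hf hδ0 hδ1 hw
    have htT : (t : ℝ) ≤ T := ht.trans hT
    have htT' : t ≤ T := by exact_mod_cast htT
    have hm'K : ∀ a, m' a < K := fun a => by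
      have h4 : δ * #(Qc R g a) + m' a ≤ ∑ a, (δ * #(Qc R g a) + (m' a : ℝ)) :=
        single_le_sum (f := fun a => δ * #(Qc R g a) + (m' a : ℝ)) (fun a _ => by positivity)
          (mem_univ a)
      have h5 : 0 ≤ δ * #(Qc R g a) := by positivity
      have h6 : (m' a : ℝ) < K := by linarith
      exact_mod_cast h6
    have hbif : ∀ a, (bif a then m' true else m' false) = m' a := by rintro (_ | _) <;> rfl
    refine mem_biUnion.2 ⟨R, mem_filter.2 ⟨mem_powerset.2 hRQ, hRt.trans htT'⟩,
      mem_biUnion.2 ⟨t, mem_range.2 (by omega), mem_biUnion.2 ⟨g, hg, mem_biUnion.2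
        ⟨(m' false, m' true), mem_filter.2 ⟨by simp [hm'K], ?_⟩, mem_image.2
          ⟨(fun p => if p ∈ R then f p else default,
            fun p => if p ∈ Q \ R ∧ g p = false then f p else default,
            fun p => if p ∈ Q \ R ∧ g p = true then f p else default),
            mem_product.2 ⟨?_, mem_product.2 ⟨(h1 false).1, (h1 true).1⟩⟩, ?_⟩⟩⟩⟩⟩
    · simp only [ok, hbif]
      exact ⟨fun a => (h1 a).2.trans (by linarith), h2, h3.trans (by linarith)⟩
    · refine Fintype.mem_piFinset.2 fun p => ?_
      by_cases h : p ∈ R <;> simp [h]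
    · have hfoff := (mem_labelings.1 hf).1
      funext p
      by_cases hR : p ∈ R
      · simp [hR]
      · by_cases hQ : p ∈ Q
        · cases hgp : g p <;> simp [hR, hQ, hgp]
        · simp [hR, hQ, hfoff p hQ]
  have hpow : ∀ t ∈ range (T + 1), ∀ R, (#(labelings P (Q \ R) t : Finset (α → Bool)) : ℝ) ≤
      ((#Q + 1) ^ 12 * 2) ^ T := fun t ht R => by
    have h1 := card_labelings_le_pow (κ := Bool) P (Q \ R) t
    have h2 : #(Q \ R) ≤ #Q := card_le_card sdiff_subset
    have h3 : ((#(Q \ R) + 1) ^ 12 * 2) ^ t ≤ ((#Q + 1) ^ 12 * 2) ^ T := by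
      calc ((#(Q \ R) + 1) ^ 12 * 2) ^ t ≤ ((#Q + 1) ^ 12 * 2) ^ t := by gcongr
        _ ≤ _ := Nat.pow_le_pow_right (by positivity) (by simpa [Nat.lt_succ_iff] using ht)
    exact_mod_cast h1.trans h3
  have hk : (1 : ℝ) ≤ Fintype.card κ := by exact_mod_cast Fintype.card_pos
  refine le_trans (by exact_mod_cast card_le_card hsub) (card_biUnion_le_real _ _
    (by exact_mod_cast card_small_subsets_le Q T) (by positivity) fun R hR =>
      card_biUnion_le_real _ _
    (by simp) (by positivity) fun t ht => card_biUnion_le_real _ _ (hpow t ht R) (by positivity)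
    fun g hg => card_biUnion_le_real _ _ ?_ (by positivity) fun mm hmm => ?_)
  · refine (Nat.cast_le.2 (card_filter_le _ _)).trans ?_
    simp
  · obtain ⟨h1, h2, h3⟩ := (mem_filter.1 hmm).2
    refine (Nat.cast_le.2 card_image_le).trans ?_
    rw [card_product, card_product, Nat.cast_mul]
    gcongr
    · rw [Fintype.card_piFinset]
      have h4 : ∏ p, #(if p ∈ R then (univ : Finset κ) else {default}) = Fintype.card κ ^ #R := by
        rw [← prod_subset (subset_univ R) (fun p _ hp => by simp [hp]),
          prod_congr rfl fun p hp => by rw [if_pos hp], prod_const, card_univ]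
      rw [h4]
      push_cast
      exact pow_le_pow_right₀ hk (mem_filter.1 hR).2
    · have h5 := hB (Qc R g) (fun a => bif a then mm.2 else mm.1)
        (fun a => by have := h1 a; cases a <;> exact this)
        (by simpa using h2) (by simpa using h3)
      simp only [Fintype.prod_bool, cond_true, cond_false] at h5
      push_cast
      rw [mul_comm]
      exact h5

theorem mul_le_rpow_three_quarters {u : ℝ} (h0 : 0 ≤ u) (h1 : u ≤ 91 / 100) :
    51 / 50 * u ≤ u ^ (3 / 4 : ℝ) := by
  have h2 : (51 / 50 * u) ^ (4 : ℝ) ≤ u ^ (3 : ℝ) := by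
    rw [show (4 : ℝ) = (4 : ℕ) by norm_num, show (3 : ℝ) = (3 : ℕ) by norm_num, Real.rpow_natCast,
      Real.rpow_natCast]
    have : 0 ≤ u ^ 3 := by positivity
    nlinarith
  have h3 := Real.rpow_le_rpow (by positivity) h2 (show (0 : ℝ) ≤ 1 / 4 by norm_num)
  rw [← Real.rpow_mul (by positivity), ← Real.rpow_mul h0] at h3
  norm_num at h3
  exact h3

theorem rpow_gain {w : ℝ} (hw : 0 < w) {v : Bool → ℝ} (h0 : ∀ a, 0 ≤ v a)
    (h1 : ∀ a, v a ≤ 91 / 100 * w) (h2 : w ≤ ∑ a, v a) :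
    51 / 50 * w ^ (3 / 4 : ℝ) ≤ ∑ a, v a ^ (3 / 4 : ℝ) := by
  have h3 : ∀ a, 51 / 50 * (v a / w) * w ^ (3 / 4 : ℝ) ≤ v a ^ (3 / 4 : ℝ) := fun a => by
    have h4 := mul_le_rpow_three_quarters (u := v a / w) (div_nonneg (h0 a) hw.le)
      (by rw [div_le_iff₀ hw]; exact h1 a)
    calc _ ≤ (v a / w) ^ (3 / 4 : ℝ) * w ^ (3 / 4 : ℝ) := by gcongr
      _ = _ := by
        rw [← Real.mul_rpow (div_nonneg (h0 a) hw.le) hw.le, div_mul_cancel₀ _ hw.ne']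
  refine le_trans ?_ (sum_le_sum fun a _ => h3 a)
  rw [← sum_mul, ← mul_sum, ← sum_div]
  have h5 : 1 ≤ (∑ a, v a) / w := by rwa [le_div_iff₀ hw, one_mul]
  have h6 : 0 ≤ w ^ (3 / 4 : ℝ) := by positivity
  gcongr
  linarith

theorem exists_large (k : ℕ) : ∃ W : ℝ, ∀ w ≥ W, 1000 ≤ w ∧ 2 * k ≤ w ∧
    12000 * w ^ (9 / 16 : ℝ) * Real.log w ≤ w ^ (3 / 4 : ℝ) / 100 := by
  have h := (isLittleO_log_rpow_atTop (show (0 : ℝ) < 3 / 16 by norm_num)).bound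
    (show (0 : ℝ) < 1 / 1200000 by norm_num)
  have h' := ((Filter.eventually_ge_atTop (1000 : ℝ)).and
    (Filter.eventually_ge_atTop (2 * k : ℝ))).and h
  obtain ⟨W, hW⟩ := Filter.eventually_atTop.1 h'
  refine ⟨W, fun w hw => ?_⟩
  obtain ⟨⟨h1, h2⟩, h3⟩ := hW w hw
  refine ⟨h1, h2, ?_⟩
  have hw0 : 0 < w := by linarith
  have h4 : Real.log w ≤ 1 / 1200000 * w ^ (3 / 16 : ℝ) := by
    refine (le_abs_self _).trans (h3.trans_eq ?_)
    rw [Real.norm_of_nonneg (by positivity)]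
  have h5 : w ^ (3 / 4 : ℝ) = w ^ (9 / 16 : ℝ) * w ^ (3 / 16 : ℝ) := by
    rw [← Real.rpow_add hw0]; norm_num
  have h6 : 0 ≤ w ^ (9 / 16 : ℝ) := by positivity
  rw [h5]
  nlinarith [mul_le_mul_of_nonneg_left h4 h6]

theorem card_labelings_base {α κ : Type} [Fintype α] [Fintype κ] [Inhabited κ] {P : α → ℝ × ℝ}
    {Q : Finset α} {m D : ℕ} (hD : 1 ≤ D) (hw : 1 / (D : ℝ) * #Q + m ≤ D ^ 8) :
    (#(labelings P Q m : Finset (α → κ)) : ℝ) ≤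
      (((D : ℝ) ^ 9 + 1) ^ 12 * Fintype.card κ) ^ (1 / (D : ℝ) * #Q + m) := by
  have hk : (1 : ℝ) ≤ Fintype.card κ := by exact_mod_cast Fintype.card_pos
  have hD' : (0 : ℝ) < D := by exact_mod_cast hD
  have hq0 : 0 ≤ 1 / (D : ℝ) * #Q := by positivity
  have hq : (#Q : ℝ) ≤ D ^ 9 := by
    have h1 : 1 / (D : ℝ) * #Q ≤ D ^ 8 := by
      have : (0 : ℝ) ≤ m := by positivity
      linarith
    rw [one_div, inv_mul_le_iff₀ hD'] at h1
    exact h1.trans_eq (by ring)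
  have h1 : (1 : ℝ) ≤ ((D : ℝ) ^ 9 + 1) ^ 12 := one_le_pow₀ (by linarith [pow_pos hD' 9])
  calc (#(labelings P Q m : Finset (α → κ)) : ℝ) ≤ (((#Q : ℝ) + 1) ^ 12 * Fintype.card κ) ^ m := by
        exact_mod_cast card_labelings_le_pow P Q m
    _ ≤ (((D : ℝ) ^ 9 + 1) ^ 12 * Fintype.card κ) ^ m := by gcongr
    _ = (((D : ℝ) ^ 9 + 1) ^ 12 * Fintype.card κ) ^ (m : ℝ) := (Real.rpow_natCast _ _).symm
    _ ≤ _ := Real.rpow_le_rpow_of_exponent_le (one_le_mul_of_one_le_of_one_le h1 hk) (by linarith)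

/-- The factor lost in one step of the recursion is absorbed by the gain. -/
theorem step_factor_le {w q k T K : ℝ} {t : ℕ} (hT : (t : ℝ) = T) (hw : 1000 ≤ w) (hk0 : 0 ≤ k)
    (hk : 2 * k ≤ w) (hlog : 12000 * w ^ (9 / 16 : ℝ) * Real.log w ≤ w ^ (3 / 4 : ℝ) / 100)
    (hT1 : 1 ≤ T) (hTw : T ≤ 257 * w ^ (9 / 16 : ℝ)) (hT' : T ≤ w / 200) (hq0 : 0 ≤ q)
    (hq : q + 1 ≤ w ^ 3) (hK0 : 0 ≤ K) (hK : K ≤ 2 * w) {X : ℝ} (hX : Real.exp 1 ≤ X) (B : ℝ)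
    (hB : 0 ≤ B) :
    ((T + 1) * (q + 1) ^ t) * ((T + 1) * ((((q + 1) ^ 12 * 2) ^ t) * ((K * K) * (k ^ t * B)))) ≤
      X ^ (w ^ (3 / 4 : ℝ) / 100) * B := by
  have hw0 : 0 < w := by linarith
  have hfac : ((T + 1) * (q + 1) ^ t) * ((T + 1) * ((((q + 1) ^ 12 * 2) ^ t) * ((K * K) * k ^ t))) ≤
      w ^ (45 * t) := by
    have h1 : T + 1 ≤ w := by linarith
    have h2 : K * K ≤ w ^ 3 := by nlinarith [mul_le_mul hK hK hK0 (by linarith)]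
    have ht1 : 1 ≤ t := by
      have : (1 : ℝ) ≤ t := hT ▸ hT1
      exact_mod_cast this
    calc ((T + 1) * (q + 1) ^ t) * ((T + 1) * ((((q + 1) ^ 12 * 2) ^ t) * ((K * K) * k ^ t)))
        ≤ (w * (w ^ 3) ^ t) * (w * ((((w ^ 3) ^ 12 * 2) ^ t) * (w ^ 3 * k ^ t))) := by
          gcongr
      _ = w ^ 5 * (w ^ 39) ^ t * (2 * k) ^ t := by
          rw [mul_pow, mul_pow 2 k, ← pow_mul w 3 12, show w ^ 39 = w ^ 3 * w ^ 36 by ring, mul_pow]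
          ring
      _ ≤ w ^ 5 * (w ^ 39) ^ t * w ^ t := by gcongr
      _ = w ^ (5 + 40 * t) := by rw [← pow_mul, ← pow_add, ← pow_add]; congr 1; ring
      _ ≤ w ^ (45 * t) := pow_le_pow_right₀ (by linarith) (by omega)
  have hlw : 0 ≤ Real.log w := Real.log_nonneg (by linarith)
  have hexp : w ^ (45 * t) ≤ X ^ (w ^ (3 / 4 : ℝ) / 100) := by
    calc w ^ (45 * t) = Real.exp (Real.log w * (45 * t)) := by
          rw [← Real.rpow_natCast, Real.rpow_def_of_pos hw0]; push_cast; rfl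
      _ ≤ Real.exp (1 * (w ^ (3 / 4 : ℝ) / 100)) := by
          rw [Real.exp_le_exp, hT]
          have h3 : 0 ≤ w ^ (9 / 16 : ℝ) := by positivity
          nlinarith [mul_le_mul_of_nonneg_left hTw hlw, mul_nonneg h3 hlw]
      _ = Real.exp 1 ^ (w ^ (3 / 4 : ℝ) / 100) := Real.exp_mul _ _
      _ ≤ _ := Real.rpow_le_rpow (Real.exp_pos 1).le hX (by positivity)
  calc _ = ((T + 1) * (q + 1) ^ t) *
          ((T + 1) * ((((q + 1) ^ 12 * 2) ^ t) * ((K * K) * k ^ t))) * B := by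
        ring
    _ ≤ _ := by gcongr; exact hfac.trans hexp

set_option maxHeartbeats 400000 in
theorem card_labelings_rec (κ : Type) [Fintype κ] [Inhabited κ] : ∃ D₀ : ℕ, ∀ D ≥ D₀, ∀ X : ℝ,
    X = (((D : ℝ) ^ 9 + 1) ^ 12 * Fintype.card κ) ^ (2 : ℝ) →
    ∀ {α : Type} [Fintype α] (P : α → ℝ × ℝ) (N : ℕ) (Q : Finset α) (m : ℕ) (w : ℝ),
      w = 1 / (D : ℝ) * #Q + m → w ≤ N → 16 ≤ w →
      (#(labelings P Q m : Finset (α → κ)) : ℝ) ≤ X ^ (w - w ^ (3 / 4 : ℝ)) := by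
  obtain ⟨W, hW⟩ := exists_large (Fintype.card κ)
  refine ⟨⌈W⌉₊ + 2, fun D hD X hX α _ P N => ?_⟩
  have hk : (1 : ℝ) ≤ Fintype.card κ := by exact_mod_cast Fintype.card_pos
  have hD2 : 2 ≤ D := by omega
  have hD2' : (2 : ℝ) ≤ D := by exact_mod_cast hD2
  have hDW : W ≤ D := (Nat.le_ceil W).trans (by exact_mod_cast by omega)
  have hY3 : 3 ≤ ((D : ℝ) ^ 9 + 1) ^ 12 * Fintype.card κ := by
    have h1 : (2 : ℝ) ^ 9 ≤ (D : ℝ) ^ 9 := by gcongr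
    have h2 : ((2 : ℝ) ^ 9 + 1) ^ 12 ≤ ((D : ℝ) ^ 9 + 1) ^ 12 := by gcongr
    have h3 : (3 : ℝ) ≤ ((D : ℝ) ^ 9 + 1) ^ 12 := le_trans (by norm_num) h2
    nlinarith
  have hX3 : 3 ≤ X := by
    rw [hX, show (2 : ℝ) = (2 : ℕ) by norm_num, Real.rpow_natCast]
    nlinarith
  have hXe : Real.exp 1 ≤ X := by linarith [Real.exp_one_lt_d9]
  have hX1 : 1 ≤ X := by linarith
  have hX0 : 0 < X := by linarith
  induction N with
  | zero =>
    intro Q m w _ h1 h2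
    norm_num at h1
    linarith
  | succ N ih =>
    intro Q m w hwdef hwN hw16
    have hw0 : 0 < w := by linarith
    have hq0 : (0 : ℝ) ≤ #Q := by positivity
    by_cases hsmall : w ≤ (D : ℝ) ^ 8
    · refine (card_labelings_base (by omega) (hwdef ▸ hsmall)).trans ?_
      rw [← hwdef, hX, ← Real.rpow_mul (by linarith)]
      refine Real.rpow_le_rpow_of_exponent_le (by linarith) ?_
      have h1 : w ^ (3 / 4 : ℝ) ≤ w / 2 := by
        have h2 : w = w ^ (3 / 4 : ℝ) * w ^ (1 / 4 : ℝ) := by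
          rw [← Real.rpow_add hw0]; norm_num
        have h3 : (2 : ℝ) ≤ w ^ (1 / 4 : ℝ) := by
          calc (2 : ℝ) = ((2 : ℝ) ^ (4 : ℝ)) ^ (1 / 4 : ℝ) := by
                rw [← Real.rpow_mul (by norm_num)]; norm_num
            _ ≤ _ := Real.rpow_le_rpow (by positivity) (by norm_num; exact hw16) (by norm_num)
        have h4 : 0 ≤ w ^ (3 / 4 : ℝ) := by positivity
        nlinarith
      linarith
    · push Not at hsmall
      have hDw : (D : ℝ) ≤ w := (le_self_pow₀ (by linarith) (by norm_num)).trans hsmall.le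
      obtain ⟨hw1000, hwk, hlog⟩ := hW w (hDW.trans hDw)
      have hDpos : (0 : ℝ) < D := by linarith
      have hqD : (#Q : ℝ) ≤ D * w := by
        have : 1 / (D : ℝ) * #Q ≤ w := by
          have : (0 : ℝ) ≤ m := by positivity
          linarith
        rwa [one_div, inv_mul_le_iff₀ hDpos] at this
      have hmw : (m : ℝ) ≤ w := by
        have : 0 ≤ 1 / (D : ℝ) * #Q := by positivity
        linarith
      have hD8 : (D : ℝ) ≤ w ^ (1 / 8 : ℝ) := by
        calc (D : ℝ) = ((D : ℝ) ^ 8) ^ (1 / 8 : ℝ) := by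
              rw [← Real.rpow_natCast, ← Real.rpow_mul hDpos.le]; norm_num
          _ ≤ _ := Real.rpow_le_rpow (by positivity) hsmall.le (by norm_num)
      set u := w ^ (9 / 16 : ℝ) with hu
      have hu1 : 1 ≤ u := Real.one_le_rpow (by linarith) (by norm_num)
      have hsqrt : √(#Q + m) ≤ 283 / 200 * u := by
        refine Real.sqrt_le_iff.2 ⟨by positivity, ?_⟩
        have h1 : u ^ 2 = w * w ^ (1 / 8 : ℝ) := by
          rw [hu, ← Real.rpow_natCast, ← Real.rpow_mul hw0.le, ← Real.rpow_one_add' hw0.le]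
          · norm_num
          · norm_num
        have h2 : D * w ≤ u ^ 2 := by rw [h1, mul_comm]; gcongr
        have h3 : w ≤ D * w := le_mul_of_one_le_left hw0.le (by linarith)
        have h4 : (#Q : ℝ) + m ≤ 2 * u ^ 2 := by linarith
        rw [mul_pow]
        linarith [sq_nonneg u]
      set T := ⌈180 * √(#Q + m) + 1⌉₊ with hTdef
      have hT1 : 180 * √(#Q + m) + 1 ≤ T := Nat.le_ceil _
      have hT2 : (T : ℝ) < 180 * √(#Q + m) + 1 + 1 := Nat.ceil_lt_add_one (by positivity)
      have hTu : (T : ℝ) ≤ 257 * u := by linarith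
      have hTone : (1 : ℝ) ≤ T := by linarith [Real.sqrt_nonneg (#Q + m : ℝ)]
      have hlog1 : 1 ≤ Real.log w := by
        rw [Real.le_log_iff_exp_le hw0]; linarith [Real.exp_one_lt_d9]
      have hu34 : 12000 * u ≤ w ^ (3 / 4 : ℝ) / 100 := by nlinarith
      have h34 : w ^ (3 / 4 : ℝ) ≤ w := by
        calc w ^ (3 / 4 : ℝ) ≤ w ^ (1 : ℝ) :=
              Real.rpow_le_rpow_of_exponent_le (by linarith) (by norm_num)
          _ = w := Real.rpow_one w
      set K := ⌊w + 2 * T⌋₊ + 1 with hKdef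
      have hK1 : w + 2 * T < K := by
        rw [hKdef]; push_cast; exact Nat.lt_floor_add_one _
      have hK2 : (K : ℝ) ≤ w + 2 * T + 1 := by
        rw [hKdef]; push_cast
        linarith [Nat.floor_le (show 0 ≤ w + 2 * T by positivity)]
      have hδ1 : 1 / (D : ℝ) ≤ 1 := by rw [div_le_one hDpos]; linarith
      have hstep := card_labelings_step (κ := κ) (P := P) (Q := Q) (m := m) (δ := 1 / (D : ℝ))
        (by positivity) hδ1 (by linarith) (T := T) (K := K) hT1 (by rw [← hwdef]; exact hK1)
        (B := X ^ (w - 101 / 100 * w ^ (3 / 4 : ℝ))) (by positivity) (by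
          intro Q' m' h1 h2 h3
          rw [← hwdef] at h1 h2 h3
          have hv0 : ∀ a, 0 ≤ 1 / (D : ℝ) * #(Q' a) + m' a := fun a => by positivity
          have hv1 : ∀ a, 1 / (D : ℝ) * #(Q' a) + m' a ≤ 91 / 100 * w := fun a => by
            have := h1 a
            linarith
          have hv16 : ∀ a, 16 ≤ 1 / (D : ℝ) * #(Q' a) + m' a := fun a => by
            have h4 := hv1 (!a)
            rw [Fintype.sum_bool] at h2
            cases a
            · simp only [Bool.not_false] at h4; linarith
            · simp only [Bool.not_true] at h4; linarith
          have hgain := rpow_gain hw0 hv0 hv1 h2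
          have hN : w - 1 ≤ N := by push_cast at hwN; linarith
          calc ∏ a, (#(labelings P (Q' a) (m' a) : Finset (α → κ)) : ℝ)
              ≤ ∏ a, X ^ (1 / (D : ℝ) * #(Q' a) + m' a -
                (1 / (D : ℝ) * #(Q' a) + m' a) ^ (3 / 4 : ℝ)) :=
                prod_le_prod (fun a _ => by positivity) fun a _ => ih (Q' a) (m' a) _ rfl
                  (by linarith [hv1 a]) (hv16 a)
            _ = X ^ (∑ a, (1 / (D : ℝ) * #(Q' a) + m' a) -
                ∑ a, (1 / (D : ℝ) * #(Q' a) + m' a) ^ (3 / 4 : ℝ)) := by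
                rw [← sum_sub_distrib, Real.rpow_sum_of_pos hX0]
            _ ≤ _ := by
                refine Real.rpow_le_rpow_of_exponent_le hX1 ?_
                linarith)
      refine hstep.trans ((step_factor_le rfl hw1000 (by positivity) hwk hlog hTone hTu
        (by linarith)
        hq0 ?_ (by positivity) (by linarith) hXe _ (by positivity)).trans_eq ?_)
      · nlinarith [mul_le_mul hDw le_rfl hw0.le hw0.le]
      · rw [← Real.rpow_add hX0]
        congr 1
        ring

theorem card_labelings_le (κ : Type) [Fintype κ] [Inhabited κ] {η : ℝ} (hη : 0 < η) :
    ∃ δ : ℝ, 0 < δ ∧ ∀ {α : Type} [Fintype α] (P : α → ℝ × ℝ) (Q : Finset α) (m n : ℕ),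
      #Q ≤ n → (m : ℝ) ≤ δ * n →
      (#(labelings P Q m : Finset (α → κ)) : ℝ) ≤ (2 : ℝ) ^ (η * n) := by
  obtain ⟨D₀, hD₀⟩ := card_labelings_rec κ
  have hk : (1 : ℝ) ≤ Fintype.card κ := by exact_mod_cast Fintype.card_pos
  set k : ℝ := (Fintype.card κ : ℝ)
  have hlim : Filter.Tendsto (fun D : ℕ => (252 * Real.log D + (24 * Real.log 2 + 2 * Real.log k)) *
      (2 / (D : ℝ))) Filter.atTop (nhds 0) := by
    have h1 : Filter.Tendsto (fun D : ℕ => Real.log D / (D : ℝ)) Filter.atTop (nhds 0) :=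
      (Real.isLittleO_log_id_atTop.tendsto_div_nhds_zero).comp tendsto_natCast_atTop_atTop
    have h2 : Filter.Tendsto (fun D : ℕ => ((D : ℝ))⁻¹) Filter.atTop (nhds 0) :=
      tendsto_inv_atTop_nhds_zero_nat
    have h3 := (h1.const_mul 504).add (h2.const_mul (2 * (24 * Real.log 2 + 2 * Real.log k)))
    simp only [mul_zero, add_zero] at h3
    refine h3.congr fun D => ?_
    ring
  have hpos : 0 < η * Real.log 2 := mul_pos hη (Real.log_pos (by norm_num))
  obtain ⟨D, ⟨hD, hDD₀⟩, hD2⟩ := (((hlim.eventually_lt_const hpos).and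
    (Filter.eventually_ge_atTop D₀)).and (Filter.eventually_ge_atTop 2)).exists
  have hD2' : (2 : ℝ) ≤ D := by exact_mod_cast hD2
  have hD0 : (0 : ℝ) < D := by linarith
  set Y := ((D : ℝ) ^ 9 + 1) ^ 12 * k with hY
  have hY1 : 1 ≤ Y :=
    one_le_mul_of_one_le_of_one_le (one_le_pow₀ (by linarith [pow_pos hD0 9])) hk
  have hYpos : 0 < Y := by linarith
  have hlogY : Real.log (Y ^ (2 : ℝ)) * (2 / (D : ℝ)) ≤ η * Real.log 2 := by
    refine le_trans ?_ hD.le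
    have h1 : Y ≤ (2 * (D : ℝ) ^ 9) ^ 12 * k := by
      rw [hY]
      have : (1 : ℝ) ≤ (D : ℝ) ^ 9 := one_le_pow₀ (by linarith)
      gcongr
      linarith
    have h2 : Real.log Y ≤ 12 * (Real.log 2 + 9 * Real.log D) + Real.log k := by
      refine (Real.log_le_log hYpos h1).trans_eq ?_
      rw [Real.log_mul (by positivity) (by positivity), Real.log_pow,
        Real.log_mul (by norm_num) (by positivity), Real.log_pow]
      norm_num
    have h3 : 0 ≤ Real.log D := Real.log_nonneg (by linarith)
    rw [Real.log_rpow hYpos]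
    gcongr
    linarith
  have hbound : ∀ {α : Type} [Fintype α] (P : α → ℝ × ℝ) (Q : Finset α) (m : ℕ),
      (#(labelings P Q m : Finset (α → κ)) : ℝ) ≤
        (Y ^ (2 : ℝ)) ^ (1 / (D : ℝ) * #Q + m) := by
    intro α _ P Q m
    have hw0 : 0 ≤ 1 / (D : ℝ) * #Q + m := by positivity
    have hX1 : 1 ≤ Y ^ (2 : ℝ) := Real.one_le_rpow hY1 (by norm_num)
    by_cases hw : 16 ≤ 1 / (D : ℝ) * #Q + m
    · refine (hD₀ D hDD₀ _ rfl P ⌈1 / (D : ℝ) * #Q + m⌉₊ Q m _ rfl (Nat.le_ceil _) hw).trans ?_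
      refine Real.rpow_le_rpow_of_exponent_le hX1 ?_
      have := Real.rpow_nonneg hw0 (3 / 4 : ℝ)
      linarith
    · have hD8 : (2 : ℝ) ^ 8 ≤ (D : ℝ) ^ 8 := by gcongr
      refine (card_labelings_base (D := D) (by omega) (by push Not at hw; linarith)).trans ?_
      refine Real.rpow_le_rpow (by positivity) ?_ hw0
      calc Y = Y ^ (1 : ℝ) := (Real.rpow_one _).symm
        _ ≤ _ := Real.rpow_le_rpow_of_exponent_le hY1 (by norm_num)
  refine ⟨1 / D, by positivity, fun {α} _ P Q m n hQ hm => (hbound P Q m).trans ?_⟩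
  have hX1 : 1 ≤ Y ^ (2 : ℝ) := Real.one_le_rpow hY1 (by norm_num)
  have hXpos : 0 < Y ^ (2 : ℝ) := by linarith
  have hw : 1 / (D : ℝ) * #Q + m ≤ 2 / D * n := by
    have h1 : 1 / (D : ℝ) * #Q ≤ 1 / D * n := by gcongr
    calc _ ≤ 1 / (D : ℝ) * n + 1 / D * n := add_le_add h1 hm
      _ = _ := by ring
  refine (Real.rpow_le_rpow_of_exponent_le hX1 hw).trans ?_
  rw [Real.rpow_def_of_pos hXpos, Real.rpow_def_of_pos (show (0 : ℝ) < 2 by norm_num),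
    Real.exp_le_exp]
  have hn : (0 : ℝ) ≤ n := by positivity
  calc _ = Real.log (Y ^ (2 : ℝ)) * (2 / D) * n := by ring
    _ ≤ η * Real.log 2 * n := by gcongr
    _ = _ := by ring

namespace Sweep

theorem Cst.diag {κ κ' M : Type} {s : Sweep M} {Y : Finset (ℕ ⊕ M)} {lam : ℕ → M → κ}
    {mu : κ → ℕ → M → κ'} (h : s.Cst Y lam) (h' : ∀ a, s.Cst Y (mu a)) :
    s.Cst Y fun k b => (lam k b, mu (lam k b) k b) where
  vertical k b e hc ht he := by
    rw [h.vertical k b e hc ht he, (h' (lam k e)).vertical k b e hc ht he]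
  pass_below i b hb hx := by
    rw [h.pass_below i b hb hx, (h' (lam (i + 1) b)).pass_below i b hb hx]
  pass_above i b hb ht := by
    rw [h.pass_above i b hb ht, (h' (lam (i + 1) b)).pass_above i b hb ht]

theorem exists_separator_of_set {M : Type} [Fintype M] (s : Sweep M) (h0 : 0 ∈ s.V)
    {T : Finset (ℕ ⊕ M)} (hT : T ⊆ s.nodes) {w : ℝ} (hTw : #T ≤ max w 10) :
    ∃ Y ⊆ s.nodes, (#Y : ℝ) ≤ 60 * √(#s.nodes) ∧ ∃ mu : ℕ → M → Bool, s.Cst Y mu ∧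
      ∀ a, (#((T \ Y).filter fun z => mu (s.rep z).1 (s.rep z).2 = a) : ℝ) ≤
        max (9 / 10 * w) 10 := by
  by_cases h10 : (#T : ℝ) ≤ 10
  · refine ⟨∅, empty_subset _, by simp, fun _ _ => false, ⟨fun _ _ _ _ _ _ => rfl,
      fun _ _ _ _ => rfl, fun _ _ _ _ => rfl⟩, fun a => le_trans ?_ (le_max_right _ _)⟩
    refine le_trans ?_ h10
    exact_mod_cast (card_filter_le _ _).trans (card_le_card sdiff_subset)
  · push Not at h10
    have hw : (#T : ℝ) ≤ w := (le_max_iff.1 hTw).resolve_right (not_le.2 h10)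
    let ω : ℕ ⊕ M → ℝ := fun z => if z ∈ T then 1 else 0
    obtain ⟨Y, hY, hYc, mu, hmu, hbal⟩ := s.exists_separator h0 ω
      (fun z => by simp only [ω]; split_ifs <;> norm_num) (#T)
      (by simp [ω, sum_ite_mem, inter_eq_right.2 hT])
      (fun z _ => by simp only [ω]; split_ifs <;> linarith)
    refine ⟨Y, hY, hYc, mu, hmu, fun a => le_trans ?_ (le_max_left _ _)⟩
    refine le_trans (le_of_eq_of_le ?_ (hbal a)) (by gcongr)
    simp only [ω]
    rw [← sum_filter, sum_const, nsmul_one]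
    congr 2
    ext z
    simp only [mem_filter, mem_sdiff]
    exact ⟨fun h => ⟨⟨⟨hT h.1.1, h.1.2⟩, h.2⟩, h.1.1⟩, fun h => ⟨⟨h.2, h.1.1.2⟩, h.1.2⟩⟩

theorem exists_division_pow (j : ℕ) : ∃ (κ : Type) (_ : Fintype κ) (_ : Inhabited κ) (C : ℝ),
    ∀ {M : Type} [Fintype M] (s : Sweep M), 0 ∈ s.V → ∀ T ⊆ s.nodes, ∃ Z ⊆ s.nodes,
      (#Z : ℝ) ≤ C * √(#s.nodes) ∧ ∃ lam : ℕ → M → κ, s.Cst Z lam ∧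
        ∀ a, (#((T \ Z).filter fun z => lam (s.rep z).1 (s.rep z).2 = a) : ℝ) ≤
          max ((9 / 10 : ℝ) ^ j * (#T : ℝ)) 10 := by
  induction j with
  | zero =>
    refine ⟨Unit, inferInstance, inferInstance, 0, fun s _ T _ => ⟨∅, empty_subset _, by simp,
      fun _ _ => (), ⟨fun _ _ _ _ _ _ => rfl, fun _ _ _ _ => rfl, fun _ _ _ _ => rfl⟩,
      fun a => by simp⟩⟩
  | succ j ih =>
    obtain ⟨κ, hκ, hκ', C, ih⟩ := ih
    refine ⟨κ × Bool, inferInstance, inferInstance, C + Fintype.card κ * 60,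
      fun {M} _ s h0 T hT => ?_⟩
    obtain ⟨Z, hZ, hZc, lam, hlam, hcl⟩ := ih s h0 T hT
    have hsep := fun a => s.exists_separator_of_set h0
      (((filter_subset _ _).trans sdiff_subset).trans hT) (hcl a)
    choose Y hY hYc mu hmu hbal using hsep
    have hYsub : ∀ a, Y a ⊆ Z ∪ univ.biUnion Y := fun a =>
      (subset_biUnion_of_mem Y (mem_univ a)).trans subset_union_right
    refine ⟨Z ∪ univ.biUnion Y, union_subset hZ (biUnion_subset.2 fun a _ => hY a), ?_,
      fun k b => (lam k b, mu (lam k b) k b),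
      (hlam.mono subset_union_left).diag fun a => (hmu a).mono (hYsub a), fun ab => ?_⟩
    · have h1 : (#(Z ∪ univ.biUnion Y) : ℝ) ≤ #Z + #(univ.biUnion Y) := by
        exact_mod_cast card_union_le _ _
      have h2 := card_biUnion_le_real univ Y (a := Fintype.card κ) le_rfl
        (by positivity : 0 ≤ 60 * √(#s.nodes)) fun a _ => hYc a
      linarith
    · refine le_trans ?_ ((hbal ab.1 ab.2).trans (le_of_eq (by ring_nf)))
      refine Nat.cast_le.2 (card_le_card fun z hz => ?_)
      simp only [mem_filter, mem_sdiff, mem_union, not_or, Prod.ext_iff] at hz ⊢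
      obtain ⟨⟨h1, h2, h3⟩, h4, h5⟩ := hz
      refine ⟨⟨⟨⟨h1, h2⟩, h4⟩, fun h => h3 (mem_biUnion.2 ⟨_, mem_univ _, h⟩)⟩, ?_⟩
      rw [← h5, h4]

/-- Few nodes of a planar system separate the rest of it into small classes. -/
theorem exists_division {ε : ℝ} (hε : 0 < ε) :
    ∃ (κ : Type) (_ : Fintype κ) (_ : Inhabited κ) (C : ℝ), 0 < C ∧
    ∀ {M : Type} [Fintype M] (s : Sweep M), 0 ∈ s.V → ∀ T ⊆ s.nodes, ∃ Z ⊆ s.nodes,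
      s.Closed Z ∧ Sum.inl 0 ∈ Z ∧ (#Z : ℝ) ≤ C * √(#s.nodes) ∧ ∃ lam : ℕ → M → κ, s.Cst Z lam ∧
        ∀ a, (#((T \ Z).filter fun z => lam (s.rep z).1 (s.rep z).2 = a) : ℝ) ≤
          max (ε * (#T : ℝ)) 10 := by
  obtain ⟨j, hj⟩ := exists_pow_lt_of_lt_one hε (show (9 / 10 : ℝ) < 1 by norm_num)
  obtain ⟨κ, hκ, hκ', C, h⟩ := exists_division_pow j
  refine ⟨κ, hκ, hκ', 3 * |C| + 1, by positivity, fun {M} _ s h0 T hT => ?_⟩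
  obtain ⟨Z, hZ, hZc, lam, hlam, hcl⟩ := h s h0 T hT
  obtain ⟨Z', hZZ', hZ'n, hZ'c, hZ'0, hZ'card⟩ := exists_closed hZ h0
  refine ⟨Z', hZ'n, hZ'c, hZ'0, ?_, lam, hlam.mono hZZ', fun a => ?_⟩
  · have h1 : (#Z' : ℝ) ≤ 3 * #Z + 1 := by exact_mod_cast hZ'card
    have h2 : 1 ≤ √(#s.nodes) := by
      rw [Real.one_le_sqrt]
      exact_mod_cast card_pos.2 ⟨_, hZ'n hZ'0⟩
    have h3 : C * √(#s.nodes) ≤ |C| * √(#s.nodes) := by gcongr; exact le_abs_self C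
    linarith
  · refine le_trans (Nat.cast_le.2 (card_le_card fun z hz => ?_)) ((hcl a).trans ?_)
    · simp only [mem_filter, mem_sdiff] at hz ⊢
      exact ⟨⟨hz.1.1, fun h => hz.1.2 (hZZ' h)⟩, hz.2⟩
    · gcongr

end Sweep

/-- The elements of `T` listed by increasing value of `f`. -/
def sortBy {σ : Type} (f : σ → ℝ) (T : Finset σ) : List σ :=
  T.toList.insertionSort fun a b => f a ≤ f b

theorem mem_sortBy {σ : Type} {f : σ → ℝ} {T : Finset σ} {a : σ} : a ∈ sortBy f T ↔ a ∈ T := by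
  rw [sortBy, (List.perm_insertionSort _ _).mem_iff, mem_toList]

theorem pairwise_sortBy {σ : Type} {f : σ → ℝ} {T : Finset σ} (hf : Set.InjOn f T) :
    (sortBy f T).Pairwise fun a b => f a < f b := by
  have h1 : (sortBy f T).Pairwise fun a b => f a ≤ f b := by
    have : Std.Total fun a b : σ => f a ≤ f b := ⟨fun a b => le_total _ _⟩
    have : IsTrans σ fun a b => f a ≤ f b := ⟨fun a b c => le_trans⟩
    exact List.pairwise_insertionSort _ _
  have h2 : (sortBy f T).Nodup := (List.perm_insertionSort _ _).nodup_iff.2 T.nodup_toList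
  refine (h1.and h2).imp_of_mem fun ha hb h => lt_of_le_of_ne h.1 fun h' => h.2 ?_
  exact hf (mem_sortBy.1 ha) (mem_sortBy.1 hb) h'

/-- A planar system of non-vertical segments on `N` points listed from left to right. Segment `e`
joins the points `a e` and `b e` and lies on the line of slope `sl e` and intercept `ic e`. -/
structure System (σ : Type) where
  N : ℕ
  p : ℕ → ℝ × ℝ
  a : σ → ℕ
  b : σ → ℕ
  sl : σ → ℝ
  ic : σ → ℝ
  mono : ∀ i j, i < j → j < N → (p i).1 < (p j).1
  a_lt_b : ∀ e, a e < b e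
  b_lt : ∀ e, b e < N
  at_a : ∀ e, sl e * (p (a e)).1 + ic e = (p (a e)).2
  at_b : ∀ e, sl e * (p (b e)).1 + ic e = (p (b e)).2
  avoid : ∀ e i, a e < i → i < b e → sl e * (p i).1 + ic e ≠ (p i).2
  cross : ∀ e f, e ≠ f → ∀ x, (p (a e)).1 < x → (p (a f)).1 < x → x < (p (b e)).1 →
    x < (p (b f)).1 → sl e * x + ic e ≠ sl f * x + ic f

namespace System

variable {σ : Type} (s : System σ)

/-- The height of segment `e` at abscissa `x`. -/
def ht (x : ℝ) (e : σ) : ℝ := s.sl e * x + s.ic e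

/-- The abscissa in the middle of slab `k`. -/
def mid (k : ℕ) : ℝ := ((s.p (k - 1)).1 + (s.p k).1) / 2

/-- Segment `e` runs above the open interval between `x` and `y`, including `y`. -/
def Spans (e : σ) (x y : ℝ) : Prop := ∀ t ∈ Set.Ioc (0 : ℝ) 1,
  (s.p (s.a e)).1 < x + t * (y - x) ∧ x + t * (y - x) < (s.p (s.b e)).1

variable {s}

theorem ht_lt_of_spans {e f : σ} {x y : ℝ} (he : s.Spans e x y) (hf : s.Spans f x y)
    (h : s.ht x e < s.ht x f) : s.ht y e < s.ht y f := by
  by_contra! hy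
  have hne : e ≠ f := by rintro rfl; exact lt_irrefl _ h
  set u := s.ht x f - s.ht x e with hu
  set v := s.ht y e - s.ht y f with hv
  have hu0 : 0 < u := by simp only [hu]; linarith
  have hv0 : 0 ≤ v := by simp only [hv]; linarith
  have ht : u / (u + v) ∈ Set.Ioc (0 : ℝ) 1 :=
    ⟨by positivity, (div_le_one (by positivity)).2 (by linarith)⟩
  refine s.cross e f hne (x + u / (u + v) * (y - x)) (he _ ht).1 (hf _ ht).1 (he _ ht).2
    (hf _ ht).2 ?_
  have huv : u + v ≠ 0 := by positivity
  have hs : (s.sl f - s.sl e) * (y - x) = - (u + v) := by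
    simp only [hu, hv, System.ht]; ring
  have hd : u / (u + v) * (u + v) = u := by field_simp
  have hu' : u = (s.sl f * x + s.ic f) - (s.sl e * x + s.ic e) := rfl
  clear_value u v
  linear_combination - (u / (u + v)) * hs + hd + hu'

theorem spans_right {e : σ} {i : ℕ} (ha : s.a e ≤ i) (hb : i < s.b e) :
    s.Spans e (s.p i).1 (s.mid (i + 1)) := by
  rintro t ⟨ht0, ht1⟩
  have hN := s.b_lt e
  have h1 : (s.p i).1 < (s.p (i + 1)).1 := s.mono _ _ (by omega) (by omega)
  have h2 : (s.p (s.a e)).1 ≤ (s.p i).1 := by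
    rcases ha.eq_or_lt with h | h
    · rw [h]
    · exact (s.mono _ _ h (by omega)).le
  have h3 : (s.p (i + 1)).1 ≤ (s.p (s.b e)).1 := by
    rcases (Nat.succ_le_of_lt hb).eq_or_lt with h | h
    · rw [← h]
    · exact (s.mono _ _ h (by omega)).le
  simp only [mid, Nat.add_sub_cancel]
  constructor <;> nlinarith

theorem spans_left {e : σ} {i : ℕ} (ha : s.a e < i) (hb : i ≤ s.b e) :
    s.Spans e (s.p i).1 (s.mid i) := by
  rintro t ⟨ht0, ht1⟩
  have hN := s.b_lt e
  have h1 : (s.p (i - 1)).1 < (s.p i).1 := s.mono _ _ (by omega) (by omega)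
  have h2 : (s.p (s.a e)).1 ≤ (s.p (i - 1)).1 := by
    rcases (Nat.le_sub_one_of_lt ha).eq_or_lt with h | h
    · rw [h]
    · exact (s.mono _ _ h (by omega)).le
  have h3 : (s.p i).1 ≤ (s.p (s.b e)).1 := by
    rcases hb.eq_or_lt with h | h
    · rw [← h]
    · exact (s.mono _ _ h (by omega)).le
  simp only [mid]
  constructor <;> nlinarith

variable {i : ℕ} {e f : σ}

theorem ht_ne {x : ℝ} (hne : e ≠ f) (h1 : (s.p (s.a e)).1 < x) (h2 : (s.p (s.a f)).1 < x)
    (h3 : x < (s.p (s.b e)).1) (h4 : x < (s.p (s.b f)).1) : s.ht x e ≠ s.ht x f :=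
  s.cross e f hne x h1 h2 h3 h4

theorem a_lt (h : s.a e < i) (h' : i < s.b e) : (s.p (s.a e)).1 < (s.p i).1 :=
  s.mono _ _ h (h'.trans (s.b_lt e))

theorem lt_b (h' : i < s.b e) : (s.p i).1 < (s.p (s.b e)).1 := s.mono _ _ h' (s.b_lt e)

theorem Spans.apply {x y : ℝ} (h : s.Spans e x y) :
    (s.p (s.a e)).1 < y ∧ y < (s.p (s.b e)).1 := by
  simpa using h 1 ⟨one_pos, le_rfl⟩

theorem ht_ne_of_spans {x y : ℝ} (hne : e ≠ f) (he : s.Spans e x y) (hf : s.Spans f x y) :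
    s.ht y e ≠ s.ht y f :=
  ht_ne hne he.apply.1 hf.apply.1 he.apply.2 hf.apply.2

theorem nodup_of_pairwise {l : List σ} {g : σ → ℝ} (h : l.Pairwise fun e f => g e < g f) :
    l.Nodup :=
  h.imp fun h => by rintro rfl; exact lt_irrefl _ h

variable [Fintype σ] (s)

/-- The segments passing below point `i`. -/
def lower (i : ℕ) : List σ := sortBy (s.ht (s.p i).1)
  (univ.filter fun e => s.a e < i ∧ i < s.b e ∧ s.ht (s.p i).1 e < (s.p i).2)

/-- The segments passing above point `i`. -/
def upper (i : ℕ) : List σ := sortBy (s.ht (s.p i).1)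
  (univ.filter fun e => s.a e < i ∧ i < s.b e ∧ (s.p i).2 < s.ht (s.p i).1 e)

/-- The segments with right end point `i`. -/
def ending (i : ℕ) : List σ := sortBy (s.ht (s.mid i)) (univ.filter fun e => s.b e = i)

/-- The segments with left end point `i`. -/
def starting (i : ℕ) : List σ := sortBy (s.ht (s.mid (i + 1))) (univ.filter fun e => s.a e = i)

variable {s}

theorem mem_lower : e ∈ s.lower i ↔ s.a e < i ∧ i < s.b e ∧ s.ht (s.p i).1 e < (s.p i).2 := by
  simp [lower, mem_sortBy]

theorem mem_upper : e ∈ s.upper i ↔ s.a e < i ∧ i < s.b e ∧ (s.p i).2 < s.ht (s.p i).1 e := by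
  simp [upper, mem_sortBy]

theorem mem_ending : e ∈ s.ending i ↔ s.b e = i := by simp [ending, mem_sortBy]

theorem mem_starting : e ∈ s.starting i ↔ s.a e = i := by simp [starting, mem_sortBy]

theorem pairwise_lower : (s.lower i).Pairwise fun e f => s.ht (s.p i).1 e < s.ht (s.p i).1 f := by
  refine pairwise_sortBy fun e he f hf h => ?_
  simp only [coe_filter, mem_univ, true_and, Set.mem_ofPred_eq] at he hf
  by_contra hne
  exact ht_ne hne (a_lt he.1 he.2.1) (a_lt hf.1 hf.2.1) (lt_b he.2.1) (lt_b hf.2.1) h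

theorem pairwise_upper : (s.upper i).Pairwise fun e f => s.ht (s.p i).1 e < s.ht (s.p i).1 f := by
  refine pairwise_sortBy fun e he f hf h => ?_
  simp only [coe_filter, mem_univ, true_and, Set.mem_ofPred_eq] at he hf
  by_contra hne
  exact ht_ne hne (a_lt he.1 he.2.1) (a_lt hf.1 hf.2.1) (lt_b he.2.1) (lt_b hf.2.1) h

theorem pairwise_ending :
    (s.ending i).Pairwise fun e f => s.ht (s.mid i) e < s.ht (s.mid i) f := by
  refine pairwise_sortBy fun e he f hf h => ?_
  simp only [coe_filter, mem_univ, true_and, Set.mem_ofPred_eq] at he hf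
  by_contra hne
  have := s.a_lt_b e
  have := s.a_lt_b f
  exact ht_ne_of_spans hne (spans_left (by omega) he.ge) (spans_left (by omega) hf.ge) h

theorem pairwise_starting : (s.starting i).Pairwise
    fun e f => s.ht (s.mid (i + 1)) e < s.ht (s.mid (i + 1)) f := by
  refine pairwise_sortBy fun e he f hf h => ?_
  simp only [coe_filter, mem_univ, true_and, Set.mem_ofPred_eq] at he hf
  by_contra hne
  have := s.a_lt_b e
  have := s.a_lt_b f
  exact ht_ne_of_spans hne (spans_right he.le (by omega)) (spans_right hf.le (by omega)) h

variable (s) in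
theorem pairwise_left (i : ℕ) : (s.lower i ++ s.ending i ++ s.upper i).Pairwise
    fun e f => s.ht (s.mid i) e < s.ht (s.mid i) f := by
  have hl : ∀ e ∈ s.lower i, s.Spans e (s.p i).1 (s.mid i) := fun e he =>
    spans_left (mem_lower.1 he).1 (mem_lower.1 he).2.1.le
  have hu : ∀ e ∈ s.upper i, s.Spans e (s.p i).1 (s.mid i) := fun e he =>
    spans_left (mem_upper.1 he).1 (mem_upper.1 he).2.1.le
  have hm : ∀ e ∈ s.ending i, s.Spans e (s.p i).1 (s.mid i) ∧ s.ht (s.p i).1 e = (s.p i).2 := by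
    intro e he
    have := s.a_lt_b e
    have h := mem_ending.1 he
    exact ⟨spans_left (by omega) h.ge, by rw [← h]; exact s.at_b e⟩
  simp only [List.pairwise_append, List.mem_append]
  refine ⟨⟨pairwise_lower.imp_of_mem fun he hf h => ht_lt_of_spans (hl _ he) (hl _ hf) h,
    pairwise_ending, fun e he f hf => ht_lt_of_spans (hl _ he) (hm _ hf).1 ?_⟩,
    pairwise_upper.imp_of_mem fun he hf h => ht_lt_of_spans (hu _ he) (hu _ hf) h, ?_⟩
  · rw [(hm _ hf).2]
    exact (mem_lower.1 he).2.2
  · rintro e (he | he) f hf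
    · exact ht_lt_of_spans (hl _ he) (hu _ hf) ((mem_lower.1 he).2.2.trans (mem_upper.1 hf).2.2)
    · refine ht_lt_of_spans (hm _ he).1 (hu _ hf) ?_
      rw [(hm _ he).2]
      exact (mem_upper.1 hf).2.2

variable (s) in
theorem pairwise_right (i : ℕ) : (s.lower i ++ s.starting i ++ s.upper i).Pairwise
    fun e f => s.ht (s.mid (i + 1)) e < s.ht (s.mid (i + 1)) f := by
  have hl : ∀ e ∈ s.lower i, s.Spans e (s.p i).1 (s.mid (i + 1)) := fun e he =>
    spans_right (mem_lower.1 he).1.le (mem_lower.1 he).2.1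
  have hu : ∀ e ∈ s.upper i, s.Spans e (s.p i).1 (s.mid (i + 1)) := fun e he =>
    spans_right (mem_upper.1 he).1.le (mem_upper.1 he).2.1
  have hm : ∀ e ∈ s.starting i,
      s.Spans e (s.p i).1 (s.mid (i + 1)) ∧ s.ht (s.p i).1 e = (s.p i).2 := by
    intro e he
    have := s.a_lt_b e
    have h := mem_starting.1 he
    exact ⟨spans_right h.le (by omega), by rw [← h]; exact s.at_a e⟩
  simp only [List.pairwise_append, List.mem_append]
  refine ⟨⟨pairwise_lower.imp_of_mem fun he hf h => ht_lt_of_spans (hl _ he) (hl _ hf) h,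
    pairwise_starting, fun e he f hf => ht_lt_of_spans (hl _ he) (hm _ hf).1 ?_⟩,
    pairwise_upper.imp_of_mem fun he hf h => ht_lt_of_spans (hu _ he) (hu _ hf) h, ?_⟩
  · rw [(hm _ hf).2]
    exact (mem_lower.1 he).2.2
  · rintro e (he | he) f hf
    · exact ht_lt_of_spans (hl _ he) (hu _ hf) ((mem_lower.1 he).2.2.trans (mem_upper.1 hf).2.2)
    · refine ht_lt_of_spans (hm _ he).1 (hu _ hf) ?_
      rw [(hm _ he).2]
      exact (mem_upper.1 hf).2.2

theorem mem_left : e ∈ s.lower i ++ s.ending i ++ s.upper i ↔ s.a e < i ∧ i ≤ s.b e := by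
  have h1 := s.a_lt_b e
  simp only [List.mem_append, mem_lower, mem_ending, mem_upper]
  constructor
  · rintro ((h | h) | h) <;> omega
  · rintro ⟨h, h'⟩
    rcases h'.eq_or_lt with h' | h'
    · exact Or.inl (Or.inr h'.symm)
    · rcases lt_or_gt_of_ne (s.avoid e i h h') with h2 | h2
      · exact Or.inl (Or.inl ⟨h, h', h2⟩)
      · exact Or.inr ⟨h, h', h2⟩

theorem mem_right : e ∈ s.lower i ++ s.starting i ++ s.upper i ↔ s.a e ≤ i ∧ i < s.b e := by
  have h1 := s.a_lt_b e
  simp only [List.mem_append, mem_lower, mem_starting, mem_upper]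
  constructor
  · rintro ((h | h) | h) <;> omega
  · rintro ⟨h', h⟩
    rcases h'.eq_or_lt with h' | h'
    · exact Or.inl (Or.inr h')
    · rcases lt_or_gt_of_ne (s.avoid e i h' h) with h2 | h2
      · exact Or.inl (Or.inl ⟨h', h, h2⟩)
      · exact Or.inr ⟨h', h, h2⟩

variable (s) in
theorem right_eq_left (i : ℕ) : s.lower i ++ s.starting i ++ s.upper i =
    s.lower (i + 1) ++ s.ending (i + 1) ++ s.upper (i + 1) := by
  have h1 := s.pairwise_right i
  have h2 := s.pairwise_left (i + 1)
  refine List.Perm.eq_of_pairwise (fun e f _ _ h h' => absurd h (lt_asymm h')) h1 h2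
    ((List.perm_ext_iff_of_nodup (nodup_of_pairwise h1) (nodup_of_pairwise h2)).2 fun e => ?_)
  rw [mem_left, mem_right]
  omega

theorem left_eq_nil (h : ∀ e, ¬ (s.a e < i ∧ i ≤ s.b e)) :
    s.lower i = [] ∧ s.ending i = [] ∧ s.upper i = [] := by
  have : s.lower i ++ s.ending i ++ s.upper i = [] :=
    List.eq_nil_iff_forall_not_mem.2 fun e he => h e (mem_left.1 he)
  simpa [and_assoc] using this

variable (s)

/-- The sweep of a planar system of segments. -/
def sweep : Sweep (σ ⊕ Bool) where
  n := s.N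
  V := range s.N
  A i := Sum.inr false :: (s.lower i).map Sum.inl
  E i := (s.ending i).map Sum.inl
  S i := (s.starting i).map Sum.inl
  B i := (s.upper i).map Sum.inl ++ [Sum.inr true]
  bot := Sum.inr false
  top := Sum.inr true
  st := Sum.elim s.a fun _ => 0
  fi := Sum.elim s.b fun _ => 0
  V_lt i hi := mem_range.1 hi
  step i := by
    have := congrArg (List.map (Sum.inl : σ → σ ⊕ Bool)) (s.right_eq_left i)
    simp only [List.map_append, List.append_assoc] at this
    simp only [List.cons_append, List.append_assoc]
    rw [← List.append_assoc (List.map _ (s.starting i)),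
      ← List.append_assoc (List.map _ (s.lower i)), this]
    simp
  line_zero := by
    obtain ⟨h1, h2, h3⟩ := left_eq_nil (s := s) (i := 0) fun e => by omega
    simp [h1, h2, h3]
  line_n := by
    obtain ⟨h1, h2, h3⟩ := left_eq_nil (s := s) (i := s.N) fun e => by
      have := s.b_lt e
      omega
    simp [h1, h2, h3]
  nodup i := by
    have := (nodup_of_pairwise (s.pairwise_left i)).map (Sum.inl_injective (β := Bool))
    simp only [List.map_append, List.append_assoc] at this
    simp only [List.cons_append, List.append_assoc]
    rw [← List.append_assoc (List.map _ (s.ending i)),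
      ← List.append_assoc (List.map _ (s.lower i))]
    rw [List.nodup_cons]
    refine ⟨by simp, List.nodup_append.2 ⟨this, by simp, ?_⟩⟩
    simp
  A_head i := ⟨_, rfl⟩
  B_last i := ⟨_, rfl⟩
  S_st i e he := by
    obtain ⟨e, he', rfl⟩ := List.mem_map.1 he
    have h1 := s.a_lt_b e
    have h2 := s.b_lt e
    rw [mem_starting] at he'
    exact ⟨he', mem_range.2 (by omega)⟩
  E_fi i e he := by
    obtain ⟨e, he', rfl⟩ := List.mem_map.1 he
    have h2 := s.b_lt e
    rw [mem_ending] at he'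
    exact ⟨he', mem_range.2 (by omega)⟩
  line_mem k e he hb ht := by
    rcases e with e | (_ | _)
    · exact mem_left.1 (by simpa using he)
    · exact absurd rfl hb
    · exact absurd rfl ht

theorem geo : s.sweep.Geo (range s.N) s.p (Sum.elim s.sl fun _ => 0)
    (Sum.elim s.ic fun _ => 0) where
  mono i _ j hj hij := s.mono i j hij (mem_range.1 hj)
  below i _ e he hb := by
    rcases e with e | b
    · exact (mem_lower.1 (by simpa [sweep] using he)).2.2
    · rcases b <;> simp [sweep] at he hb
  above i _ e he ht := by
    rcases e with e | b
    · exact (mem_upper.1 (by simpa [sweep] using he)).2.2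
    · rcases b <;> simp [sweep] at he ht

theorem mem_S (e : σ) : Sum.inl e ∈ s.sweep.S (s.a e) := by
  simpa [sweep] using mem_starting.2 rfl

theorem mem_E (e : σ) : Sum.inl e ∈ s.sweep.E (s.b e) := by
  simpa [sweep] using mem_ending.2 rfl

theorem card_nodes_le : #s.sweep.nodes ≤ s.N + Fintype.card σ := by
  rw [Sweep.nodes, card_disjSum]
  refine add_le_add (by simp [sweep]) ?_
  have : s.sweep.segs ⊆ univ.image (Sum.inl : σ → σ ⊕ Bool) := by
    intro e he
    rw [Sweep.mem_segs] at he
    rcases e with e | b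
    · simp
    · simp [sweep] at he
  exact (card_le_card this).trans card_image_le

end System

/-- A function moving every point outside `R` into `R` or within its class is one of few. -/
theorem card_classwise_le {κ : Type} {n : ℕ} (R : Finset (Fin n)) (f : Fin n → κ)
    (hR : (#R : ℝ) ≤ n / 2 ^ 17) (hf : ∀ a, (#(Rᶜ.filter fun u => f u = a) : ℝ) ≤ n / 2 ^ 17) :
    (#(Fintype.piFinset fun v => if v ∈ R then univ else R ∪ Rᶜ.filter fun u => f u = f v) : ℝ) ≤
      n ^ n * (1 / 2) ^ (8 * n) := by
  rw [Fintype.card_piFinset]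
  push_cast
  have h1 : ∀ v ∈ (univ : Finset (Fin n)),
      (#(if v ∈ R then univ else R ∪ Rᶜ.filter fun u => f u = f v) : ℝ) ≤
        n * (if v ∈ R then 1 else (1 / 2) ^ 16) := by
    intro v _
    split_ifs
    · simp
    · have := card_union_le R (Rᶜ.filter fun u => f u = f v)
      have h2 : (#(R ∪ Rᶜ.filter fun u => f u = f v) : ℝ) ≤
          #R + #(Rᶜ.filter fun u => f u = f v) := by exact_mod_cast this
      have := hf (f v)
      linarith
  refine (prod_le_prod (fun _ _ => Nat.cast_nonneg _) h1).trans ?_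
  rw [prod_mul_distrib, prod_const, prod_ite, prod_const_one, one_mul, prod_const, card_univ,
    Fintype.card_fin, ← pow_mul]
  refine mul_le_mul_of_nonneg_left ?_ (by positivity)
  refine pow_le_pow_of_le_one (by norm_num) (by norm_num) ?_
  have h2 : #((univ : Finset (Fin n)).filter fun v => v ∉ R) = n - #R := by
    rw [filter_not, filter_mem_eq_inter, univ_inter, card_sdiff_of_subset (subset_univ _),
      card_univ, Fintype.card_fin]
  rw [h2]
  have h3 : (2 * #R : ℝ) ≤ n := by
    have : (0 : ℝ) ≤ n := Nat.cast_nonneg n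
    linarith
  have h4 : 2 * #R ≤ n := by exact_mod_cast h3
  omega

/-- Few functions move every point, up to few exceptions, within its class for some labelling
with a realization. -/
theorem card_functions_le (κ : Type) [Fintype κ] [Inhabited κ] : ∃ δ : ℝ, 0 < δ ∧
    ∀ {n : ℕ} (P : Fin n → ℝ × ℝ) (F : Finset (Fin n → Fin n)),
      (∀ g ∈ F, ∃ (R : Finset (Fin n)) (m : ℕ) (f : Fin n → κ), (m : ℝ) ≤ δ * n ∧
        f ∈ labelings P Rᶜ m ∧ (#R : ℝ) ≤ n / 2 ^ 17 ∧
        (∀ a, (#(Rᶜ.filter fun u => f u = a) : ℝ) ≤ n / 2 ^ 17) ∧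
        ∀ v ∉ R, g v ∈ R ∨ g v ∉ R ∧ f (g v) = f v) →
      (#F : ℝ) ≤ n ^ n * (1 / 2) ^ (5 * n) := by
  obtain ⟨δ, hδ, hlab⟩ := card_labelings_le κ (η := 1) one_pos
  refine ⟨min δ 1, lt_min hδ one_pos, fun {n} P F hF => ?_⟩
  let good : Finset (Fin n) → ℕ → Finset (Fin n → κ) := fun R m =>
    (labelings P Rᶜ m).filter fun f => (m : ℝ) ≤ δ * n ∧ (#R : ℝ) ≤ n / 2 ^ 17 ∧
      ∀ a, (#(Rᶜ.filter fun u => f u = a) : ℝ) ≤ n / 2 ^ 17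
  let cod : Finset (Fin n) → (Fin n → κ) → Finset (Fin n → Fin n) := fun R f =>
    Fintype.piFinset fun v => if v ∈ R then univ else R ∪ Rᶜ.filter fun u => f u = f v
  have hsub : F ⊆ univ.biUnion fun R : Finset (Fin n) => (range (n + 1)).biUnion fun m =>
      (good R m).biUnion fun f => cod R f := by
    intro g hg
    obtain ⟨R, m, f, hm, hf, hR, hcl, hgf⟩ := hF g hg
    have hm1 : (m : ℝ) ≤ n := hm.trans (by
      calc min δ 1 * (n : ℝ) ≤ 1 * n := by gcongr; exact min_le_right _ _
        _ = n := one_mul _)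
    have hm2 : (m : ℝ) ≤ δ * n := hm.trans (by gcongr; exact min_le_left _ _)
    refine mem_biUnion.2 ⟨R, mem_univ _, mem_biUnion.2 ⟨m, ?_, mem_biUnion.2 ⟨f, ?_, ?_⟩⟩⟩
    · exact mem_range.2 (Nat.lt_succ_of_le (by exact_mod_cast hm1))
    · exact mem_filter.2 ⟨hf, hm2, hR, hcl⟩
    · refine Fintype.mem_piFinset.2 fun v => ?_
      split_ifs with hv
      · exact mem_univ _
      · rcases hgf v hv with h | ⟨h, h'⟩
        · exact mem_union_left _ h
        · exact mem_union_right _ (mem_filter.2 ⟨mem_compl.2 h, h'⟩)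
  have hgood : ∀ R m, (#(good R m) : ℝ) ≤ 2 ^ n := by
    intro R m
    by_cases hm : (m : ℝ) ≤ δ * n
    · refine (Nat.cast_le.2 (card_filter_le _ _)).trans ?_
      have := hlab P Rᶜ m n ((card_le_univ _).trans (by simp)) hm
      rw [one_mul, Real.rpow_natCast] at this
      exact this
    · have : good R m = ∅ := filter_eq_empty_iff.2 fun f _ h => hm h.1
      rw [this]
      simp
  refine (Nat.cast_le.2 (card_le_card hsub)).trans ?_
  have hnn : (n + 1 : ℝ) ≤ 2 ^ n := by exact_mod_cast Nat.lt_two_pow_self (n := n)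
  have h1 : (#(univ.biUnion fun R : Finset (Fin n) => (range (n + 1)).biUnion fun m =>
      (good R m).biUnion fun f => cod R f) : ℝ) ≤
        2 ^ n * (2 ^ n * (2 ^ n * (n ^ n * (1 / 2) ^ (8 * n)))) := by
    refine card_biUnion_le_real _ _ (by simp) (by positivity) fun R _ => ?_
    refine card_biUnion_le_real _ _ (by simpa using hnn) (by positivity) fun m _ => ?_
    refine card_biUnion_le_real _ _ (hgood R m) (by positivity) fun f hf => ?_
    obtain ⟨-, -, hR, hcl⟩ := mem_filter.1 hf
    exact card_classwise_le R f hR hcl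
  refine h1.trans (le_of_eq ?_)
  have h2 : (2 : ℝ) ^ n * 2 ^ n * 2 ^ n * (1 / 2) ^ (3 * n) = 1 := by
    rw [← mul_pow, ← mul_pow, pow_mul, ← mul_pow]
    norm_num
  rw [show 8 * n = 3 * n + 5 * n by ring, pow_add]
  linear_combination (n ^ n * (1 / 2) ^ (5 * n) : ℝ) * h2

/-- A planar system of segments containing sheared points `P` and, for every `v` other than
`root`, a path from `v` to `g v` whose inner points are owned by `v`. -/
structure Layout {α : Type} (P : α → ℝ × ℝ) (g : α → α) (root : α) where
  σ : Type
  inst : Fintype σ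
  s : System σ
  ε : ℝ
  idx : α → ℕ
  own : ℕ → α
  inj : Function.Injective idx
  idx_lt : ∀ v, idx v < s.N
  idx_pt : ∀ v, s.p (idx v) = shear ε (P v)
  own_idx : ∀ v, own (idx v) = v
  link : ∀ v, v ≠ root → ∀ (κ : Type) (h : ℕ → κ) (Z : Set ℕ),
    (∀ e, s.a e ∉ Z → s.b e ∉ Z → h (s.a e) = h (s.b e)) → (∀ i ∈ Z, own i ≠ v) →
      idx (g v) ∉ Z → h (idx v) = h (idx (g v))

attribute [instance] Layout.inst

theorem Layout.exists_labeling {κ : Type} [Fintype κ] [Inhabited κ] {n : ℕ} {P : Fin n → ℝ × ℝ}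
    {g : Fin n → Fin n} {root : Fin n} (L : Layout P g root) {Z : Finset (ℕ ⊕ (L.σ ⊕ Bool))}
    (hZ : Z ⊆ L.s.sweep.nodes) (closed : L.s.sweep.Closed Z) (h0 : Sum.inl 0 ∈ Z)
    {lam : ℕ → L.σ ⊕ Bool → κ} (cst : L.s.sweep.Cst Z lam) {w : ℝ}
    (hcl : ∀ a, (#(((univ.image fun v => Sum.inl (L.idx v)) \ Z).filter fun z =>
      lam (L.s.sweep.rep z).1 (L.s.sweep.rep z).2 = a) : ℝ) ≤ w) :
    ∃ (R : Finset (Fin n)) (f : Fin n → κ), f ∈ labelings P Rᶜ #Z ∧ #R ≤ #Z + 1 ∧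
      (∀ a, (#(Rᶜ.filter fun u => f u = a) : ℝ) ≤ w) ∧
        ∀ v ∉ R, g v ∈ R ∨ g v ∉ R ∧ f (g v) = f v := by
  set R : Finset (Fin n) := insert root (Z.image fun z => Sum.elim L.own (fun _ => root) z)
    with hR
  set h : ℕ → κ := fun i => lam (i + 1) (L.s.sweep.x i) with hh
  set f : Fin n → κ := fun v => if v ∈ Rᶜ then h (L.idx v) else default with hf
  have hRZ : ∀ v ∉ R, ∀ i, Sum.inl i ∈ Z → L.own i ≠ v := by
    rintro v hv i hi rfl
    exact hv (mem_insert_of_mem (mem_image.2 ⟨_, hi, rfl⟩))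
  have hidx : ∀ v ∉ R, Sum.inl (L.idx v) ∉ Z := fun v hv hi => hRZ v hv _ hi (L.own_idx v)
  have hfR : ∀ v ∉ R, f v = h (L.idx v) := fun v hv => if_pos (mem_compl.2 hv)
  refine ⟨R, f, mem_labelings.2 ⟨fun v hv => if_neg hv, ?_⟩, ?_, fun a => ?_, fun v hv => ?_⟩
  · refine L.s.geo.nonempty_realization (ε := L.ε) (idx := L.idx) (lam := lam) L.inj.injOn ?_ ?_ ?_
      ?_ hZ
      closed h0 cst ?_
    · exact fun p _ => mem_range.2 (L.idx_lt p)
    · exact fun p _ => (Sweep.inl_mem_nodes _).2 (mem_range.2 (L.idx_lt p))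
    · exact fun p hp => hidx p (mem_compl.1 hp)
    · exact fun p _ => L.idx_pt p
    · exact fun p hp => hfR p (mem_compl.1 hp)
  · exact (card_insert_le _ _).trans (Nat.succ_le_succ card_image_le)
  · refine le_trans (Nat.cast_le.2 ?_) (hcl a)
    refine card_le_card_of_injOn (fun v => Sum.inl (L.idx v)) (fun v hv => ?_)
      fun u _ v _ huv => L.inj (Sum.inl_injective huv)
    have hv' := mem_filter.1 hv
    have hvR := mem_compl.1 hv'.1
    refine mem_filter.2 ⟨mem_sdiff.2 ⟨mem_image_of_mem _ (mem_univ _), hidx v hvR⟩, ?_⟩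
    rw [← hv'.2, hfR v hvR]
    rfl
  · by_cases hg : g v ∈ R
    · exact Or.inl hg
    · refine Or.inr ⟨hg, ?_⟩
      rw [hfR v hv, hfR _ hg]
      refine (L.link v (fun hv' => hv (hv' ▸ mem_insert_self _ _)) κ h {i | Sum.inl i ∈ Z} ?_
        (hRZ v hv) (hidx _ hg)).symm
      intro e ha hb
      exact (cst.S_eq closed ha (L.s.mem_S e)).trans (cst.E_eq closed hb (L.s.mem_E e)).symm

/-- Few functions admit a small layout. -/
theorem card_functions_of_layout : ∃ c : ℝ, 0 < c ∧ ∃ N : ℕ, ∀ n : ℕ, N ≤ n →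
    ∀ (P : Fin n → ℝ × ℝ) (root : Fin n) (F : Finset (Fin n → Fin n)),
      (∀ g ∈ F, ∃ L : Layout P g root,
        (L.s.N + Fintype.card L.σ : ℝ) ≤ 2 * n + 2 * (c * n ^ 2)) →
      (#F : ℝ) ≤ n ^ n * (1 / 2) ^ (5 * n) := by
  obtain ⟨κ, _, _, C, hC, hdiv⟩ := Sweep.exists_division (ε := 1 / 2 ^ 17) (by norm_num)
  obtain ⟨δ, hδ, hF⟩ := card_functions_le κ
  set D : ℝ := min δ (1 / 2 ^ 18) with hD
  have hD0 : 0 < D := lt_min hδ (by norm_num)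
  obtain ⟨N₀, hN₀⟩ := exists_nat_ge (4 * C ^ 2 / D ^ 2)
  refine ⟨D ^ 2 / (4 * C ^ 2), by positivity, max N₀ (2 ^ 21), fun n hn P root F h => hF P F
    fun g hg => ?_⟩
  obtain ⟨L, hL⟩ := h g hg
  have hn1 : (2 ^ 21 : ℝ) ≤ n := by exact_mod_cast (le_max_right _ _).trans hn
  have hn2 : 4 * C ^ 2 / D ^ 2 ≤ n := hN₀.trans (by exact_mod_cast (le_max_left _ _).trans hn)
  rw [div_le_iff₀ (by positivity)] at hn2
  set T : Finset (ℕ ⊕ (L.σ ⊕ Bool)) := univ.image fun v => Sum.inl (L.idx v) with hT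
  have hTc : #T = n := by
    rw [hT, card_image_of_injective _ fun u v h => L.inj (Sum.inl_injective h), card_univ,
      Fintype.card_fin]
  obtain ⟨Z, hZ, hZc, h0, hZn, lam, cst, hcl⟩ := hdiv L.s.sweep
    (mem_range.2 ((Nat.zero_le _).trans_lt (L.idx_lt root))) T
    (image_subset_iff.2 fun v _ => (Sweep.inl_mem_nodes _).2 (mem_range.2 (L.idx_lt v)))
  have hcl' : ∀ a, _ ≤ (n : ℝ) / 2 ^ 17 := fun a => (hcl a).trans
    (max_le (le_of_eq (by rw [hTc]; ring)) (by linarith))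
  have hZD : (#Z : ℝ) ≤ D * n := by
    refine hZn.trans (abs_le_of_sq_le_sq' ?_ (by positivity)).2
    rw [mul_pow, Real.sq_sqrt (Nat.cast_nonneg _)]
    have h1 : (#L.s.sweep.nodes : ℝ) ≤ 2 * n + 2 * (D ^ 2 / (4 * C ^ 2) * n ^ 2) :=
      le_trans (by exact_mod_cast L.s.card_nodes_le) hL
    calc C ^ 2 * (#L.s.sweep.nodes : ℝ)
        ≤ C ^ 2 * (2 * n + 2 * (D ^ 2 / (4 * C ^ 2) * n ^ 2)) := by gcongr
      _ = (4 * C ^ 2) * n / 2 + D ^ 2 * n ^ 2 / 2 := by field_simp; ring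
      _ ≤ (n * D ^ 2) * n / 2 + D ^ 2 * n ^ 2 / 2 := by gcongr
      _ = (D * n) ^ 2 := by ring
  obtain ⟨R, f, hf, hR, hRcl, hg'⟩ := L.exists_labeling hZ hZc h0 cst
    (w := n / 2 ^ 17) fun a => by convert hcl' a
  refine ⟨R, #Z, f, hZD.trans (by gcongr; exact min_le_left _ _), hf, ?_, hRcl, hg'⟩
  have h2 : (#R : ℝ) ≤ #Z + 1 := by exact_mod_cast hR
  have h3 : D * n ≤ 1 / 2 ^ 18 * n := by gcongr; exact min_le_right _ _
  linarith

/-- Every tree consists of the edges from the vertices to their parents. -/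
theorem SimpleGraph.IsTree.exists_parent {V : Type} [Fintype V] {G : SimpleGraph V}
    (hG : G.IsTree) (root : V) :
    ∃ g : V → V, (∀ v, v ≠ root → G.Adj v (g v)) ∧
      (∀ u v, u ≠ root → v ≠ root → s(u, g u) = s(v, g v) → u = v) ∧
      ∀ u v, G.Adj u v ↔ (u ≠ root ∧ g u = v) ∨ (v ≠ root ∧ g v = u) := by
  have hpar : ∀ v, ∃ w, v ≠ root → G.Adj v w ∧ G.dist root w < G.dist root v := by
    intro v
    by_cases hv : v = root
    · exact ⟨root, fun h => absurd hv h⟩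
    obtain ⟨p, hp⟩ := (hG.connected.preconnected v root).exists_walk_length_eq_dist
    cases p with
    | nil => exact absurd rfl hv
    | cons h q =>
      refine ⟨_, fun _ => ⟨h, ?_⟩⟩
      rw [SimpleGraph.dist_comm, SimpleGraph.dist_comm (u := root), ← hp,
        SimpleGraph.Walk.length_cons]
      exact Nat.lt_succ_of_le (SimpleGraph.dist_le q)
  choose g hg using hpar
  have hinj : ∀ u v, u ≠ root → v ≠ root → s(u, g u) = s(v, g v) → u = v := by
    intro u v hu hv h
    rcases Sym2.eq_iff.1 h with h | ⟨h1, h2⟩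
    · exact h.1
    · have h3 := (hg u hu).2
      have h4 := (hg v hv).2
      rw [h2] at h3
      rw [← h1] at h4
      exact absurd h3 (lt_asymm h4)
  refine ⟨g, fun v hv => (hg v hv).1, hinj, fun u v => ⟨fun h => ?_, ?_⟩⟩
  · have himg : (univ.erase root).image (fun v => s(v, g v)) = G.edgeFinset := by
      refine eq_of_subset_of_card_le (fun e he => ?_) ?_
      · obtain ⟨v, hv, rfl⟩ := mem_image.1 he
        exact SimpleGraph.mem_edgeFinset.2 (hg v (mem_erase.1 hv).1).1
      · rw [card_image_of_injOn fun u hu v hv h => hinj u v (mem_erase.1 hu).1 (mem_erase.1 hv).1 h,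
          card_erase_of_mem (mem_univ _), card_univ]
        have := hG.card_edgeFinset
        omega
    have he : s(u, v) ∈ G.edgeFinset := SimpleGraph.mem_edgeFinset.2 h
    rw [← himg] at he
    obtain ⟨w, hw, hwe⟩ := mem_image.1 he
    rcases Sym2.eq_iff.1 hwe with ⟨rfl, h2⟩ | ⟨rfl, h2⟩
    · exact Or.inl ⟨(mem_erase.1 hw).1, h2⟩
    · exact Or.inr ⟨(mem_erase.1 hw).1, h2⟩
  · rintro (⟨hu, rfl⟩ | ⟨hv, rfl⟩)
    · exact (hg u hu).1
    · exact (hg v hv).1.symm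

theorem sum_bends_le {n : ℕ} {G : SimpleGraph (Fin n)} {bends : Fin n → Fin n → List (ℝ × ℝ)}
    (symm : ∀ u v : Fin n, bends v u = (bends u v).reverse) {g : Fin n → Fin n} {root : Fin n}
    (adj : ∀ v, v ≠ root → G.Adj v (g v))
    (inj : ∀ u v, u ≠ root → v ≠ root → s(u, g u) = s(v, g v) → u = v) :
    (∑ v ∈ univ.erase root, (bends v (g v)).length : ℝ) ≤ totalBends G bends := by
  set F : Fin n × Fin n → ℝ := fun e => if G.Adj e.1 e.2 then ((bends e.1 e.2).length : ℝ) else 0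
    with hF
  have hF0 : ∀ e, 0 ≤ F e := fun e => by simp only [hF]; positivity
  have htot : totalBends G bends = (∑ e, F e) / 2 := by
    rw [totalBends, Fintype.sum_prod_type]
  have himg : ∑ e ∈ (univ.erase root).disjSum (univ.erase root),
      F (Sum.elim (fun v => (v, g v)) (fun v => (g v, v)) e) ≤ ∑ e, F e := by
    rw [← sum_image (f := F)]
    · exact sum_le_sum_of_subset_of_nonneg (subset_univ _) fun e _ _ => hF0 e
    · rintro (u | u) hu (v | v) hv huv <;>
        simp only [mem_coe, inl_mem_disjSum, inr_mem_disjSum, mem_erase, mem_univ, and_true,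
          Sum.elim_inl, Sum.elim_inr, Prod.mk.injEq] at hu hv huv
      · rw [huv.1]
      · have := inj u v hu hv (Sym2.eq_iff.2 (Or.inr huv))
        subst this
        exact absurd huv.1 (adj u hu).ne
      · have := inj u v hu hv (Sym2.eq_iff.2 (Or.inr ⟨huv.2, huv.1⟩))
        subst this
        exact absurd huv.2 (adj u hu).ne
      · rw [huv.2]
  rw [sum_disjSum] at himg
  have h1 : ∀ v ∈ univ.erase root, F (v, g v) = (bends v (g v)).length := fun v hv =>
    if_pos (adj v (mem_erase.1 hv).1)
  have h2 : ∀ v ∈ univ.erase root, F (g v, v) = (bends v (g v)).length := fun v hv => by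
    simp only [hF]
    rw [if_pos (adj v (mem_erase.1 hv).1).symm, symm v (g v), List.length_reverse]
  simp only [Sum.elim_inl, Sum.elim_inr] at himg
  rw [sum_congr rfl h1, sum_congr rfl h2] at himg
  rw [htot]
  linarith

theorem exists_shear (T : Finset (ℝ × ℝ)) :
    ∃ ε : ℝ, Set.InjOn (fun p : ℝ × ℝ => (shear ε p).1) T := by
  obtain ⟨ε, hε⟩ := Infinite.exists_notMem_finset
    ((T ×ˢ T).image fun e => - (e.1.1 - e.2.1) / (e.1.2 - e.2.2))
  refine ⟨ε, fun p hp q hq h => ?_⟩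
  simp only [shear] at h
  by_cases h2 : p.2 = q.2
  · rw [h2] at h
    exact Prod.ext (by linarith) h2
  · refine absurd (mem_image.2 ⟨(p, q), mem_product.2 ⟨hp, hq⟩, ?_⟩) hε
    have : p.2 - q.2 ≠ 0 := sub_ne_zero.2 h2
    field_simp
    linarith

theorem mem_openSegment_of_shear {p q : ℝ × ℝ} {ε m c x : ℝ}
    (hp : m * (shear ε p).1 + c = (shear ε p).2) (hq : m * (shear ε q).1 + c = (shear ε q).2)
    (hpx : (shear ε p).1 < x) (hxq : x < (shear ε q).1) :
    (x - ε * (m * x + c), m * x + c) ∈ openSegment ℝ p q := by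
  have hd : 0 < (shear ε q).1 - (shear ε p).1 := by linarith
  set d := (shear ε q).1 - (shear ε p).1 with hdd
  refine ⟨((shear ε q).1 - x) / d, (x - (shear ε p).1) / d, div_pos (by linarith) hd,
    div_pos (by linarith) hd, by rw [← add_div, div_eq_one_iff_eq hd.ne', hdd]; ring, ?_⟩
  have hq1 : (shear ε q).1 = (shear ε p).1 + d := by rw [hdd]; ring
  have e2 : ((shear ε q).1 - x) / d * p.2 + (x - (shear ε p).1) / d * q.2 = m * x + c := by
    have h1 : p.2 = m * (shear ε p).1 + c := hp.symm
    have h2 : q.2 = m * (shear ε q).1 + c := hq.symm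
    rw [h1, h2, hq1]
    field_simp
    ring
  have e1 : ((shear ε q).1 - x) / d * (shear ε p).1 + (x - (shear ε p).1) / d * (shear ε q).1
      = x := by
    rw [hq1]
    field_simp
    ring
  refine Prod.ext ?_ e2
  simp only [Prod.fst_add, Prod.smul_fst, smul_eq_mul]
  rw [← e2]
  nth_rewrite 3 [← e1]
  simp only [shear]
  ring

/-- A planar straight-line graph. -/
structure IsPlane (T : Finset (ℝ × ℝ)) (E : Finset ((ℝ × ℝ) × (ℝ × ℝ))) : Prop where
  fst_mem : ∀ e ∈ E, e.1 ∈ T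
  snd_mem : ∀ e ∈ E, e.2 ∈ T
  ne : ∀ e ∈ E, e.1 ≠ e.2
  avoid : ∀ e ∈ E, ∀ p ∈ T, p ∉ openSegment ℝ e.1 e.2
  disj : ∀ e ∈ E, ∀ f ∈ E, e ≠ f → ∀ p, p ∈ openSegment ℝ e.1 e.2 → p ∉ openSegment ℝ f.1 f.2

/-- A planar straight-line graph is a planar system of segments after a shear. -/
theorem IsPlane.exists_system {T : Finset (ℝ × ℝ)} {E : Finset ((ℝ × ℝ) × (ℝ × ℝ))}
    (h : IsPlane T E) : ∃ (s : System E) (ε : ℝ) (idx : ℝ × ℝ → ℕ), s.N = #T ∧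
      (∀ p ∈ T, idx p < s.N ∧ s.p (idx p) = shear ε p) ∧ Set.InjOn idx T ∧
        ∀ e : E, (s.a e = idx e.1.1 ∧ s.b e = idx e.1.2) ∨
          (s.a e = idx e.1.2 ∧ s.b e = idx e.1.1) := by
  obtain ⟨ε, hε⟩ := exists_shear T
  set X : ℝ × ℝ → ℝ := fun p => (shear ε p).1 with hX
  set l := sortBy X T with hl
  have hpw : l.Pairwise fun p q => X p < X q := pairwise_sortBy hε
  have hlen : l.length = #T := by
    rw [hl, sortBy, List.length_insertionSort, length_toList]
  have hmem : ∀ {p}, p ∈ l ↔ p ∈ T := mem_sortBy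
  set idx : ℝ × ℝ → ℕ := fun p => l.idxOf p with hidx
  set pt : ℕ → ℝ × ℝ := fun i => l.getD i 0 with hpt
  have hidx_lt : ∀ p ∈ T, idx p < #T := fun p hp => hlen ▸ List.idxOf_lt_length_iff.2 (hmem.2 hp)
  have hpt_idx : ∀ p ∈ T, pt (idx p) = p := fun p hp => by
    have := hlen ▸ hidx_lt p hp
    simp only [hpt, hidx] at this ⊢
    rw [List.getD_eq_getElem _ _ this, List.getElem_idxOf]
  have hpt_mem : ∀ i < #T, pt i ∈ T := fun i hi => by
    rw [← hlen] at hi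
    simp only [hpt]
    rw [List.getD_eq_getElem _ _ hi]
    exact hmem.1 (List.getElem_mem hi)
  have hmono : ∀ i j, i < j → j < #T → X (pt i) < X (pt j) := by
    intro i j hij hj
    rw [← hlen] at hj
    simp only [hpt]
    rw [List.getD_eq_getElem _ _ hj, List.getD_eq_getElem _ _ (hij.trans hj)]
    exact List.pairwise_iff_getElem.1 hpw i j _ hj hij
  have hidx_mono : ∀ p ∈ T, ∀ q ∈ T, X p < X q → idx p < idx q := by
    intro p hp q hq hpq
    by_contra! hle
    rcases hle.eq_or_lt with hle | hle
    · rw [← hpt_idx p hp, ← hpt_idx q hq, hle] at hpq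
      exact lt_irrefl _ hpq
    · have := hmono _ _ hle (hidx_lt p hp)
      rw [hpt_idx p hp, hpt_idx q hq] at this
      exact lt_asymm this hpq
  set lf : E → ℝ × ℝ := fun e => if X e.1.1 < X e.1.2 then e.1.1 else e.1.2 with hlf
  set rg : E → ℝ × ℝ := fun e => if X e.1.1 < X e.1.2 then e.1.2 else e.1.1 with hrg
  have hends : ∀ e : E, (lf e = e.1.1 ∧ rg e = e.1.2) ∨ (lf e = e.1.2 ∧ rg e = e.1.1) := by
    intro e
    simp only [hlf, hrg]
    split_ifs <;> simp
  have hlr : ∀ e, X (lf e) < X (rg e) := by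
    intro e
    simp only [hlf, hrg]
    split_ifs with hc
    · exact hc
    · refine lt_of_le_of_ne (not_lt.1 hc) fun heq => h.ne e.1 e.2 ?_
      exact (hε (h.snd_mem e.1 e.2) (h.fst_mem e.1 e.2) heq).symm
  have hlfT : ∀ e, lf e ∈ T := fun e => by
    rcases hends e with hc | hc <;> rw [hc.1]
    exacts [h.fst_mem e.1 e.2, h.snd_mem e.1 e.2]
  have hrgT : ∀ e, rg e ∈ T := fun e => by
    rcases hends e with hc | hc <;> rw [hc.2]
    exacts [h.snd_mem e.1 e.2, h.fst_mem e.1 e.2]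
  have hseg : ∀ e, openSegment ℝ (lf e) (rg e) = openSegment ℝ e.1.1 e.1.2 := fun e => by
    rcases hends e with hc | hc <;> rw [hc.1, hc.2]
    exact openSegment_symm ℝ _ _
  set sl : E → ℝ := fun e => ((rg e).2 - (lf e).2) / (X (rg e) - X (lf e)) with hsl
  set ic : E → ℝ := fun e => (lf e).2 - sl e * X (lf e) with hic
  have hat_l : ∀ e, sl e * X (lf e) + ic e = (lf e).2 := fun e => by simp only [hic]; ring
  have hat_r : ∀ e, sl e * X (rg e) + ic e = (rg e).2 := fun e => by
    have : X (rg e) - X (lf e) ≠ 0 := (sub_pos.2 (hlr e)).ne'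
    have h1 : sl e * (X (rg e) - X (lf e)) = (rg e).2 - (lf e).2 := by
      simp only [hsl]
      field_simp
    simp only [hic]
    linarith
  refine ⟨{ N := #T, p := fun i => shear ε (pt i), a := fun e => idx (lf e),
            b := fun e => idx (rg e), sl := sl, ic := ic, mono := hmono,
            a_lt_b := fun e => hidx_mono _ (hlfT e) _ (hrgT e) (hlr e),
            b_lt := fun e => hidx_lt _ (hrgT e), at_a := ?_, at_b := ?_, avoid := ?_,
            cross := ?_ }, ε, idx, rfl, ?_, ?_, ?_⟩
  · intro e
    rw [hpt_idx _ (hlfT e)]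
    exact hat_l e
  · intro e
    rw [hpt_idx _ (hrgT e)]
    exact hat_r e
  · intro e i hai hib heq
    have hi := hib.trans (hidx_lt _ (hrgT e))
    have h1 := hmono _ _ hai hi
    have h2 := hmono _ _ hib (hidx_lt _ (hrgT e))
    rw [hpt_idx _ (hlfT e)] at h1
    rw [hpt_idx _ (hrgT e)] at h2
    have h3 := mem_openSegment_of_shear (hat_l e) (hat_r e) h1 h2
    rw [hseg, heq] at h3
    refine h.avoid e.1 e.2 (pt i) (hpt_mem i hi) ?_
    convert h3 using 1
    simp [hX, shear]
  · intro e f hef x hea hfa heb hfb heq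
    simp only [hpt_idx _ (hlfT e), hpt_idx _ (hlfT f), hpt_idx _ (hrgT e), hpt_idx _ (hrgT f)]
      at hea hfa heb hfb
    have h3 := mem_openSegment_of_shear (hat_l e) (hat_r e) hea heb
    have h4 := mem_openSegment_of_shear (hat_l f) (hat_r f) hfa hfb
    rw [hseg] at h3 h4
    rw [← heq] at h4
    exact h.disj e.1 e.2 f.1 f.2 (fun h' => hef (Subtype.ext h')) _ h3 h4
  · intro p hp
    exact ⟨hidx_lt p hp, by simp only [hpt_idx p hp]⟩
  · intro p hp q hq hpq
    rw [← hpt_idx p hp, hpq, hpt_idx q hq]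
  · intro e
    rcases hends e with hc | hc <;> simp only [hc.1, hc.2, and_self, true_or, or_true]

theorem mem_zip_tail {α : Type*} {l : List α} {p q : α} :
    (p, q) ∈ l.zip l.tail ↔ Cons l p q := by
  induction l with
  | nil => simpa using not_cons_nil
  | cons a l ih =>
    cases l with
    | nil => simpa using not_cons_singleton
    | cons b l =>
      rw [cons_cons_iff, ← ih]
      simp [eq_comm]

theorem polylineOf_singleton (p : ℝ × ℝ) : polylineOf [p] = ∅ := by simp [polylineOf]

theorem polylineOf_cons_cons (p q : ℝ × ℝ) (l : List (ℝ × ℝ)) :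
    polylineOf (p :: q :: l) = segment ℝ p q ∪ polylineOf (q :: l) := by
  simp [polylineOf, Set.iUnion_or, Set.iUnion_union_distrib]

theorem polylineOf_append (l : List (ℝ × ℝ)) (q : ℝ × ℝ) (l' : List (ℝ × ℝ)) :
    polylineOf (l ++ q :: l') = polylineOf (l ++ [q]) ∪ polylineOf (q :: l') := by
  induction l with
  | nil => simp [polylineOf_singleton]
  | cons p l ih =>
    cases l with
    | nil => simp [polylineOf_cons_cons, polylineOf_singleton]
    | cons r l =>
      simp only [List.cons_append, polylineOf_cons_cons] at ih ⊢
      rw [ih, Set.union_assoc]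

theorem segment_subset_polylineOf {l : List (ℝ × ℝ)} {p q : ℝ × ℝ} (h : Cons l p q) :
    segment ℝ p q ⊆ polylineOf l :=
  Set.subset_biUnion_of_mem (u := fun e : (ℝ × ℝ) × (ℝ × ℝ) => segment ℝ e.1 e.2)
    (show (p, q) ∈ {e | e ∈ l.zip l.tail} from mem_zip_tail.2 h)

theorem mem_polylineOf {l : List (ℝ × ℝ)} {p q x : ℝ × ℝ} (hx : x ∈ p :: q :: l) :
    x ∈ polylineOf (p :: q :: l) := by
  induction l generalizing p q with
  | nil =>
    rw [polylineOf_cons_cons]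
    rcases List.mem_pair.1 hx with rfl | rfl
    exacts [Or.inl (left_mem_segment ℝ _ _), Or.inl (right_mem_segment ℝ _ _)]
  | cons r l ih =>
    rw [polylineOf_cons_cons]
    rcases List.mem_cons.1 hx with rfl | hx
    exacts [Or.inl (left_mem_segment ℝ _ _), Or.inr (ih hx)]

/-- `l` is a polyline from `P` to `Q` within `C`. -/
def IsPolylineIn (C : Set (ℝ × ℝ)) (P Q : ℝ × ℝ) (l : List (ℝ × ℝ)) : Prop :=
  l.head? = some P ∧ l.getLast? = some Q ∧ polylineOf l ⊆ C

/-- A polyline without redundant points. -/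
structure IsReducedPolyline (l : List (ℝ × ℝ)) : Prop where
  ne : ∀ {p q}, Cons l p q → p ≠ q
  avoid : ∀ {p q x}, Cons l p q → x ∈ l → x ∉ openSegment ℝ p q
  disj : ∀ {p q p' q' x}, Cons l p q → Cons l p' q' → (p, q) ≠ (p', q') →
    x ∈ openSegment ℝ p q → x ∉ openSegment ℝ p' q'

theorem getLast?_append_cons {α : Type*} (l : List α) (a : α) (l' : List α) :
    (l ++ a :: l').getLast? = (a :: l').getLast? := by
  rw [List.getLast?_append_of_ne_nil _ (List.cons_ne_nil _ _)]

section
variable {C : Set (ℝ × ℝ)} {P Q : ℝ × ℝ}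

theorem IsPolylineIn.replace {A M B M' : List (ℝ × ℝ)} {q r : ℝ × ℝ}
    (h : IsPolylineIn C P Q (A ++ q :: (M ++ r :: B)))
    (hM' : polylineOf (q :: (M' ++ [r])) ⊆ C) :
    IsPolylineIn C P Q (A ++ q :: (M' ++ r :: B)) := by
  obtain ⟨h1, h2, h3⟩ := h
  refine ⟨?_, ?_, ?_⟩
  · rw [← h1]
    cases A <;> simp
  · rw [← h2, getLast?_append_cons, getLast?_append_cons, ← List.cons_append, ← List.cons_append,
      getLast?_append_cons, getLast?_append_cons]
  · rw [polylineOf_append, ← List.cons_append, polylineOf_append _ r] at h3 ⊢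
    simp only [Set.union_subset_iff, List.cons_append] at h3 ⊢
    exact ⟨h3.1, hM', h3.2.2⟩

theorem IsPolylineIn.contract {A M B : List (ℝ × ℝ)} {q : ℝ × ℝ}
    (h : IsPolylineIn C P Q (A ++ q :: (M ++ q :: B))) : IsPolylineIn C P Q (A ++ q :: B) := by
  obtain ⟨h1, h2, h3⟩ := h
  refine ⟨?_, ?_, ?_⟩
  · rw [← h1]
    cases A <;> simp
  · rw [← h2, getLast?_append_cons, getLast?_append_cons, ← List.cons_append,
      getLast?_append_cons]
  · rw [polylineOf_append, ← List.cons_append, polylineOf_append (q :: M) q B] at h3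
    rw [polylineOf_append]
    simp only [Set.union_subset_iff, List.cons_append] at h3 ⊢
    exact ⟨h3.1, h3.2.2⟩

theorem segment_subset_of_overlap {p q r x : ℝ × ℝ} (hp : x ∈ openSegment ℝ p r)
    (hq : x ∈ openSegment ℝ r q) : segment ℝ p q ⊆ segment ℝ p r ∪ segment ℝ r q := by
  obtain ⟨a, b, ha, hb, hab, rfl⟩ := hp
  obtain ⟨a', b', ha', hb', hab', h⟩ := hq
  have hb1 : b = 1 - a := by linarith
  have ha1 : a' = 1 - b' := by linarith
  subst hb1 ha1
  have key1 : b' * q.1 = a * p.1 + (b' - a) * r.1 := by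
    have := congrArg Prod.fst h
    simp at this
    linarith
  have key2 : b' * q.2 = a * p.2 + (b' - a) * r.2 := by
    have := congrArg Prod.snd h
    simp at this
    linarith
  rcases le_total a b' with hle | hle
  · refine (?_ : segment ℝ p q ⊆ segment ℝ p r).trans Set.subset_union_left
    refine (convex_segment _ _).segment_subset (left_mem_segment ℝ _ _) ?_
    refine ⟨a / b', (b' - a) / b', by positivity, div_nonneg (by linarith) hb'.le,
      by field_simp; ring, Prod.ext ?_ ?_⟩ <;> simp <;> field_simp <;> linarith
  · refine (?_ : segment ℝ p q ⊆ segment ℝ r q).trans Set.subset_union_right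
    refine (convex_segment _ _).segment_subset ?_ (right_mem_segment ℝ _ _)
    refine ⟨(a - b') / a, b' / a, div_nonneg (by linarith) ha.le, by positivity,
      by field_simp; ring, Prod.ext ?_ ?_⟩ <;> simp <;> field_simp <;> linarith

theorem IsPolylineIn.isReducedPolyline {L : List (ℝ × ℝ)} (h : IsPolylineIn C P Q L)
    (hmin : ∀ L', IsPolylineIn C P Q L' → L.length ≤ L'.length) : IsReducedPolyline L := by
  have hrep : ∀ {A M B M' : List (ℝ × ℝ)} {q r : ℝ × ℝ}, L = A ++ q :: (M ++ r :: B) →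
      polylineOf (q :: (M' ++ [r])) ⊆ C → M.length ≤ M'.length := by
    rintro A M B M' q r hL hM'
    rw [hL] at h
    have := hmin _ (h.replace hM')
    simp only [hL, List.length_append, List.length_cons] at this
    omega
  have hne : ∀ {p q}, Cons L p q → p ≠ q := by
    rintro p q ⟨A, B, hL⟩ rfl
    have h' := h
    rw [hL] at h'
    have := hmin _ (IsPolylineIn.contract (M := []) h')
    simp only [hL, List.length_append, List.length_cons] at this
    omega
  have hsub : ∀ {p q}, Cons L p q → segment ℝ p q ⊆ C := fun hc =>
    (segment_subset_polylineOf hc).trans h.2.2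
  have havoid : ∀ {p q x}, Cons L p q → x ∈ L → x ∉ openSegment ℝ p q := by
    intro p q x hc hx hxo
    have hpq := hne hc
    have hxs := openSegment_subset_segment ℝ _ _ hxo
    have hC := hsub hc
    obtain ⟨A, B, hL⟩ := hc
    rw [hL] at hx
    rcases List.mem_append.1 hx with hx | hx
    · obtain ⟨A₁, A₂, rfl⟩ := List.append_of_mem hx
      have := hrep (A := A₁) (M := A₂ ++ [p]) (B := B) (q := x) (r := q) (M' := [])
        (by simp [hL]) ?_
      · simp at this
      · simp only [List.nil_append, polylineOf_cons_cons, polylineOf_singleton, Set.union_empty]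
        exact ((convex_segment _ _).segment_subset hxs (right_mem_segment ℝ _ _)).trans hC
    · rcases List.mem_cons.1 hx with rfl | hx
      · exact hpq (left_mem_openSegment_iff.1 hxo)
      rcases List.mem_cons.1 hx with rfl | hx
      · exact hpq (right_mem_openSegment_iff.1 hxo)
      obtain ⟨B₁, B₂, rfl⟩ := List.append_of_mem hx
      have := hrep (A := A) (M := q :: B₁) (B := B₂) (q := p) (r := x) (M' := []) (by simp [hL]) ?_
      · simp at this
      · simp only [List.nil_append, polylineOf_cons_cons, polylineOf_singleton, Set.union_empty]
        exact ((convex_segment _ _).segment_subset (left_mem_segment ℝ _ _) hxs).trans hC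
  have hdisj : ∀ {A B : List (ℝ × ℝ)} {p q p' q' x}, L = A ++ p :: q :: B →
      Cons (q :: B) p' q' → x ∈ openSegment ℝ p q → x ∉ openSegment ℝ p' q' := by
    rintro A B p q p' q' x hL ⟨B₁, B₂, hB⟩ hx hx'
    have hC : segment ℝ p q ⊆ C := hsub ⟨A, B, hL⟩
    have hC' : segment ℝ p' q' ⊆ C := hsub ⟨A ++ p :: B₁, B₂, by simp [hL, hB]⟩
    cases B₁ with
    | nil =>
      obtain ⟨rfl, rfl⟩ : q = p' ∧ B = q' :: B₂ := by simpa using hB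
      have := hrep (A := A) (M := [q]) (B := B₂) (q := p) (r := q') (M' := []) (by simp [hL]) ?_
      · simp at this
      · simp only [List.nil_append, polylineOf_cons_cons, polylineOf_singleton, Set.union_empty]
        exact (segment_subset_of_overlap hx hx').trans (Set.union_subset hC hC')
    | cons d B₁ =>
      obtain ⟨rfl, rfl⟩ : q = d ∧ B = B₁ ++ p' :: q' :: B₂ := by simpa using hB
      have := hrep (A := A) (M := q :: (B₁ ++ [p'])) (B := B₂) (q := p) (r := q') (M' := [x])
        (by simp [hL]) ?_
      · simp at this
      · simp only [List.cons_append, List.nil_append, polylineOf_cons_cons, polylineOf_singleton,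
          Set.union_empty]
        have hxs := openSegment_subset_segment ℝ _ _ hx
        have hxs' := openSegment_subset_segment ℝ _ _ hx'
        exact Set.union_subset
          (((convex_segment _ _).segment_subset (left_mem_segment ℝ _ _) hxs).trans hC)
          (((convex_segment _ _).segment_subset hxs' (right_mem_segment ℝ _ _)).trans hC')
  refine ⟨hne, havoid, fun {p q p' q' x} hc hc' hneq hx hx' => ?_⟩
  obtain ⟨A, B, hL⟩ := hc
  rw [hL, cons_append_iff, cons_cons_iff] at hc'
  rcases hc' with ⟨A₁, A₂, hA⟩ | ⟨rfl, rfl⟩ | hc'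
  · rcases List.eq_nil_or_concat' (q' :: A₂) with h0 | ⟨A₃, z, h3⟩
    · simp at h0
    · have hz : A = A₁ ++ p' :: A₃ ∧ p = z := by
        rw [h3, ← List.cons_append, ← List.append_assoc] at hA
        exact List.append_singleton_inj.1 hA
      obtain ⟨rfl, rfl⟩ := hz
      have h4 : q' :: (A₂ ++ q :: B) = A₃ ++ p :: q :: B := by
        rw [← List.cons_append, h3, List.append_assoc]
        rfl
      refine hdisj (A := A₁) (B := A₂ ++ q :: B) (p := p') (q := q') ?_ ⟨A₃, B, h4⟩ hx' hx
      rw [hL, h4, List.append_assoc]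
      rfl
  · exact hneq rfl
  · exact hdisj hL hc' hx hx'

/-- Every polyline can be replaced by a reduced one. -/
theorem exists_isReducedPolyline {l : List (ℝ × ℝ)} (hPQ : P ≠ Q)
    (hl : polylineOf (P :: (l ++ [Q])) ⊆ C) :
    ∃ l' : List (ℝ × ℝ), l'.length ≤ l.length ∧ polylineOf (P :: (l' ++ [Q])) ⊆ C ∧
      IsReducedPolyline (P :: (l' ++ [Q])) := by
  have hP : IsPolylineIn C P Q (P :: (l ++ [Q])) :=
    ⟨rfl, by rw [← List.cons_append, List.getLast?_concat], hl⟩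
  have hex : ∃ k L, IsPolylineIn C P Q L ∧ L.length = k :=
    ⟨_, _, hP, rfl⟩
  obtain ⟨L, hL, hk⟩ := Nat.find_spec hex
  have hmin : ∀ L', IsPolylineIn C P Q L' → L.length ≤ L'.length := fun L' hL' => by
    rw [hk]
    exact Nat.find_min' hex ⟨L', hL', rfl⟩
  have hred := hL.isReducedPolyline hmin
  have hlen := hmin _ hP
  obtain ⟨h1, h2, h3⟩ := hL
  cases L with
  | nil => simp at h1
  | cons p L =>
    obtain rfl : p = P := by simpa using h1
    rcases List.eq_nil_or_concat' L with rfl | ⟨l', q, rfl⟩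
    · exact absurd (by simpa using h2) hPQ
    · obtain rfl : q = Q := by
        rwa [← List.cons_append, List.getLast?_concat, Option.some_inj] at h2
      refine ⟨l', ?_, h3, hred⟩
      simp only [List.length_cons, List.length_append] at hlen
      omega

end

theorem mem_polylineOf_concat {P Q x : ℝ × ℝ} {l : List (ℝ × ℝ)} (hx : x ∈ P :: (l ++ [Q])) :
    x ∈ polylineOf (P :: (l ++ [Q])) := by
  cases l <;> exact mem_polylineOf hx

theorem openSegment_subset_polylineOf {l : List (ℝ × ℝ)} {p q : ℝ × ℝ} (h : Cons l p q) :
    openSegment ℝ p q ⊆ polylineOf l :=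
  (openSegment_subset_segment ℝ p q).trans (segment_subset_polylineOf h)

theorem eq_last_of_cons {α κ : Type*} {f : α → κ} {q : α} {l : List α} {p : α}
    (hf : ∀ a b, Cons (p :: (l ++ [q])) a b → f a = f b) : f p = f q := by
  induction l generalizing p with
  | nil => exact hf p q ⟨[], [], rfl⟩
  | cons r l ih =>
    exact (hf p r ⟨[], l ++ [q], rfl⟩).trans
      (ih fun a b h => hf a b (cons_cons_iff.2 (Or.inr h)))

theorem IsPolylineDrawing.exists_layout {n : ℕ} {G : SimpleGraph (Fin n)} {π : Fin n → ℝ × ℝ}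
    {bends : Fin n → Fin n → List (ℝ × ℝ)} (h : IsPolylineDrawing G π bends)
    (hπ : Function.Injective π) {g : Fin n → Fin n} {root : Fin n}
    (adj : ∀ v, v ≠ root → G.Adj v (g v))
    (inj : ∀ u v, u ≠ root → v ≠ root → s(u, g u) = s(v, g v) → u = v) :
    ∃ L : Layout π g root, (L.s.N + Fintype.card L.σ : ℝ) ≤
      2 * n + 2 * ∑ v ∈ univ.erase root, (bends v (g v)).length := by
  set C : Fin n → Set (ℝ × ℝ) := fun v => edgeCurve π bends v (g v) with hC
  have hvert : ∀ v, v ≠ root → ∀ w, π w ∈ C v → w = v ∨ w = g v := by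
    intro v hv w hw
    by_contra! hne
    exact h.noVertex _ _ w (adj v hv) hne.1 hne.2 hw
  have hmeet : ∀ v w, v ≠ root → w ≠ root → v ≠ w → ∀ x, x ∈ C v → x ∈ C w →
      ∃ u, (u = v ∨ u = g v) ∧ (u = w ∨ u = g w) ∧ π u = x := by
    intro v w hv hw hvw x hxv hxw
    have hx : x ∈ C v ∩ C w := ⟨hxv, hxw⟩
    simp only [hC] at hx
    rw [h.inter _ _ _ _ (adj v hv) (adj w hw) fun he => hvw (inj v w hv hw he)] at hx
    obtain ⟨u, hu, rfl⟩ := hx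
    exact ⟨u, hu.1, hu.2, rfl⟩
  have hex : ∀ v, ∃ l' : List (ℝ × ℝ), v ≠ root → l'.length ≤ (bends v (g v)).length ∧
      polylineOf (π v :: (l' ++ [π (g v)])) ⊆ C v ∧
      IsReducedPolyline (π v :: (l' ++ [π (g v)])) := by
    intro v
    by_cases hv : v = root
    · exact ⟨[], fun hv' => absurd hv hv'⟩
    · obtain ⟨l', hl'⟩ := exists_isReducedPolyline (l := bends v (g v))
        (hπ.ne (adj v hv).ne) (subset_refl _)
      exact ⟨l', fun _ => hl'⟩
  choose l hl using hex
  set L : Fin n → List (ℝ × ℝ) := fun v => π v :: (l v ++ [π (g v)]) with hL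
  have hlen : ∀ v, v ≠ root → (l v).length ≤ (bends v (g v)).length := fun v hv => (hl v hv).1
  have hsub : ∀ v, v ≠ root → polylineOf (L v) ⊆ C v := fun v hv => (hl v hv).2.1
  have hred : ∀ v, v ≠ root → IsReducedPolyline (L v) := fun v hv => (hl v hv).2.2
  have hLC : ∀ v, v ≠ root → ∀ x ∈ L v, x ∈ C v := fun v hv x hx =>
    hsub v hv (mem_polylineOf_concat hx)
  set T : Finset (ℝ × ℝ) := univ.image π ∪ (univ.erase root).biUnion fun v => (l v).toFinset
    with hT
  set E : Finset ((ℝ × ℝ) × (ℝ × ℝ)) :=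
    (univ.erase root).biUnion fun v => ((L v).zip (L v).tail).toFinset with hE
  have hmemE : ∀ {e}, e ∈ E ↔ ∃ v, v ≠ root ∧ Cons (L v) e.1 e.2 := by
    rintro ⟨p, q⟩
    simp only [hE, mem_biUnion, mem_erase, mem_univ, and_true, List.mem_toFinset, mem_zip_tail]
  have hπT : ∀ v, π v ∈ T := fun v => mem_union_left _ (mem_image_of_mem _ (mem_univ v))
  have hmemT : ∀ {x}, x ∈ T ↔ (∃ v, π v = x) ∨ ∃ v, v ≠ root ∧ x ∈ l v := by
    intro x
    simp [hT]
  have hLT : ∀ v, v ≠ root → ∀ x ∈ L v, x ∈ T := by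
    intro v hv x hx
    rcases List.mem_cons.1 hx with rfl | hx
    · exact hπT v
    rcases List.mem_append.1 hx with hx | hx
    · exact hmemT.2 (Or.inr ⟨v, hv, hx⟩)
    · exact List.mem_singleton.1 hx ▸ hπT _
  have hlL : ∀ v, ∀ x ∈ l v, x ∈ L v := fun v x hx =>
    List.mem_cons_of_mem _ (List.mem_append_left _ hx)
  have hend : ∀ v u, (u = v ∨ u = g v) → π u ∈ L v := by
    rintro v u (rfl | rfl) <;> simp [hL]
  have hvavoid : ∀ v, v ≠ root → ∀ p q, Cons (L v) p q → ∀ u, π u ∉ openSegment ℝ p q := by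
    intro v hv p q hc u hu
    have huC := hsub v hv (openSegment_subset_polylineOf hc hu)
    exact (hred v hv).avoid hc (hend v u (hvert v hv u huC)) hu
  have hplane : IsPlane T E := by
    refine ⟨fun e he => ?_, fun e he => ?_, fun e he => ?_, fun e he x hx hxe => ?_,
      fun e he f hf hef x hxe hxf => ?_⟩ <;> obtain ⟨v, hv, hc⟩ := hmemE.1 he
    · exact hLT v hv _ hc.mem_left
    · exact hLT v hv _ hc.mem_right
    · exact (hred v hv).ne hc
    · rcases hmemT.1 hx with ⟨u, rfl⟩ | ⟨w, hw, hxw⟩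
      · exact hvavoid v hv _ _ hc u hxe
      · by_cases hvw : v = w
        · subst hvw
          exact (hred v hv).avoid hc (hlL v x hxw) hxe
        · obtain ⟨u, -, -, rfl⟩ := hmeet v w hv hw hvw x
            (hsub v hv (openSegment_subset_polylineOf hc hxe)) (hLC w hw _ (hlL w x hxw))
          exact hvavoid v hv _ _ hc u hxe
    · obtain ⟨w, hw, hcw⟩ := hmemE.1 hf
      by_cases hvw : v = w
      · subst hvw
        exact (hred v hv).disj hc hcw hef hxe hxf
      · obtain ⟨u, -, -, rfl⟩ := hmeet v w hv hw hvw x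
          (hsub v hv (openSegment_subset_polylineOf hc hxe))
          (hsub w hw (openSegment_subset_polylineOf hcw hxf))
        exact hvavoid v hv _ _ hc u hxe
  obtain ⟨s, ε, idx, hN, hidx, hinj, hends⟩ := hplane.exists_system
  set own : ℕ → Fin n := fun i =>
    if hi : ∃ w, idx (π w) = i then hi.choose
    else if hi : ∃ v, v ≠ root ∧ ∃ x ∈ l v, idx x = i then hi.choose else root with hown
  have hownπ : ∀ v, own (idx (π v)) = v := by
    intro v
    have hi : ∃ w, idx (π w) = idx (π v) := ⟨v, rfl⟩
    simp only [hown, dif_pos hi]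
    exact hπ (hinj (hπT _) (hπT _) hi.choose_spec)
  have hownL : ∀ v, v ≠ root → ∀ x ∈ L v, x ≠ π (g v) → own (idx x) = v := by
    intro v hv x hx hxg
    by_cases hxπ : ∃ u, π u = x
    · obtain ⟨u, rfl⟩ := hxπ
      rcases hvert v hv u (hLC v hv _ hx) with rfl | rfl
      exacts [hownπ u, absurd rfl hxg]
    have hxl : x ∈ l v := by
      rcases List.mem_cons.1 hx with rfl | hx
      · exact absurd ⟨v, rfl⟩ hxπ
      rcases List.mem_append.1 hx with hx | hx
      exacts [hx, absurd (List.mem_singleton.1 hx) hxg]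
    have hi : ¬ ∃ w, idx (π w) = idx x := fun ⟨w, hw⟩ =>
      hxπ ⟨w, hinj (hπT w) (hLT v hv x hx) hw⟩
    have hi' : ∃ w, w ≠ root ∧ ∃ y ∈ l w, idx y = idx x := ⟨v, hv, x, hxl, rfl⟩
    simp only [hown, dif_neg hi, dif_pos hi']
    obtain ⟨hw, y, hy, hyx⟩ := hi'.choose_spec
    obtain rfl := hinj (hLT _ hw y (hlL _ y hy)) (hLT v hv x hx) hyx
    by_contra hne
    obtain ⟨u, -, -, hu⟩ := hmeet _ v hw hv hne y (hLC _ hw y (hlL _ y hy)) (hLC v hv y hx)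
    exact hxπ ⟨u, hu⟩
  refine ⟨⟨E, inferInstance, s, ε, fun v => idx (π v), own, fun u v huv => ?_,
    fun v => (hidx _ (hπT v)).1, fun v => (hidx _ (hπT v)).2, hownπ,
    fun v hv κ f Z hf hZ hg => ?_⟩, ?_⟩
  · exact hπ (hinj (hπT u) (hπT v) huv)
  · have hLZ : ∀ x ∈ L v, idx x ∉ Z := by
      intro x hx hxZ
      by_cases hxg : x = π (g v)
      · exact hg (hxg ▸ hxZ)
      · exact hZ _ hxZ (hownL v hv x hx hxg)
    refine eq_last_of_cons (f := fun x => f (idx x)) (l := l v) fun a b hc => ?_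
    have ha := hLZ a hc.mem_left
    have hb := hLZ b hc.mem_right
    have := hf ⟨(a, b), hmemE.2 ⟨v, hv, hc⟩⟩
    rcases hends ⟨(a, b), hmemE.2 ⟨v, hv, hc⟩⟩ with ⟨h1, h2⟩ | ⟨h1, h2⟩ <;> rw [h1, h2] at this
    exacts [this ha hb, (this hb ha).symm]
  · have hcT : #T ≤ n + ∑ v ∈ univ.erase root, (bends v (g v)).length := by
      refine (card_union_le _ _).trans (Nat.add_le_add ?_ (card_biUnion_le.trans ?_))
      · exact card_image_le.trans (by simp)
      · exact sum_le_sum fun v hv =>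
          (List.toFinset_card_le _).trans (hlen v (mem_erase.1 hv).1)
    have hcE : #E ≤ n + ∑ v ∈ univ.erase root, (bends v (g v)).length := by
      calc #E ≤ ∑ v ∈ univ.erase root, (1 + (bends v (g v)).length) := by
            refine card_biUnion_le.trans (sum_le_sum fun v hv => ?_)
            refine (List.toFinset_card_le _).trans ?_
            have := hlen v (mem_erase.1 hv).1
            simp [hL]
            omega
        _ = #(univ.erase root) + ∑ v ∈ univ.erase root, (bends v (g v)).length := by
            simp [sum_add_distrib]
        _ ≤ _ := Nat.add_le_add_right ((card_le_univ _).trans (by simp)) _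
    have hcE' : Fintype.card E = #E := Fintype.card_coe E
    have hsum : s.N + Fintype.card E ≤
        2 * n + 2 * ∑ v ∈ univ.erase root, (bends v (g v)).length := by omega
    exact_mod_cast hsum

/-- There are constants `c > 0` and `N` such that for all `n ≥ N` and every injective
vertex mapping `π : Fin n → ℝ²`, the number of trees on `Fin n` (connected acyclic
simple graphs) admitting a polyline drawing with vertex mapping `π` and at most
`c·n²` total bends is at most `2^{-n}·n^{n-2}`. -/
theorem count_few_bend_trees :
    ∃ c : ℝ, 0 < c ∧ ∃ N : ℕ, ∀ n : ℕ, N ≤ n →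
      ∀ π : Fin n → ℝ × ℝ, Function.Injective π →
      (Nat.card {G : SimpleGraph (Fin n) // G.Connected ∧ G.IsAcyclic ∧
          ∃ bends : Fin n → Fin n → List (ℝ × ℝ),
            IsPolylineDrawing G π bends ∧ totalBends G bends ≤ c * (n : ℝ) ^ 2} : ℝ) ≤
        (2 : ℝ) ^ (-(n : ℤ)) * (n : ℝ) ^ (n - 2) := by
  obtain ⟨c, hc, N, hcount⟩ := card_functions_of_layout
  refine ⟨c, hc, max N 2, fun n hn π hπ => ?_⟩
  have hn2 : 2 ≤ n := (le_max_right _ _).trans hn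
  set root : Fin n := ⟨0, by omega⟩
  set Tr := {G : SimpleGraph (Fin n) // G.Connected ∧ G.IsAcyclic ∧
    ∃ bends : Fin n → Fin n → List (ℝ × ℝ),
      IsPolylineDrawing G π bends ∧ totalBends G bends ≤ c * (n : ℝ) ^ 2}
  have hpar := fun G : Tr => SimpleGraph.IsTree.exists_parent ⟨G.2.1, G.2.2.1⟩ root
  choose par adj inj iff using hpar
  have hparinj : Function.Injective par := fun G H hGH =>
    Subtype.ext (SimpleGraph.ext (funext fun u => funext fun v => propext
      ((iff G u v).trans (hGH ▸ (iff H u v).symm))))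
  have hF := hcount n ((le_max_left _ _).trans hn) π root (univ.image par) fun g hg => by
    obtain ⟨G, -, rfl⟩ := mem_image.1 hg
    obtain ⟨bends, hd, hb⟩ := G.2.2.2
    obtain ⟨L, hL⟩ := hd.exists_layout hπ (adj G) (inj G)
    have := sum_bends_le hd.symm (adj G) (inj G)
    refine ⟨L, hL.trans ?_⟩
    push_cast
    linarith
  rw [card_image_of_injective _ hparinj, card_univ, ← Nat.card_eq_fintype_card] at hF
  refine hF.trans ?_
  have hpow : (n : ℝ) ^ n = (n : ℝ) ^ (n - 2) * (n : ℝ) ^ 2 := by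
    rw [← pow_add, Nat.sub_add_cancel hn2]
  have hlt : (n : ℝ) ≤ 2 ^ n := by exact_mod_cast Nat.lt_two_pow_self.le
  have hsq : (n : ℝ) ^ 2 * (1 / 2) ^ (4 * n) ≤ 1 := by
    have h1 : ((1 : ℝ) / 2) ^ (4 * n) = 1 / (2 ^ n) ^ 4 := by
      rw [one_div_pow, ← pow_mul, mul_comm]
    have h2 : (1 : ℝ) ≤ 2 ^ n := one_le_pow₀ (by norm_num)
    rw [h1, mul_one_div, div_le_one (by positivity)]
    calc (n : ℝ) ^ 2 ≤ (2 ^ n) ^ 2 := by gcongr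
      _ ≤ (2 ^ n) ^ 4 := pow_le_pow_right₀ h2 (by norm_num)
  have h5 : ((1 : ℝ) / 2) ^ (5 * n) = (1 / 2) ^ (4 * n) * 2 ^ (-(n : ℤ)) := by
    rw [show 5 * n = 4 * n + n by ring, pow_add, zpow_neg, zpow_natCast, one_div, inv_pow _ n]
  calc (n : ℝ) ^ n * (1 / 2) ^ (5 * n)
      = ((n : ℝ) ^ 2 * (1 / 2) ^ (4 * n)) * (2 ^ (-(n : ℤ)) * (n : ℝ) ^ (n - 2)) := by
        rw [hpow, h5]
        ring
    _ ≤ 1 * (2 ^ (-(n : ℤ)) * (n : ℝ) ^ (n - 2)) := by gcongr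
    _ = _ := one_mul _
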